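/- (Time-varying peak-power.) Assume Ω₂ is nonempty and there exists (x₁, x₂) ∈ [0, A₁]×[0, A₂] with p₁·x₁² + p₂·x₂² < P and p₁·ℰ(x₁) + p₂·ℰ(x₂) > E_req. Then any maximizer F* of I over Ω₂ has finite topological support; i.e., the optimal input distribution for the time-varying peak-power SWIPT problem is supported on finitely many points of [0, A₁]×[0, A₂]. -/

import Mathlib

open MeasureTheory Real Set Filter

/-- Phase-removed Rayleigh-fading channel density `p(y|x)`. -/
noncomputable def pcond (x y : ℝ) : ℝ := (1 / (1 + x ^ 2)) * Real.exp (-y / (1 + x ^ 2))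

/-- Modified Bessel function of the first kind, order zero. -/
noncomputable def besselI0 (t : ℝ) : ℝ := ∑' n : ℕ, (t ^ 2 / 4) ^ n / ((Nat.factorial n : ℝ)) ^ 2

/-- Harvested-energy function `ℰ(x) = I₀(√2 B h₂ x)`. -/
noncomputable def EH (B h2 x : ℝ) : ℝ := besselI0 (Real.sqrt 2 * B * h2 * x)

/-- Output density `p(y; F)`. -/
noncomputable def pout (F : Measure ℝ) (y : ℝ) : ℝ := ∫ x, pcond x y ∂F

/-- Mutual-information density `i(x; F)`. -/
noncomputable def idens (F : Measure ℝ) (x : ℝ) : ℝ :=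
  ∫ y in Set.Ioi (0 : ℝ), pcond x y * Real.log (pcond x y / pout F y)

/-- Mutual information `I(F)`. -/
noncomputable def MI (F : Measure ℝ) : ℝ := ∫ x, idens F x ∂F

/-- Borel probability measure concentrated on `[0, A]`. -/
def IsDistOn (A : ℝ) (F : Measure ℝ) : Prop :=
  IsProbabilityMeasure F ∧ F (Set.Icc 0 A)ᶜ = 0

/-- The feasible set `Ω`: probability measures on `[0,A]` meeting the AP and EH constraints. -/
def Feas (A P B h2 Ereq : ℝ) (F : Measure ℝ) : Prop :=
  IsDistOn A F ∧ (∫ x, x ^ 2 ∂F) ≤ P ∧ Ereq ≤ ∫ x, EH B h2 x ∂F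

/-- Information-energy capacity `C = sup_{F ∈ Ω} I(F)`. -/
noncomputable def Cap (A P B h2 Ereq : ℝ) : ℝ :=
  sSup (MI '' {F | Feas A P B h2 Ereq F})

/-- Topological support of a measure: points all of whose open neighborhoods have
positive measure (the smallest closed set of full measure). -/
def msupp {X : Type*} [TopologicalSpace X] [MeasurableSpace X] (μ : Measure X) : Set X :=
  {x | ∀ U : Set X, IsOpen U → x ∈ U → 0 < μ U}

/-- Extended (Shannon-strategy) channel density `f(y|x₁,x₂) = p₁ p(y|x₁) + p₂ p(y|x₂)`. -/
noncomputable def fcond (p1 p2 : ℝ) (x : ℝ × ℝ) (y : ℝ) : ℝ :=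
  p1 * pcond x.1 y + p2 * pcond x.2 y

/-- Output density `f(y; F)` of the extended channel. -/
noncomputable def fout (p1 p2 : ℝ) (F : Measure (ℝ × ℝ)) (y : ℝ) : ℝ :=
  ∫ x, fcond p1 p2 x y ∂F

/-- Mutual-information density `i(x₁, x₂; F)` of the extended channel. -/
noncomputable def idens2 (p1 p2 : ℝ) (F : Measure (ℝ × ℝ)) (x : ℝ × ℝ) : ℝ :=
  ∫ y in Set.Ioi (0 : ℝ), fcond p1 p2 x y * Real.log (fcond p1 p2 x y / fout p1 p2 F y)

/-- Mutual information `I(F)` of the extended channel. -/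
noncomputable def MI2 (p1 p2 : ℝ) (F : Measure (ℝ × ℝ)) : ℝ := ∫ x, idens2 p1 p2 F x ∂F

/-- Borel probability measure concentrated on `[0, A₁] × [0, A₂]`. -/
def IsDistOn2 (A1 A2 : ℝ) (F : Measure (ℝ × ℝ)) : Prop :=
  IsProbabilityMeasure F ∧ F (Set.Icc 0 A1 ×ˢ Set.Icc 0 A2)ᶜ = 0

/-- The feasible set `Ω₂` for the time-varying peak-power problem. -/
def Feas2 (A1 A2 p1 p2 P B h2 Ereq : ℝ) (F : Measure (ℝ × ℝ)) : Prop :=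
  IsDistOn2 A1 A2 F ∧ (∫ x : ℝ × ℝ, (p1 * x.1 ^ 2 + p2 * x.2 ^ 2) ∂F) ≤ P ∧
    Ereq ≤ ∫ x : ℝ × ℝ, (p1 * EH B h2 x.1 + p2 * EH B h2 x.2) ∂F

/-- Capacity `sup_{F ∈ Ω₂} I(F)` for the time-varying peak-power problem. -/
noncomputable def Cap2 (A1 A2 p1 p2 P B h2 Ereq : ℝ) : ℝ :=
  sSup (MI2 p1 p2 '' {F | Feas2 A1 A2 p1 p2 P B h2 Ereq F})

open Topology

/-- The point `(p + κ h, S (e √(Z² - A)))` lies on the zero set of `R`, and `A < Z²` there. -/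
def OnBranch (A S : ℝ → ℝ) (R : ℝ × ℝ → ℝ) (Z e t : ℝ) : Prop :=
  A t < Z ^ 2 ∧ R (t, S (e * √(Z ^ 2 - A t))) = 0

lemma frequently_sqrt_of_frequently {q : ℝ → Prop} (h : ∃ᶠ x in 𝓝[>] (0:ℝ), q x) :
    ∃ᶠ y in 𝓝[≠] (0:ℝ), 0 < y ∧ q (y ^ 2) := by
  have ht : Tendsto Real.sqrt (𝓝[>] (0:ℝ)) (𝓝[≠] 0) := by
    refine tendsto_nhdsWithin_iff.2 ⟨?_, ?_⟩
    · have := (Real.continuous_sqrt.tendsto 0)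
      rw [Real.sqrt_zero] at this
      exact this.mono_left nhdsWithin_le_nhds
    · filter_upwards [self_mem_nhdsWithin] with x hx
      exact (Real.sqrt_pos.2 hx).ne'
  refine ht.frequently ?_
  refine (h.and_eventually (self_mem_nhdsWithin)).mono ?_
  rintro x ⟨hx, hx0⟩
  refine ⟨Real.sqrt_pos.2 hx0, ?_⟩
  rwa [Real.sq_sqrt (le_of_lt hx0)]

lemma tendsto_sqrt_zero : Tendsto (fun h => √h) (𝓝[>] (0:ℝ)) (𝓝 0) := by
  have := (Real.continuous_sqrt.tendsto 0)
  simp only [Real.sqrt_zero] at this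
  exact this.mono_left nhdsWithin_le_nhds

lemma tendsto_neg_sqrt : Tendsto (fun h => -√h) (𝓝[>] (0:ℝ)) (𝓝 0) := by
  simpa using tendsto_sqrt_zero.neg

lemma branch_crossing {A S : ℝ → ℝ} {R : ℝ × ℝ → ℝ} {Z p κ e : ℝ}
    (he : e = 1 ∨ e = -1) (hA : AnalyticAt ℝ A p)
    (hAp : A p = Z ^ 2) (hS : AnalyticAt ℝ S 0) (hR : AnalyticAt ℝ R (p, S 0))
    (hf : ∃ᶠ h in 𝓝[>] (0:ℝ), OnBranch A S R Z e (p + κ * h)) :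
    (∀ᶠ h in 𝓝[>] (0:ℝ), OnBranch A S R Z e (p + κ * h)) ∧
    ((∀ᶠ h in 𝓝[>] (0:ℝ), OnBranch A S R Z (-e) (p + κ * h)) ∨
      ∃ e', (e' = 1 ∨ e' = -1) ∧ ∀ᶠ h in 𝓝[>] (0:ℝ), OnBranch A S R Z e' (p + -κ * h)) := by
  have hg : AnalyticAt ℝ (fun x => Z ^ 2 - A (p + κ * x)) 0 := by
    refine analyticAt_const.sub ?_
    refine AnalyticAt.fun_comp (g := A) (f := fun x => p + κ * x) (by simpa using hA) ?_
    fun_prop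
  have hnz : ¬ ∀ᶠ x in 𝓝 (0:ℝ), Z ^ 2 - A (p + κ * x) = 0 := by
    intro h
    obtain ⟨x, ⟨hx1, -⟩, hx2⟩ := (hf.and_eventually (h.filter_mono nhdsWithin_le_nhds)).exists
    linarith
  obtain ⟨m, G, hG, hG0, hgG⟩ := hg.exists_eventuallyEq_pow_smul_nonzero_iff.2 hnz
  simp only [sub_zero, smul_eq_mul] at hgG
  have hm0 : m ≠ 0 := by
    rintro rfl
    have := hgG.self_of_nhds
    simp [hAp] at this
    exact hG0 this.symm
  have hGpos : 0 < G 0 := by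
    by_contra hcon
    have hneg : ∀ᶠ x in 𝓝 (0:ℝ), G x < 0 :=
      hG.continuousAt.eventually_lt continuousAt_const (lt_of_le_of_ne (not_lt.1 hcon) hG0)
    obtain ⟨x, ⟨⟨hx1, -⟩, hx2, hx3⟩, hx4⟩ := ((hf.and_eventually
      ((hgG.and hneg).filter_mono nhdsWithin_le_nhds)).and_eventually self_mem_nhdsWithin).exists
    have : 0 < x ^ m := pow_pos hx4 m
    nlinarith
  have hGev : ∀ᶠ x in 𝓝 (0:ℝ), 0 < G x :=
    continuousAt_const.eventually_lt hG.continuousAt hGpos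
  have hsqrtG : AnalyticAt ℝ (fun x => √(G x)) 0 := by
    exact AnalyticAt.fun_comp (g := Real.sqrt) ((Real.contDiffAt_sqrt hGpos.ne').analyticAt) hG
  have hsq0 : AnalyticAt ℝ (fun ξ : ℝ => ξ ^ 2) 0 := by fun_prop
  have hη : AnalyticAt ℝ (fun ξ : ℝ => ξ ^ m * √(G (ξ ^ 2))) 0 := by
    refine AnalyticAt.mul (by fun_prop) ?_
    exact AnalyticAt.fun_comp (g := fun x => √(G x)) (f := fun ξ : ℝ => ξ ^ 2)
      (by simpa using hsqrtG) hsq0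
  have hΘ : AnalyticAt ℝ (fun ξ : ℝ => R (p + κ * ξ ^ 2, S (e * (ξ ^ m * √(G (ξ ^ 2)))))) 0 := by
    refine AnalyticAt.fun_comp (g := R)
      (f := fun ξ : ℝ => (p + κ * ξ ^ 2, S (e * (ξ ^ m * √(G (ξ ^ 2))))))
        (by simpa [hm0] using hR) ?_
    refine AnalyticAt.prod (by fun_prop) ?_
    refine AnalyticAt.fun_comp (g := S) (f := fun ξ : ℝ => e * (ξ ^ m * √(G (ξ ^ 2))))
      (by simpa [hm0] using hS) ?_
    exact analyticAt_const.mul hη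
  have hsqt : Tendsto (fun ξ : ℝ => ξ ^ 2) (𝓝 0) (𝓝 0) := by
    have := (continuous_pow 2 (M := ℝ)).tendsto 0
    simpa using this
  have hΘ0 : ∀ᶠ ξ in 𝓝 (0:ℝ), R (p + κ * ξ ^ 2, S (e * (ξ ^ m * √(G (ξ ^ 2))))) = 0 := by
    refine hΘ.frequently_zero_iff_eventually_zero.1 ?_
    refine ((frequently_sqrt_of_frequently hf).and_eventually
      ((hsqt.eventually (hgG.and hGev)).filter_mono nhdsWithin_le_nhds)).mono ?_
    rintro y ⟨⟨hy0, -, hy2⟩, hy3, hy4⟩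
    rw [hy3, Real.sqrt_mul (by positivity), ← pow_mul, mul_comm 2 m, pow_mul,
      Real.sqrt_sq (by positivity)] at hy2
    exact hy2
  have hboth := hgG.and hGev
  have hpos : ∀ᶠ h in 𝓝[>] (0:ℝ), A (p + κ * h) < Z ^ 2 := by
    filter_upwards [hboth.filter_mono nhdsWithin_le_nhds, self_mem_nhdsWithin] with h hh h0
    have : 0 < h ^ m * G h := mul_pos (pow_pos h0 m) hh.2
    linarith [hh.1]
  have h1 : ∀ᶠ h in 𝓝[>] (0:ℝ), OnBranch A S R Z e (p + κ * h) := by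
    filter_upwards [hpos, hboth.filter_mono nhdsWithin_le_nhds, tendsto_sqrt_zero.eventually hΘ0,
      self_mem_nhdsWithin] with h h1 h2 h3 h4
    refine ⟨h1, ?_⟩
    have h4' : (0:ℝ) ≤ h := le_of_lt h4
    rw [Real.sq_sqrt h4'] at h3
    rw [h2.1, Real.sqrt_mul (by positivity)]
    rw [← h3]
    have : √(h ^ m) = √h ^ m := by
      rw [Real.sqrt_eq_iff_mul_self_eq (by positivity) (by positivity), ← mul_pow,
        Real.mul_self_sqrt h4']
    rw [this]
  refine ⟨h1, ?_⟩
  rcases Nat.even_or_odd m with hme | hmo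
  · right
    obtain ⟨j, hj⟩ := hme
    have hj0 : j ≠ 0 := by omega
    have hmj : ∀ x : ℝ, x ^ m = (x ^ j) ^ 2 := fun x => by rw [hj, ← pow_mul, mul_two]
    have hΘ2 : AnalyticAt ℝ (fun x : ℝ => R (p + κ * x, S (e * (x ^ j * √(G x))))) 0 := by
      refine AnalyticAt.fun_comp (g := R)
        (f := fun x : ℝ => (p + κ * x, S (e * (x ^ j * √(G x))))) (by simpa [hj0] using hR) ?_
      refine AnalyticAt.prod (by fun_prop) ?_
      refine AnalyticAt.fun_comp (g := S) (f := fun x : ℝ => e * (x ^ j * √(G x)))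
        (by simpa [hj0] using hS) ?_
      exact analyticAt_const.mul (AnalyticAt.mul (by fun_prop) hsqrtG)
    have hz : ∀ᶠ x in 𝓝 (0:ℝ), R (p + κ * x, S (e * (x ^ j * √(G x)))) = 0 := by
      refine hΘ2.frequently_zero_iff_eventually_zero.1 ?_
      have : ∃ᶠ h in 𝓝[>] (0:ℝ), R (p + κ * h, S (e * (h ^ j * √(G h)))) = 0 := by
        refine Eventually.frequently ?_
        filter_upwards [h1, hboth.filter_mono nhdsWithin_le_nhds,
            self_mem_nhdsWithin] with h h1 h2 h4
        have h4' : (0:ℝ) < h := h4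
        have := h1.2
        rwa [h2.1, hmj, Real.sqrt_mul (by positivity), Real.sqrt_sq (by positivity)] at this
      exact this.filter_mono (nhdsWithin_mono _ fun x hx => ne_of_gt hx)
    have htn : Tendsto (fun h : ℝ => -h) (𝓝[>] (0:ℝ)) (𝓝 0) := by
      have := (continuous_neg (G := ℝ)).tendsto 0
      simp only [neg_zero] at this
      exact this.mono_left nhdsWithin_le_nhds
    refine ⟨e * (-1) ^ j, ?_, ?_⟩
    · rcases he with rfl | rfl <;> rcases neg_one_pow_eq_or ℝ j with h | h <;> simp [h]
    · filter_upwards [htn.eventually (hz.and hboth), self_mem_nhdsWithin] with h h2 h4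
      have h4' : (0:ℝ) < h := h4
      obtain ⟨h2, h3, h5⟩ := h2
      have e1 : p + κ * -h = p + -κ * h := by ring
      rw [e1] at h2 h3
      have e2 : (-h) ^ m = (h ^ j) ^ 2 := by rw [hmj, neg_pow, mul_pow, ← pow_mul]; simp
      rw [e2] at h3
      refine ⟨?_, ?_⟩
      · have : 0 < (h ^ j) ^ 2 * G (-h) := by positivity
        linarith
      · rw [h3, Real.sqrt_mul (by positivity), Real.sqrt_sq (by positivity)]
        rw [neg_pow] at h2
        rw [← h2]; ring_nf
  · left
    filter_upwards [hpos, hboth.filter_mono nhdsWithin_le_nhds, tendsto_neg_sqrt.eventually hΘ0,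
      self_mem_nhdsWithin] with h h1 h2 h3 h4
    refine ⟨h1, ?_⟩
    have h4' : (0:ℝ) ≤ h := le_of_lt h4
    rw [neg_sq, Real.sq_sqrt h4', hmo.neg_pow] at h3
    rw [h2.1, Real.sqrt_mul (by positivity)]
    rw [← h3]
    have : √(h ^ m) = √h ^ m := by
      rw [Real.sqrt_eq_iff_mul_self_eq (by positivity) (by positivity), ← mul_pow,
        Real.mul_self_sqrt h4']
    rw [this]; ring_nf

/-- Hypotheses on a profile `A` on the line, a separation function `S`, and a relation `R`. -/
structure ArcSystem (A S : ℝ → ℝ) (R : ℝ × ℝ → ℝ) (P : ℝ → Prop) (Z k M : ℝ) : Prop where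
  hA : ∀ t, AnalyticAt ℝ A t
  hM : ∀ t, M ≤ t → Z ^ 2 < A t
  hZ : 0 < Z
  hk : 0 < k
  hS : ∀ z ∈ Ioo (-Z) Z, AnalyticAt ℝ S z
  hmono : StrictMonoOn S (Ioo (-Z) Z)
  hpos : ∀ z ∈ Ioo (-Z) Z, 0 < S z
  hleft : Tendsto S (𝓝[>] (-Z)) (𝓝 0)
  hright : Tendsto S (𝓝[<] Z) atTop
  hR : ∀ t s, 0 < s → AnalyticAt ℝ R (t, s)
  hRA : ∀ t s, 0 < s → R (t, s) = 0 → k * A (t - s) = -A t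
  hRP : ∀ l, (∃ᶠ z in 𝓝 ((l, 0) : ℝ × ℝ), 0 < z.2 ∧ R z = 0) → P l

/-- An interval between consecutive levels `0`, `Z²` of `A` on which the branch of sign `e`
satisfies the relation. -/
structure IsArc (A S : ℝ → ℝ) (R : ℝ × ℝ → ℝ) (Z e l r : ℝ) : Prop where
  he : e = 1 ∨ e = -1
  hlr : l < r
  hpos : ∀ t ∈ Ioo l r, 0 < A t
  hb : ∀ t ∈ Ioo l r, OnBranch A S R Z e t
  hl : A l = 0 ∨ A l = Z ^ 2
  hr : A r = 0 ∨ A r = Z ^ 2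

/-- The partner point on the branch of sign `e`. -/
noncomputable def partner (A S : ℝ → ℝ) (Z e t : ℝ) : ℝ := t - S (e * √(Z ^ 2 - A t))

namespace ArcSystem
variable {A S : ℝ → ℝ} {R : ℝ × ℝ → ℝ} {P : ℝ → Prop} {Z k M : ℝ}

lemma arg_mem (h : ArcSystem A S R P Z k M) {e t : ℝ} (he : e = 1 ∨ e = -1)
    (h0 : 0 < A t) : e * √(Z ^ 2 - A t) ∈ Ioo (-Z) Z := by
  have : √(Z ^ 2 - A t) < Z := by
    rw [Real.sqrt_lt' h.hZ]; linarith
  have h2 := Real.sqrt_nonneg (Z ^ 2 - A t)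
  have := h.hZ
  rcases he with rfl | rfl <;> constructor <;> linarith

lemma zero_mem (h : ArcSystem A S R P Z k M) : (0:ℝ) ∈ Ioo (-Z) Z :=
  ⟨by linarith [h.hZ], h.hZ⟩

lemma continuousOn_partner (h : ArcSystem A S R P Z k M) {e : ℝ} (he : e = 1 ∨ e = -1)
    {s : Set ℝ} (hs : ∀ t ∈ s, 0 < A t) : ContinuousOn (partner A S Z e) s := by
  intro t ht
  refine ContinuousAt.continuousWithinAt ?_
  refine continuousAt_id.sub ?_
  refine ContinuousAt.comp (g := S) (f := fun t => e * √(Z ^ 2 - A t))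
    (h.hS _ (h.arg_mem he (hs t ht))).continuousAt ?_
  have := (h.hA t).continuousAt
  fun_prop

lemma partner_lt (h : ArcSystem A S R P Z k M) {e t : ℝ} (he : e = 1 ∨ e = -1)
    (h0 : 0 < A t) : partner A S Z e t < t := by
  have := h.hpos _ (h.arg_mem he h0)
  unfold partner; linarith

lemma A_partner (h : ArcSystem A S R P Z k M) {e t : ℝ} (he : e = 1 ∨ e = -1)
    (h0 : 0 < A t) (hb : OnBranch A S R Z e t) : k * A (partner A S Z e t) = -A t :=
  h.hRA _ _ (h.hpos _ (h.arg_mem he h0)) hb.2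

lemma A_partner_neg (h : ArcSystem A S R P Z k M) {e t : ℝ} (he : e = 1 ∨ e = -1)
    (h0 : 0 < A t) (hb : OnBranch A S R Z e t) : A (partner A S Z e t) < 0 := by
  have := h.A_partner he h0 hb
  have hk := h.hk
  by_contra hc
  have := mul_nonneg hk.le (not_lt.1 hc)
  linarith

lemma continuous_A (h : ArcSystem A S R P Z k M) : Continuous A :=
  continuous_iff_continuousAt.2 fun t => (h.hA t).continuousAt

/-- The component of `{0 < A < Z²}` around a point. -/
lemma exists_component (h : ArcSystem A S R P Z k M) {t₀ t₁ : ℝ} (h1 : t₁ < t₀) (hA1 : A t₁ ≤ 0)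
    (h0 : 0 < A t₀) (h0' : A t₀ < Z ^ 2) :
    ∃ l r, l < t₀ ∧ t₀ < r ∧ (∀ t ∈ Ioo l r, 0 < A t ∧ A t < Z ^ 2) ∧
      (A l = 0 ∨ A l = Z ^ 2) ∧ (A r = 0 ∨ A r = Z ^ 2) := by
  have hc := h.continuous_A
  have hcl : IsClosed {t | A t ≤ 0 ∨ Z ^ 2 ≤ A t} :=
    (isClosed_le hc continuous_const).union (isClosed_le continuous_const hc)
  have hM0 : t₀ ≤ max M t₀ := le_max_right _ _
  obtain ⟨l, ⟨⟨hl1, hl2⟩, hl3⟩, hlmax⟩ := (isCompact_Icc.inter_right hcl).exists_isGreatest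
    (s := Icc t₁ t₀ ∩ {t | A t ≤ 0 ∨ Z ^ 2 ≤ A t}) ⟨t₁, ⟨le_rfl, h1.le⟩, Or.inl hA1⟩
  obtain ⟨r, ⟨⟨hr1, hr2⟩, hr3⟩, hrmin⟩ := (isCompact_Icc.inter_right hcl).exists_isLeast
    (s := Icc t₀ (max M t₀) ∩ {t | A t ≤ 0 ∨ Z ^ 2 ≤ A t})
    ⟨max M t₀, ⟨hM0, le_rfl⟩, Or.inr (h.hM _ (le_max_left _ _)).le⟩
  have hlt : l < t₀ := lt_of_le_of_ne hl2 (by rintro rfl; rcases hl3 with h | h <;> linarith)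
  have hrt : t₀ < r := lt_of_le_of_ne hr1 (by rintro rfl; rcases hr3 with h | h <;> linarith)
  have hin : ∀ t ∈ Ioo l r, 0 < A t ∧ A t < Z ^ 2 := by
    rintro t ⟨ht1, ht2⟩
    by_contra hcon
    have hcon' : A t ≤ 0 ∨ Z ^ 2 ≤ A t := by
      by_contra hh
      push Not at hh
      exact hcon hh
    rcases le_total t t₀ with h | h
    · have := hlmax ⟨⟨hl1.trans ht1.le, h⟩, hcon'⟩
      linarith
    · have := hrmin ⟨⟨h, ht2.le.trans hr2⟩, hcon'⟩
      linarith
  have hIoo : (Ioo l r).Nonempty := ⟨t₀, hlt, hrt⟩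
  have hcls : ∀ t ∈ Icc l r, 0 ≤ A t ∧ A t ≤ Z ^ 2 := by
    have : IsClosed {t | 0 ≤ A t ∧ A t ≤ Z ^ 2} :=
      (isClosed_le continuous_const hc).inter (isClosed_le hc continuous_const)
    have h2 : closure (Ioo l r) ⊆ {t | 0 ≤ A t ∧ A t ≤ Z ^ 2} :=
      closure_minimal (fun t ht => ⟨(hin t ht).1.le, (hin t ht).2.le⟩) this
    rw [closure_Ioo (hlt.trans hrt).ne] at h2
    exact h2
  have e1 := hcls l ⟨le_rfl, (hlt.trans hrt).le⟩
  have e2 := hcls r ⟨(hlt.trans hrt).le, le_rfl⟩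
  refine ⟨l, r, hlt, hrt, hin, ?_, ?_⟩
  · rcases hl3 with h | h
    · exact Or.inl (le_antisymm h e1.1)
    · exact Or.inr (le_antisymm e1.2 h)
  · rcases hr3 with h | h
    · exact Or.inl (le_antisymm h e2.1)
    · exact Or.inr (le_antisymm e2.2 h)

/-- If the relation accumulates at an interior point, it holds on the whole component. -/
lemma extend_component (h : ArcSystem A S R P Z k M) {e l r t₀ : ℝ} (he : e = 1 ∨ e = -1)
    (hin : ∀ t ∈ Ioo l r, 0 < A t ∧ A t < Z ^ 2) (ht₀ : t₀ ∈ Ioo l r)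
    (hf : ∃ᶠ t in 𝓝[≠] t₀, R (t, S (e * √(Z ^ 2 - A t))) = 0) :
    ∀ t ∈ Ioo l r, OnBranch A S R Z e t := by
  have han : AnalyticOnNhd ℝ (fun t => R (t, S (e * √(Z ^ 2 - A t)))) (Ioo l r) := by
    intro t ht
    have ha := h.arg_mem he (hin t ht).1
    refine AnalyticAt.fun_comp (g := R) (f := fun t => (t, S (e * √(Z ^ 2 - A t))))
      (h.hR _ _ (h.hpos _ ha)) ?_
    refine AnalyticAt.prod analyticAt_id ?_
    refine AnalyticAt.fun_comp (g := S) (f := fun t => e * √(Z ^ 2 - A t)) (h.hS _ ha) ?_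
    refine analyticAt_const.mul ?_
    refine AnalyticAt.fun_comp (g := Real.sqrt)
      ((Real.contDiffAt_sqrt (by linarith [(hin t ht).2])).analyticAt)
        (analyticAt_const.sub (h.hA t))
  have := han.eqOn_zero_of_preconnected_of_frequently_eq_zero isPreconnected_Ioo ht₀ hf
  exact fun t ht => ⟨(hin t ht).2, this ht⟩

/-- An accumulation of solutions at an interior point yields an arc through that point. -/
lemma exists_arc_of_frequently (h : ArcSystem A S R P Z k M) {e t₀ : ℝ} (he : e = 1 ∨ e = -1)
    (h0 : 0 < A t₀) (h0' : A t₀ < Z ^ 2)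
    (hf : ∃ᶠ t in 𝓝[≠] t₀, R (t, S (e * √(Z ^ 2 - A t))) = 0) :
    ∃ l r, t₀ ∈ Ioo l r ∧ IsArc A S R Z e l r := by
  have hA0 := (h.hA t₀).continuousAt
  have hev : ∀ᶠ t in 𝓝 t₀, 0 < A t ∧ A t < Z ^ 2 :=
    (continuousAt_const.eventually_lt hA0 h0).and (hA0.eventually_lt continuousAt_const h0')
  have hpt : ContinuousAt (partner A S Z e) t₀ := by
    have := h.continuousOn_partner he (s := {t | 0 < A t}) (fun t ht => ht)
    exact this.continuousAt (isOpen_lt continuous_const h.continuous_A |>.mem_nhds h0)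
  have hlt : ∀ᶠ t in 𝓝 t₀, partner A S Z e t < t₀ :=
    hpt.eventually_lt continuousAt_const (h.partner_lt he h0)
  obtain ⟨t, hR, ⟨hb1, hb2⟩, hb3⟩ :=
    (hf.and_eventually ((hev.and hlt).filter_mono nhdsWithin_le_nhds)).exists
  obtain ⟨l, r, hl, hr, hin, hle, hre⟩ := h.exists_component hb3
    (h.A_partner_neg he hb1 ⟨hb2, hR⟩).le h0 h0'
  exact ⟨l, r, ⟨hl, hr⟩, he, hl.trans hr, fun t ht => (hin t ht).1,
    h.extend_component he hin ⟨hl, hr⟩ hf, hle, hre⟩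

lemma exists_small (h : ArcSystem A S R P Z k M) {p κ e : ℝ} (hAp : A p = Z ^ 2)
    (hg : ∀ᶠ x in 𝓝[>] (0:ℝ), OnBranch A S R Z e (p + κ * x)) :
    ∃ δ > 0, ∀ x ∈ Ioo 0 δ, 0 < A (p + κ * x) ∧ OnBranch A S R Z e (p + κ * x) := by
  have hpos : ∀ᶠ x in 𝓝[>] (0:ℝ), 0 < A (p + κ * x) := by
    have hc : ContinuousAt (fun x => A (p + κ * x)) 0 := by
      have := h.continuous_A
      fun_prop
    refine (continuousAt_const.eventually_lt hc ?_).filter_mono nhdsWithin_le_nhds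
    have := h.hZ
    simp only [mul_zero, add_zero, hAp]
    positivity
  obtain ⟨δ, hδ, hsub⟩ := (mem_nhdsGT_iff_exists_Ioo_subset).1 (hpos.and hg)
  exact ⟨δ, hδ, fun x hx => hsub hx⟩

/-- A germ to the right of a level-`Z²` point extends to an arc. -/
lemma arc_of_germ_right (h : ArcSystem A S R P Z k M) {p e : ℝ} (he : e = 1 ∨ e = -1)
    (hAp : A p = Z ^ 2)
    (hg : ∀ᶠ x in 𝓝[>] (0:ℝ), OnBranch A S R Z e (p + 1 * x)) : ∃ r, IsArc A S R Z e p r := by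
  obtain ⟨δ, hδ, hsm⟩ := h.exists_small hAp hg
  have hsm' : ∀ t ∈ Ioo p (p + δ), 0 < A t ∧ OnBranch A S R Z e t := by
    intro t ht
    have := hsm (t - p) ⟨by linarith [ht.1], by linarith [ht.2]⟩
    simpa using this
  have hmid : p + δ / 2 ∈ Ioo p (p + δ) := ⟨by linarith, by linarith⟩
  have hm := hsm' _ hmid
  have hfr : ∃ᶠ t in 𝓝[≠] (p + δ / 2), R (t, S (e * √(Z ^ 2 - A t))) = 0 := by
    refine Eventually.frequently ?_
    filter_upwards [nhdsWithin_le_nhds (isOpen_Ioo.mem_nhds hmid)] with t ht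
    exact (hsm' t ht).2.2
  obtain ⟨l, r, hlr, harc⟩ := h.exists_arc_of_frequently he hm.1 hm.2.1 hfr
  have hZ := h.hZ
  have hlp : l = p := by
    rcases lt_trichotomy l p with hlt | heq | hgt
    · have := (harc.hb p ⟨hlt, hmid.1.trans hlr.2⟩).1
      linarith
    · exact heq
    · have := hsm' l ⟨hgt, hlr.1.trans hmid.2⟩
      rcases harc.hl with h | h <;> linarith [this.1, this.2.1]
  exact ⟨r, hlp ▸ harc⟩

/-- A germ to the left of a level-`Z²` point extends to an arc. -/
lemma arc_of_germ_left (h : ArcSystem A S R P Z k M) {p e : ℝ} (he : e = 1 ∨ e = -1)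
    (hAp : A p = Z ^ 2)
    (hg : ∀ᶠ x in 𝓝[>] (0:ℝ), OnBranch A S R Z e (p + -1 * x)) : ∃ l, IsArc A S R Z e l p := by
  obtain ⟨δ, hδ, hsm⟩ := h.exists_small hAp hg
  have hsm' : ∀ t ∈ Ioo (p - δ) p, 0 < A t ∧ OnBranch A S R Z e t := by
    intro t ht
    have := hsm (p - t) ⟨by linarith [ht.2], by linarith [ht.1]⟩
    simpa using this
  have hmid : p - δ / 2 ∈ Ioo (p - δ) p := ⟨by linarith, by linarith⟩
  have hm := hsm' _ hmid
  have hfr : ∃ᶠ t in 𝓝[≠] (p - δ / 2), R (t, S (e * √(Z ^ 2 - A t))) = 0 := by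
    refine Eventually.frequently ?_
    filter_upwards [nhdsWithin_le_nhds (isOpen_Ioo.mem_nhds hmid)] with t ht
    exact (hsm' t ht).2.2
  obtain ⟨l, r, hlr, harc⟩ := h.exists_arc_of_frequently he hm.1 hm.2.1 hfr
  have hrp : r = p := by
    rcases lt_trichotomy r p with hlt | heq | hgt
    · have := hsm' r ⟨hmid.1.trans hlr.2, hlt⟩
      rcases harc.hr with h | h <;> linarith [this.1, this.2.1]
    · exact heq
    · have := (harc.hb p ⟨hlr.1.trans hmid.2, hgt⟩).1
      linarith
  exact ⟨l, hrp ▸ harc⟩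

/-- The left endpoint of an arc is determined by the right one. -/
lemma arc_left_unique {e e' l l' r : ℝ} (h1 : IsArc A S R Z e l r)
    (h2 : IsArc A S R Z e' l' r) : l = l' := by
  rcases lt_trichotomy l l' with h | h | h
  · have hm : l' ∈ Ioo l r := ⟨h, h2.hlr⟩
    have a := h1.hpos _ hm
    have b := (h1.hb _ hm).1
    rcases h2.hl with h | h <;> linarith
  · exact h
  · have hm : l ∈ Ioo l' r := ⟨h, h1.hlr⟩
    have a := h2.hpos _ hm
    have b := (h2.hb _ hm).1
    rcases h1.hl with h | h <;> linarith

/-- The right endpoint of an arc is determined by the left one. -/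
lemma arc_right_unique {e e' l r r' : ℝ} (h1 : IsArc A S R Z e l r)
    (h2 : IsArc A S R Z e' l r') : r = r' := by
  rcases lt_trichotomy r r' with h | h | h
  · have hm : r ∈ Ioo l r' := ⟨h1.hlr, h⟩
    have a := h2.hpos _ hm
    have b := (h2.hb _ hm).1
    rcases h1.hr with h | h <;> linarith
  · exact h
  · have hm : r' ∈ Ioo l r := ⟨h2.hlr, h⟩
    have a := h1.hpos _ hm
    have b := (h1.hb _ hm).1
    rcases h2.hr with h | h <;> linarith

lemma analyticAt_S_zero (h : ArcSystem A S R P Z k M) : AnalyticAt ℝ S 0 := h.hS _ h.zero_mem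

/-- Crossing the right endpoint of an arc. -/
lemma cross_right (h : ArcSystem A S R P Z k M) {e l r : ℝ} (ha : IsArc A S R Z e l r)
    (hr : A r = Z ^ 2) :
    IsArc A S R Z (-e) l r ∨ ∃ e' r', IsArc A S R Z e' r r' := by
  have hf : ∀ᶠ x in 𝓝[>] (0:ℝ), OnBranch A S R Z e (r + -1 * x) := by
    have : Ioo (0:ℝ) (r - l) ∈ 𝓝[>] (0:ℝ) := Ioo_mem_nhdsGT (by linarith [ha.hlr])
    filter_upwards [this] with x hx
    exact ha.hb _ ⟨by linarith [hx.2], by linarith [hx.1]⟩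
  rcases (branch_crossing ha.he (h.hA r) hr h.analyticAt_S_zero
    (h.hR _ _ (h.hpos _ h.zero_mem)) hf.frequently).2 with h1 | ⟨e', he', h1⟩
  · left
    obtain ⟨l', hl'⟩ := h.arc_of_germ_left (by rcases ha.he with rfl | rfl <;> simp) hr h1
    rwa [arc_left_unique ha hl']
  · right
    rw [neg_neg] at h1
    obtain ⟨r', hr'⟩ := h.arc_of_germ_right he' hr h1
    exact ⟨e', r', hr'⟩

/-- Crossing the left endpoint of an arc. -/
lemma cross_left (h : ArcSystem A S R P Z k M) {e l r : ℝ} (ha : IsArc A S R Z e l r)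
    (hl : A l = Z ^ 2) :
    IsArc A S R Z (-e) l r ∨ ∃ e' l', IsArc A S R Z e' l' l := by
  have hf : ∀ᶠ x in 𝓝[>] (0:ℝ), OnBranch A S R Z e (l + 1 * x) := by
    have : Ioo (0:ℝ) (r - l) ∈ 𝓝[>] (0:ℝ) := Ioo_mem_nhdsGT (by linarith [ha.hlr])
    filter_upwards [this] with x hx
    exact ha.hb _ ⟨by linarith [hx.1], by linarith [hx.2]⟩
  rcases (branch_crossing ha.he (h.hA l) hl h.analyticAt_S_zero
    (h.hR _ _ (h.hpos _ h.zero_mem)) hf.frequently).2 with h1 | ⟨e', he', h1⟩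
  · left
    obtain ⟨r', hr'⟩ := h.arc_of_germ_right (by rcases ha.he with rfl | rfl <;> simp) hl h1
    rwa [arc_right_unique ha hr']
  · right
    obtain ⟨l', hl'⟩ := h.arc_of_germ_left he' hl h1
    exact ⟨e', l', hl'⟩

end ArcSystem

namespace ArcSystem
variable {A S : ℝ → ℝ} {R : ℝ × ℝ → ℝ} {P : ℝ → Prop} {Z k M : ℝ}

lemma partner_level {e p : ℝ} (hp : A p = Z ^ 2) : partner A S Z e p = p - S 0 := by
  simp [partner, hp]

lemma continuousAt_partner (h : ArcSystem A S R P Z k M) {e : ℝ} (he : e = 1 ∨ e = -1)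
    {t : ℝ} (ht : 0 < A t) : ContinuousAt (partner A S Z e) t :=
  (h.continuousOn_partner he (s := {t | 0 < A t}) (fun _ ht => ht)).continuousAt
    (isOpen_lt continuous_const h.continuous_A |>.mem_nhds ht)

lemma tendsto_sqrt_arg (h : ArcSystem A S R P Z k M) {p : ℝ} (hp : A p = 0) :
    Tendsto (fun t => √(Z ^ 2 - A t)) (𝓝[{t | 0 < A t}] p) (𝓝[<] Z) := by
  refine tendsto_nhdsWithin_iff.2 ⟨?_, ?_⟩
  · have hc : ContinuousAt (fun t => √(Z ^ 2 - A t)) p := by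
      have := h.continuous_A
      fun_prop
    have := hc.tendsto
    simp only [hp, sub_zero, Real.sqrt_sq h.hZ.le] at this
    exact this.mono_left nhdsWithin_le_nhds
  · filter_upwards [self_mem_nhdsWithin] with t ht
    have ht' : 0 < A t := ht
    rw [mem_Iio, Real.sqrt_lt' h.hZ]
    linarith

lemma tendsto_partner_neg (h : ArcSystem A S R P Z k M) {p : ℝ} (hp : A p = 0) :
    Tendsto (fun t => S (-1 * √(Z ^ 2 - A t))) (𝓝[{t | 0 < A t}] p) (𝓝 0) := by
  have hneg : Tendsto (fun x : ℝ => -1 * x) (𝓝[<] Z) (𝓝[>] (-Z)) := by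
    refine tendsto_nhdsWithin_iff.2 ⟨?_, ?_⟩
    · have : Continuous (fun x : ℝ => -1 * x) := by fun_prop
      have := this.tendsto Z
      rw [neg_one_mul] at this
      exact this.mono_left nhdsWithin_le_nhds
    · filter_upwards [self_mem_nhdsWithin] with t ht
      have ht' : t < Z := ht
      simp [ht']
  exact h.hleft.comp (hneg.comp (h.tendsto_sqrt_arg hp))

lemma tendsto_partner_pos (h : ArcSystem A S R P Z k M) {p : ℝ} (hp : A p = 0) :
    Tendsto (partner A S Z 1) (𝓝[{t | 0 < A t}] p) atBot := by
  have h1 : Tendsto (fun t => S (1 * √(Z ^ 2 - A t))) (𝓝[{t | 0 < A t}] p) atTop := by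
    simp only [one_mul]
    exact h.hright.comp (h.tendsto_sqrt_arg hp)
  have h2 : Tendsto (fun t : ℝ => t) (𝓝[{t | 0 < A t}] p) (𝓝 p) :=
    tendsto_id.mono_left nhdsWithin_le_nhds
  have := h2.add_atBot (tendsto_neg_atTop_atBot.comp h1)
  exact this

lemma nhdsGT_le {e l r : ℝ} (ha : IsArc A S R Z e l r) : 𝓝[>] l ≤ 𝓝[{t | 0 < A t}] l := by
  rw [← nhdsWithin_Ioo_eq_nhdsGT ha.hlr]
  exact nhdsWithin_mono _ fun t ht => ha.hpos t ht

lemma nhdsLT_le {e l r : ℝ} (ha : IsArc A S R Z e l r) : 𝓝[<] r ≤ 𝓝[{t | 0 < A t}] r := by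
  rw [← nhdsWithin_Ioo_eq_nhdsLT ha.hlr]
  exact nhdsWithin_mono _ fun t ht => ha.hpos t ht

lemma arc_relation (h : ArcSystem A S R P Z k M) {e l r t : ℝ} (ha : IsArc A S R Z e l r)
    (ht : t ∈ Icc l r) (h0 : 0 < A t) : k * A (partner A S Z e t) = -A t := by
  have hc : ContinuousAt (fun t => k * A (partner A S Z e t) + A t) t := by
    have h1 := h.continuousAt_partner ha.he h0
    have h2 := h.continuous_A
    exact (continuousAt_const.mul (h2.continuousAt.comp h1)).add h2.continuousAt
  have hcl : t ∈ closure (Ioo l r) := by rwa [closure_Ioo ha.hlr.ne]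
  have : (𝓝[Ioo l r] t).NeBot := mem_closure_iff_nhdsWithin_neBot.1 hcl
  have h1 : Tendsto (fun t => k * A (partner A S Z e t) + A t) (𝓝[Ioo l r] t) (𝓝 0) := by
    refine tendsto_const_nhds.congr' ?_
    filter_upwards [self_mem_nhdsWithin] with s hs
    have := h.A_partner ha.he (ha.hpos s hs) (ha.hb s hs)
    linarith
  have := tendsto_nhds_unique (hc.tendsto.mono_left nhdsWithin_le_nhds) h1
  linarith

lemma eq_of_partner_eq (h : ArcSystem A S R P Z k M) {e l r t l' r' t' : ℝ}
    (ha : IsArc A S R Z e l r) (ht : t ∈ Icc l r) (h0 : 0 < A t)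
    (ha' : IsArc A S R Z e l' r') (ht' : t' ∈ Icc l' r') (h0' : 0 < A t')
    (hp : partner A S Z e t = partner A S Z e t') : t = t' := by
  have h1 := h.arc_relation ha ht h0
  have h2 := h.arc_relation ha' ht' h0'
  rw [hp] at h1
  have h3 : A t = A t' := by linarith
  unfold partner at hp
  rw [h3] at hp
  linarith

lemma A_eq_of_partner_eq (h : ArcSystem A S R P Z k M) {e e' l r t l' r' t' : ℝ}
    (ha : IsArc A S R Z e l r) (ht : t ∈ Icc l r) (h0 : 0 < A t)
    (ha' : IsArc A S R Z e' l' r') (ht' : t' ∈ Icc l' r') (h0' : 0 < A t')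
    (hp : partner A S Z e t = partner A S Z e' t') : A t = A t' := by
  have h1 := h.arc_relation ha ht h0
  have h2 := h.arc_relation ha' ht' h0'
  rw [hp] at h1
  linarith

lemma partner_lt_left (h : ArcSystem A S R P Z k M) {e l r t : ℝ}
    (ha : IsArc A S R Z e l r) (ht : t ∈ Ioo l r) : partner A S Z e t ≤ l := by
  by_contra hc
  have h1 := h.partner_lt ha.he (ha.hpos t ht)
  have h2 := ha.hpos _ ⟨not_le.1 hc, h1.trans ht.2⟩
  have h3 := h.A_partner_neg ha.he (ha.hpos t ht) (ha.hb t ht)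
  linarith

lemma pos_of_level (h : ArcSystem A S R P Z k M) {t : ℝ} (ht : A t = Z ^ 2) : 0 < A t := by
  rw [ht]; exact pow_pos h.hZ 2

lemma partner_surj_right (h : ArcSystem A S R P Z k M) {l r c v : ℝ}
    (ha : IsArc A S R Z 1 l r) (hr : A r = 0) (hc : c ∈ Ico l r) (h0 : 0 < A c)
    (hv : v < partner A S Z 1 c) : ∃ t ∈ Ioo c r, partner A S Z 1 t = v := by
  have h1 := (h.tendsto_partner_pos hr).mono_left (nhdsLT_le ha)
  obtain ⟨s, hs1, hs2⟩ := ((h1.eventually (eventually_lt_atBot v)).and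
    (Ioo_mem_nhdsLT hc.2)).exists
  have hcont : ContinuousOn (partner A S Z 1) (Icc c s) := by
    refine h.continuousOn_partner (Or.inl rfl) ?_
    intro t ht
    rcases eq_or_lt_of_le ht.1 with rfl | hlt
    · exact h0
    · exact ha.hpos t ⟨hc.1.trans_lt hlt, ht.2.trans_lt hs2.2⟩
  obtain ⟨t, ht, hte⟩ := intermediate_value_Ioo' hs2.1.le hcont ⟨hs1, hv⟩
  exact ⟨t, ⟨ht.1, ht.2.trans hs2.2⟩, hte⟩

lemma partner_surj_left (h : ArcSystem A S R P Z k M) {l r c v : ℝ}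
    (ha : IsArc A S R Z 1 l r) (hl : A l = 0) (hc : c ∈ Ioo l r)
    (hv : v < partner A S Z 1 c) : ∃ t ∈ Ioo l c, partner A S Z 1 t = v := by
  have h1 := (h.tendsto_partner_pos hl).mono_left (nhdsGT_le ha)
  obtain ⟨s, hs1, hs2⟩ := ((h1.eventually (eventually_lt_atBot v)).and
    (Ioo_mem_nhdsGT hc.1)).exists
  have hcont : ContinuousOn (partner A S Z 1) (Icc s c) := by
    refine h.continuousOn_partner (Or.inl rfl) ?_
    intro t ht
    exact ha.hpos t ⟨hs2.1.trans_le ht.1, ht.2.trans_lt hc.2⟩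
  obtain ⟨t, ht, hte⟩ := intermediate_value_Ioo hs2.2.le hcont ⟨hs1, hv⟩
  exact ⟨t, ⟨hs2.1.trans ht.1, ht.2⟩, hte⟩

/-- An arc ending at level `0` belongs to the positive branch and starts at level `Z²`. -/
lemma arc_right_zero (h : ArcSystem A S R P Z k M) {e l r : ℝ}
    (ha : IsArc A S R Z e l r) (hr : A r = 0) : e = 1 ∧ A l = Z ^ 2 := by
  have he : e = 1 := by
    rcases ha.he with he | rfl
    · exact he
    exfalso
    have h1 := (h.tendsto_partner_neg hr).mono_left (nhdsLT_le ha)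
    obtain ⟨t, ht1, ht2⟩ := ((h1.eventually (gt_mem_nhds (show (0:ℝ) < (r - l) / 2 by
      linarith [ha.hlr]))).and (Ioo_mem_nhdsLT (show (l + r) / 2 < r by linarith [ha.hlr]))).exists
    have := h.partner_lt_left ha ⟨by linarith [ht2.1, ha.hlr], ht2.2⟩
    unfold partner at this
    linarith [ht2.1]
  subst he
  refine ⟨rfl, ?_⟩
  rcases ha.hl with hl | hl
  · exfalso
    have hm : (l + r) / 2 ∈ Ioo l r := ⟨by linarith [ha.hlr], by linarith [ha.hlr]⟩
    obtain ⟨t, ht, hte⟩ := h.partner_surj_left ha hl hm (v := partner A S Z 1 ((l + r) / 2) - 1)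
      (by linarith)
    obtain ⟨t', ht', hte'⟩ := h.partner_surj_right ha hr ⟨hm.1.le, hm.2⟩ (ha.hpos _ hm)
      (v := partner A S Z 1 ((l + r) / 2) - 1) (by linarith)
    have h1 : t ∈ Ioo l r := ⟨ht.1, ht.2.trans hm.2⟩
    have h2 : t' ∈ Ioo l r := ⟨hm.1.trans ht'.1, ht'.2⟩
    have := h.eq_of_partner_eq ha ⟨h1.1.le, h1.2.le⟩ (ha.hpos _ h1) ha ⟨h2.1.le, h2.2.le⟩
      (ha.hpos _ h2) (hte.trans hte'.symm)
    linarith [ht.2, ht'.1]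
  · exact hl

/-- Two arcs of opposite sign over an interval with both ends at level `Z²` cannot coexist. -/
lemma no_lens (h : ArcSystem A S R P Z k M) {l r : ℝ}
    (ha : IsArc A S R Z 1 l r) (hb : IsArc A S R Z (-1) l r) (hl : A l = Z ^ 2)
    (hr : A r = Z ^ 2) : False := by
  have hpos : ∀ t ∈ Icc l r, 0 < A t := by
    intro t ht
    rcases eq_or_lt_of_le ht.1 with rfl | h1
    · exact h.pos_of_level hl
    rcases eq_or_lt_of_le ht.2 with rfl | h2
    · exact h.pos_of_level hr
    exact ha.hpos t ⟨h1, h2⟩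
  have hc1 := h.continuousOn_partner (Or.inl rfl : (1:ℝ) = 1 ∨ (1:ℝ) = -1) hpos
  have hc2 := h.continuousOn_partner (Or.inr rfl : (-1:ℝ) = 1 ∨ (-1:ℝ) = -1) hpos
  have hmono : StrictMonoOn (partner A S Z (-1)) (Icc l r) := by
    refine ContinuousOn.strictMonoOn_of_injOn_Icc ha.hlr.le ?_ hc2 ?_
    · rw [partner_level hl, partner_level hr]; linarith [ha.hlr]
    · intro t ht t' ht' hh
      exact h.eq_of_partner_eq hb ht (hpos t ht) hb ht' (hpos t' ht') hh
  set m := (l + r) / 2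
  have hm : m ∈ Ioo l r := ⟨by simp only [m]; linarith [ha.hlr],
      by simp only [m]; linarith [ha.hlr]⟩
  have hcl : IsClosed {t | A t = A m} := isClosed_eq h.continuous_A continuous_const
  obtain ⟨t, ⟨ht1, ht2⟩, htmax⟩ := (isCompact_Icc.inter_right hcl).exists_isGreatest
    (s := Icc l r ∩ {t | A t = A m}) ⟨m, ⟨hm.1.le, hm.2.le⟩, rfl⟩
  have ht2' : A t = A m := ht2
  have hlev := (ha.hb m hm).1
  have htr : t < r := lt_of_le_of_ne ht1.2 (by rintro rfl; linarith)
  have htl : l < t := lt_of_le_of_ne ht1.1 (by rintro rfl; linarith)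
  have hlt : partner A S Z 1 t < partner A S Z (-1) t := by
    have hp := hpos t ht1
    have := h.hmono (h.arg_mem (Or.inr rfl) hp) (h.arg_mem (Or.inl rfl) hp) (by
      have : 0 < √(Z ^ 2 - A t) := Real.sqrt_pos.2 (by linarith)
      linarith)
    unfold partner; linarith
  have hle : partner A S Z (-1) t < partner A S Z 1 r := by
    have := hmono ht1 ⟨ha.hlr.le, le_rfl⟩ htr
    rwa [partner_level hr] at this ⊢
  obtain ⟨s, hs, hse⟩ := intermediate_value_Ioo htr.le
    (hc1.mono (Icc_subset_Icc htl.le le_rfl)) ⟨hlt, hle⟩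
  have hs' : s ∈ Icc l r := ⟨htl.le.trans hs.1.le, hs.2.le⟩
  have hAs := h.A_eq_of_partner_eq ha hs' (hpos s hs') hb ht1 (hpos t ht1) hse
  have := htmax ⟨hs', show A s = A m by rw [hAs, ht2']⟩
  linarith [hs.1]

/-- No arc has both ends at level `Z²`. -/
lemma no_full_arc (h : ArcSystem A S R P Z k M) {e l r : ℝ}
    (ha : IsArc A S R Z e l r) (hl : A l = Z ^ 2) (hr : A r = Z ^ 2) : False := by
  have hfin : {t | t ∈ Icc r M ∧ A t = Z ^ 2}.Finite := by
    by_contra hinf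
    obtain ⟨x, -, hx⟩ := Set.Infinite.exists_accPt_of_subset_isCompact hinf
      (isCompact_Icc (a := r) (b := M)) (fun t ht => ht.1)
    have hfr : ∃ᶠ t in 𝓝[≠] x, A t - Z ^ 2 = 0 := by
      refine (accPt_iff_frequently_nhdsNE.1 hx).mono ?_
      rintro t ⟨-, ht⟩
      linarith
    have han : AnalyticOnNhd ℝ (fun t => A t - Z ^ 2) univ :=
      fun t _ => (h.hA t).sub analyticAt_const
    have := han.eqOn_zero_of_preconnected_of_frequently_eq_zero isPreconnected_univ (mem_univ x) hfr
    have h1 : A M - Z ^ 2 = 0 := this (mem_univ M)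
    linarith [h.hM M le_rfl]
  have hXM : ∀ {e l r}, IsArc A S R Z e l r → A r = Z ^ 2 → r ≤ M := by
    intro e l r _ hr
    by_contra hc
    linarith [h.hM r (not_le.1 hc).le]
  set X := {t | ∃ e l, IsArc A S R Z e l t ∧ A l = Z ^ 2 ∧ A t = Z ^ 2 ∧ r ≤ t}
  have hXfin : X.Finite := hfin.subset fun t ⟨e, l, h1, h2, h3, h4⟩ => ⟨⟨h4, hXM h1 h3⟩, h3⟩
  obtain ⟨r₁, ⟨e₁, l₁, ha₁, hl₁, hr₁, hrr⟩, hmax⟩ := Set.exists_max_image X id hXfin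
    ⟨r, e, l, ha, hl, hr, le_rfl⟩
  rcases h.cross_right ha₁ hr₁ with hodd | ⟨e', r', hev⟩
  · rcases ha₁.he with rfl | rfl
    · exact h.no_lens ha₁ hodd hl₁ hr₁
    · rw [neg_neg] at hodd
      exact h.no_lens hodd ha₁ hl₁ hr₁
  · rcases hev.hr with hr' | hr'
    · obtain ⟨rfl, -⟩ := h.arc_right_zero hev hr'
      obtain ⟨t, ht, hte⟩ := h.partner_surj_right hev hr' (c := r₁) ⟨le_rfl, hev.hlr⟩
        (h.pos_of_level hr₁) (v := l₁ - S 0) (by rw [partner_level hr₁]; linarith [ha₁.hlr])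
      rw [← partner_level (e := e₁) hl₁] at hte
      have := h.A_eq_of_partner_eq hev ⟨ht.1.le, ht.2.le⟩ (hev.hpos t ht) ha₁
        ⟨le_rfl, ha₁.hlr.le⟩ (h.pos_of_level hl₁) hte
      linarith [(hev.hb t ht).1]
    · have := hmax r' ⟨e', r₁, hev, hr₁, hr', hrr.trans hev.hlr.le⟩
      simp only [id] at this
      linarith [hev.hlr]

lemma P_of_neg_arc (h : ArcSystem A S R P Z k M) {l r : ℝ}
    (ha : IsArc A S R Z (-1) l r) (hl : A l = 0) : P l := by
  refine h.hRP l ?_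
  have h1 := (h.tendsto_partner_neg hl).mono_left (nhdsGT_le ha)
  have h2 : Tendsto (fun t : ℝ => t) (𝓝[>] l) (𝓝 l) := tendsto_id.mono_left nhdsWithin_le_nhds
  have h3 := h2.prodMk_nhds h1
  refine h3.frequently ?_
  refine Eventually.frequently ?_
  filter_upwards [Ioo_mem_nhdsGT ha.hlr] with t ht
  exact ⟨h.hpos _ (h.arg_mem ha.he (ha.hpos t ht)), (ha.hb t ht).2⟩

lemma P_of_arc_up (h : ArcSystem A S R P Z k M) {e l r : ℝ}
    (ha : IsArc A S R Z e l r) (hl : A l = 0) : P l := by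
  rcases ha.he with rfl | rfl
  swap
  · exact h.P_of_neg_arc ha hl
  have hr : A r = Z ^ 2 := by
    rcases ha.hr with hr | hr
    · have := (h.arc_right_zero ha hr).2
      have := h.pos_of_level this
      linarith
    · exact hr
  rcases h.cross_right ha hr with hodd | ⟨e', r', hev⟩
  · exact h.P_of_neg_arc hodd hl
  · rcases hev.hr with hr' | hr'
    · exfalso
      obtain ⟨rfl, -⟩ := h.arc_right_zero hev hr'
      have h1 := (h.tendsto_partner_pos hl).mono_left (nhdsGT_le ha)
      obtain ⟨t, ht1, ht2⟩ := ((h1.eventually (eventually_lt_atBot (r - S 0))).and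
        (Ioo_mem_nhdsGT ha.hlr)).exists
      obtain ⟨t', ht', hte⟩ := h.partner_surj_right hev hr' (c := r) ⟨le_rfl, hev.hlr⟩
        (h.pos_of_level hr) (v := partner A S Z 1 t) (by rw [partner_level hr]; exact ht1)
      have := h.eq_of_partner_eq hev ⟨ht'.1.le, ht'.2.le⟩ (hev.hpos t' ht') ha
        ⟨ht2.1.le, ht2.2.le⟩ (ha.hpos t ht2) hte
      linarith [ht2.2, ht'.1]
    · exact (h.no_full_arc hev hr hr').elim

/-- Every arc can be followed down to a zero `d` of `A` at which `P` holds, with `A > 0` on the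
way. -/
theorem exists_zero_of_arc (h : ArcSystem A S R P Z k M) {e l r : ℝ}
    (ha : IsArc A S R Z e l r) :
    ∃ d ≤ l, A d = 0 ∧ P d ∧ ∀ t ∈ Ioo d r, 0 < A t := by
  rcases ha.hl with hl | hl
  · exact ⟨l, le_rfl, hl, h.P_of_arc_up ha hl, ha.hpos⟩
  rcases ha.hr with hr | hr
  swap
  · exact (h.no_full_arc ha hl hr).elim
  obtain ⟨rfl, -⟩ := h.arc_right_zero ha hr
  rcases h.cross_left ha hl with hodd | ⟨e', l', hev⟩
  · have := (h.arc_right_zero hodd hr).1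
    norm_num at this
  · rcases hev.hl with hl' | hl'
    · refine ⟨l', hev.hlr.le, hl', h.P_of_arc_up hev hl', ?_⟩
      intro t ht
      rcases lt_trichotomy t l with h1 | rfl | h1
      · exact hev.hpos t ⟨ht.1, h1⟩
      · exact h.pos_of_level hl
      · exact ha.hpos t ⟨h1, ht.2⟩
    · exact (h.no_full_arc hev hl' hl).elim

/-- Accumulating solutions on a branch force a zero `d` of `A` with `P d` and `A > 0` beyond it. -/
theorem exists_zero_of_frequently (h : ArcSystem A S R P Z k M) {Q : ℝ → Prop} {e t₀ : ℝ}
    (he : e = 1 ∨ e = -1) (h0 : 0 < A t₀) (h0' : A t₀ ≤ Z ^ 2)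
    (hf : ∃ᶠ t in 𝓝[≠] t₀, Q t ∧ OnBranch A S R Z e t) :
    ∃ d r, P d ∧ (∀ t ∈ Ioo d r, 0 < A t) ∧ ∃ᶠ t in 𝓝[≠] t₀, Q t ∧ t ∈ Ioo d r := by
  rcases lt_or_eq_of_le h0' with hlt | heq
  · obtain ⟨l, r, htr, harc⟩ := h.exists_arc_of_frequently he h0 hlt (hf.mono fun t ht => ht.2.2)
    obtain ⟨d, hd, -, hP, hpos⟩ := h.exists_zero_of_arc harc
    refine ⟨d, r, hP, hpos, ?_⟩
    refine (hf.and_eventually (nhdsWithin_le_nhds (isOpen_Ioo.mem_nhds htr))).mono ?_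
    rintro t ⟨⟨hQ, -⟩, ht⟩
    exact ⟨hQ, hd.trans_lt ht.1, ht.2⟩
  · have hR0 := h.hR t₀ _ (h.hpos _ h.zero_mem)
    rw [← Set.Iio_union_Ioi, nhdsWithin_union, frequently_sup] at hf
    rcases hf with hf | hf
    · have hmap : Tendsto (fun t => t₀ - t) (𝓝[<] t₀) (𝓝[>] 0) := by
        refine tendsto_nhdsWithin_iff.2 ⟨?_, ?_⟩
        · have : Continuous (fun t => t₀ - t) := by fun_prop
          have := this.tendsto t₀
          rw [sub_self] at this
          exact this.mono_left nhdsWithin_le_nhds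
        · filter_upwards [self_mem_nhdsWithin] with t ht
          exact mem_Ioi.2 (sub_pos.2 (mem_Iio.1 ht))
      have hg := (branch_crossing (κ := -1) he (h.hA t₀) heq h.analyticAt_S_zero hR0
        (hmap.frequently (hf.mono fun t ht => by convert ht.2 using 1; ring))).1
      obtain ⟨l, harc⟩ := h.arc_of_germ_left he heq hg
      obtain ⟨d, hd, -, hP, hpos⟩ := h.exists_zero_of_arc harc
      refine ⟨d, t₀, hP, hpos, ?_⟩
      refine ((hf.and_eventually (Ioo_mem_nhdsLT (hd.trans_lt harc.hlr))).mono ?_).filter_mono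
        (nhdsWithin_mono _ fun t ht => ne_of_lt ht)
      rintro t ⟨⟨hQ, -⟩, ht⟩
      exact ⟨hQ, ht⟩
    · have hmap : Tendsto (fun t => t - t₀) (𝓝[>] t₀) (𝓝[>] 0) := by
        refine tendsto_nhdsWithin_iff.2 ⟨?_, ?_⟩
        · have : Continuous (fun t => t - t₀) := by fun_prop
          have := this.tendsto t₀
          rw [sub_self] at this
          exact this.mono_left nhdsWithin_le_nhds
        · filter_upwards [self_mem_nhdsWithin] with t ht
          exact mem_Ioi.2 (sub_pos.2 (mem_Ioi.1 ht))
      have hg := (branch_crossing (κ := 1) he (h.hA t₀) heq h.analyticAt_S_zero hR0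
        (hmap.frequently (hf.mono fun t ht => by convert ht.2 using 1; ring))).1
      obtain ⟨r, harc⟩ := h.arc_of_germ_right he heq hg
      obtain ⟨d, hd, -, hP, hpos⟩ := h.exists_zero_of_arc harc
      refine ⟨d, r, hP, hpos, ?_⟩
      refine ((hf.and_eventually (Ioo_mem_nhdsGT harc.hlr)).mono ?_).filter_mono
        (nhdsWithin_mono _ fun t ht => ne_of_gt ht)
      rintro t ⟨⟨hQ, -⟩, ht⟩
      exact ⟨hQ, hd.trans_lt ht.1, ht.2⟩

end ArcSystem

/-- A locally dominated integral of holomorphic functions is holomorphic. -/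
theorem differentiableOn_integral_of_dominated {α : Type*} [MeasurableSpace α] {μ : Measure α}
    {U : Set ℂ} {f : ℂ → α → ℂ}
    (hmeas : ∀ z ∈ U, AEStronglyMeasurable (f z) μ)
    (hdiff : ∀ᵐ y ∂μ, DifferentiableOn ℂ (fun z => f z y) U)
    (hdom : ∀ z₀ ∈ U, ∃ r > 0, Metric.ball z₀ r ⊆ U ∧ ∃ bound : α → ℝ, Integrable bound μ ∧
      ∀ᵐ y ∂μ, ∀ z ∈ Metric.ball z₀ r, ‖f z y‖ ≤ bound y) :
    DifferentiableOn ℂ (fun z => ∫ y, f z y ∂μ) U := by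
  intro z₀ hz₀
  obtain ⟨r, hr, hsub, bound, hbi, hb⟩ := hdom z₀ hz₀
  have hball : ∀ᵐ y ∂μ, DifferentiableOn ℂ (fun z => f z y) (Metric.ball z₀ r) := by
    filter_upwards [hdiff] with y hy using hy.mono hsub
  have hder : ∀ᵐ y ∂μ, ∀ z ∈ Metric.ball z₀ (r / 2),
      HasDerivAt (fun z => f z y) (deriv (fun z => f z y) z) z := by
    filter_upwards [hball] with y hy z hz
    refine (hy.differentiableAt (Metric.isOpen_ball.mem_nhds ?_)).hasDerivAt
    exact Metric.ball_subset_ball (by linarith) hz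
  have hint : Integrable (f z₀) μ := by
    refine hbi.mono' (hmeas z₀ hz₀) ?_
    filter_upwards [hb] with y hy using hy z₀ (Metric.mem_ball_self hr)
  have hbound : ∀ᵐ y ∂μ, ∀ z ∈ Metric.ball z₀ (r / 2),
      ‖deriv (fun z => f z y) z‖ ≤ bound y / (r / 4) := by
    filter_upwards [hball, hb] with y hy hby z hz
    have hz' : dist z z₀ < r / 2 := hz
    have hcl : Metric.closedBall z (r / 4) ⊆ Metric.ball z₀ r := by
      intro w hw
      have h1 : dist w z ≤ r / 4 := hw
      have := dist_triangle w z z₀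
      rw [Metric.mem_ball]; linarith
    refine Complex.norm_deriv_le_of_forall_mem_sphere_norm_le (by linarith) ?_ ?_
    · refine DifferentiableOn.diffContOnCl ?_
      rw [closure_ball _ (by linarith)]
      exact hy.mono hcl
    · intro w hw
      exact hby w (hcl (Metric.sphere_subset_closedBall hw))
  have hmeas' : AEStronglyMeasurable (fun y => deriv (fun z => f z y) z₀) μ := by
    have hseq : Tendsto (fun n : ℕ => ((r / 2 / (n + 1) : ℝ) : ℂ)) atTop (𝓝[≠] 0) := by
      refine tendsto_nhdsWithin_iff.2 ⟨?_, Eventually.of_forall fun n => ?_⟩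
      · have : Tendsto (fun n : ℕ => r / 2 / ((n : ℝ) + 1)) atTop (𝓝 0) :=
          tendsto_const_nhds.div_atTop
            (tendsto_atTop_add_const_right _ _ tendsto_natCast_atTop_atTop)
        have := (Complex.continuous_ofReal.tendsto 0).comp this
        rwa [Complex.ofReal_zero] at this
      · have : (r / 2 / ((n : ℝ) + 1)) ≠ 0 := by positivity
        exact Complex.ofReal_ne_zero.2 this
    refine aestronglyMeasurable_of_tendsto_ae atTop
      (f := fun n : ℕ => fun y => ((r / 2 / (n + 1) : ℝ) : ℂ)⁻¹ •
        (f (z₀ + ((r / 2 / (n + 1) : ℝ) : ℂ)) y - f z₀ y)) ?_ ?_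
    · intro n
      refine (AEStronglyMeasurable.sub (hmeas _ (hsub ?_)) (hmeas _ hz₀)).const_smul
          (((r / 2 / (n + 1) : ℝ) : ℂ)⁻¹)
      rw [Metric.mem_ball, dist_eq_norm, add_sub_cancel_left, Complex.norm_real, Real.norm_eq_abs,
        abs_of_pos (by positivity), div_lt_iff₀ (by positivity)]
      have : (0:ℝ) ≤ n := n.cast_nonneg
      nlinarith
    · filter_upwards [hder] with y hy
      exact (hy z₀ (Metric.mem_ball_self (by linarith))).tendsto_slope_zero.comp hseq
  have := hasDerivAt_integral_of_dominated_loc_of_deriv_le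
    (F' := fun z y => deriv (fun z => f z y) z) (Metric.ball_mem_nhds z₀ (half_pos hr)) ?_ hint
        hmeas' hbound
    (hbi.div_const _) hder
  · exact this.2.differentiableAt.differentiableWithinAt
  · filter_upwards [Metric.ball_mem_nhds z₀ hr] with z hz using hmeas z (hsub hz)

/-- A real function whose derivative is locally the restriction of a holomorphic function is
real analytic. -/
theorem analyticAt_of_hasDerivAt_re {f f' : ℝ → ℝ} {g : ℂ → ℂ} {a : ℝ}
    (hf : ∀ᶠ x in 𝓝 a, HasDerivAt f (f' x) x) (hg : AnalyticAt ℂ g a)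
    (hfg : ∀ᶠ x : ℝ in 𝓝 a, f' x = (g x).re) : AnalyticAt ℝ f a := by
  obtain ⟨ε, hε, hball⟩ := Metric.eventually_nhds_iff_ball.1
    (hg.eventually_analyticAt)
  have hgd : DifferentiableOn ℂ g (Metric.ball (a : ℂ) ε) :=
    fun z hz => (hball z hz).differentiableAt.differentiableWithinAt
  obtain ⟨G, hG⟩ := hgd.isExactOn_ball
  have hGan : AnalyticAt ℂ G a := by
    have : DifferentiableOn ℂ G (Metric.ball (a : ℂ) ε) :=
      fun z hz => (hG z hz).differentiableAt.differentiableWithinAt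
    exact this.analyticAt (Metric.isOpen_ball.mem_nhds (Metric.mem_ball_self hε))
  obtain ⟨δ, hδ, hb⟩ := Metric.eventually_nhds_iff_ball.1 (hf.and hfg)
  set η := min ε δ with hη
  have hη0 : 0 < η := lt_min hε hδ
  have hdiff : ∀ x ∈ Metric.ball a η, HasDerivAt (fun x : ℝ => f x - (G x).re) 0 x := by
    intro x hx
    have hx1 : (x : ℂ) ∈ Metric.ball (a : ℂ) ε := by
      rw [Metric.mem_ball, Complex.dist_eq, ← Complex.ofReal_sub, Complex.norm_real]
      exact lt_of_lt_of_le hx (min_le_left _ _)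
    have hx2 := hb x (Metric.ball_subset_ball (min_le_right _ _) hx)
    have h1 : HasDerivAt (fun x : ℝ => (G x).re) (g x).re x := (hG x hx1).real_of_complex
    have := hx2.1.sub h1
    rwa [hx2.2, sub_self] at this
  have hconst : ∀ x ∈ Metric.ball a η, f x - (G x).re = f a - (G a).re := by
    intro x hx
    exact (convex_ball a η).is_const_of_fderivWithin_eq_zero (𝕜 := ℝ)
      (f := fun x : ℝ => f x - (G x).re)
      (fun y hy => (hdiff y hy).differentiableAt.differentiableWithinAt)
      (fun y hy => by
        rw [fderivWithin_of_isOpen Metric.isOpen_ball hy]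
        ext
        simp [(hdiff y hy).deriv]) hx (Metric.mem_ball_self hη0)
  have : AnalyticAt ℝ (fun x : ℝ => (G x).re + (f a - (G a).re)) a :=
    hGan.re_ofReal.add analyticAt_const
  refine this.congr ?_
  filter_upwards [Metric.ball_mem_nhds a hη0] with x hx
  linarith [hconst x hx]

lemma volume_ge_of_ordConnected {I J K : Set ℝ} {a b : ℝ} (ha : 0 < a) (hb : 0 < b)
    (hI : I.Nonempty) (hK : K.OrdConnected)
    (hsub : ∀ x ∈ I, ∀ y ∈ J, a * x + b * y ∈ K) (hJ : J.Nonempty) :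
    ENNReal.ofReal a * volume I + ENNReal.ofReal b * volume J ≤ volume K := by
  by_cases htop : volume K = ⊤
  · rw [htop]; exact le_top
  set k := (volume K).toReal with hk
  have key : ∀ x ∈ I, ∀ x' ∈ I, ∀ y ∈ J, ∀ y' ∈ J, a * |x - x'| + b * |y - y'| ≤ k := by
    have key' : ∀ x ∈ I, ∀ x' ∈ I, ∀ y ∈ J, ∀ y' ∈ J, x ≤ x' → y ≤ y' →
        a * |x - x'| + b * |y - y'| ≤ k := by
      intro x hx x' hx' y hy y' hy' hxx hyy
      have h1 := measure_mono (μ := volume) (hK.out (hsub x hx y hy) (hsub x' hx' y' hy'))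
      rw [Real.volume_Icc] at h1
      have h2 := (ENNReal.ofReal_le_iff_le_toReal htop).1 h1
      rw [abs_sub_comm x, abs_sub_comm y, abs_of_nonneg (sub_nonneg.2 hxx),
        abs_of_nonneg (sub_nonneg.2 hyy)]
      linarith
    intro x hx x' hx' y hy y' hy'
    rcases le_total x x' with h1 | h1 <;> rcases le_total y y' with h2 | h2
    · exact key' x hx x' hx' y hy y' hy' h1 h2
    · rw [abs_sub_comm y]; exact key' x hx x' hx' y' hy' y hy h1 h2
    · rw [abs_sub_comm x]; exact key' x' hx' x hx y hy y' hy' h1 h2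
    · rw [abs_sub_comm x, abs_sub_comm y]; exact key' x' hx' x hx y' hy' y hy h1 h2
  have hIv : ∀ y ∈ J, ∀ y' ∈ J, volume I ≤ ENNReal.ofReal ((k - b * |y - y'|) / a) := by
    intro y hy y' hy'
    refine (Real.volume_le_diam I).trans (Metric.ediam_le fun x hx x' hx' => ?_)
    rw [edist_dist, Real.dist_eq]
    refine ENNReal.ofReal_le_ofReal ?_
    rw [le_div_iff₀ ha]
    linarith [key x hx x' hx' y hy y' hy']
  obtain ⟨y₀, hy₀⟩ := hJ
  obtain ⟨x₀, hx₀⟩ := hI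
  have hIfin : volume I ≠ ⊤ := ne_top_of_le_ne_top ENNReal.ofReal_ne_top (hIv y₀ hy₀ y₀ hy₀)
  have hkpos : ∀ y ∈ J, ∀ y' ∈ J, b * |y - y'| ≤ k := by
    intro y hy y' hy'
    have := key x₀ hx₀ x₀ hx₀ y hy y' hy'
    simpa using this
  set v := (volume I).toReal with hv
  have hIv' : ∀ y ∈ J, ∀ y' ∈ J, a * v + b * |y - y'| ≤ k := by
    intro y hy y' hy'
    have h1 := ENNReal.toReal_le_of_le_ofReal (div_nonneg (by linarith [hkpos y hy y' hy']) ha.le)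
      (hIv y hy y' hy')
    rw [le_div_iff₀ ha] at h1
    linarith
  have hJv : volume J ≤ ENNReal.ofReal ((k - a * v) / b) := by
    refine (Real.volume_le_diam J).trans (Metric.ediam_le fun x hx x' hx' => ?_)
    rw [edist_dist, Real.dist_eq]
    refine ENNReal.ofReal_le_ofReal ?_
    rw [le_div_iff₀ hb]
    linarith [hIv' x hx x' hx']
  have hkav : a * v ≤ k := by simpa using hIv' y₀ hy₀ y₀ hy₀
  calc ENNReal.ofReal a * volume I + ENNReal.ofReal b * volume J
      ≤ ENNReal.ofReal a * ENNReal.ofReal v +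
        ENNReal.ofReal b * ENNReal.ofReal ((k - a * v) / b) := by
        rw [hv, ENNReal.ofReal_toReal hIfin]
        gcongr
    _ = ENNReal.ofReal k := by
        rw [← ENNReal.ofReal_mul ha.le, ← ENNReal.ofReal_mul hb.le, ← ENNReal.ofReal_add
          (mul_nonneg ha.le ENNReal.toReal_nonneg)
          (mul_nonneg hb.le (div_nonneg (by linarith) hb.le))]
        congr 1
        field_simp
        ring
    _ = volume K := ENNReal.ofReal_toReal htop

lemma integral_ge_of_normalized {f g h : ℝ → ℝ} {a b : ℝ} (ha : 0 < a) (hb : 0 < b)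
    (hab : a + b = 1)
    (hf0 : ∀ x, 0 ≤ f x) (hg0 : ∀ x, 0 ≤ g x) (hh0 : ∀ x, 0 ≤ h x)
    (hf1 : ∀ x, f x ≤ 1) (hg1 : ∀ x, g x ≤ 1)
    (hfs : ∀ t < 1, ∃ x, t < f x) (hgs : ∀ t < 1, ∃ x, t < g x)
    (hhc : ∀ t, {x | t < h x}.OrdConnected)
    (hfi : Integrable f) (hgi : Integrable g) (hhi : Integrable h)
    (hfm : Measurable f) (hgm : Measurable g) (hhm : Measurable h)
    (H : ∀ x y, f x ^ a * g y ^ b ≤ h (a * x + b * y)) :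
    a * (∫ x, f x) + b * (∫ x, g x) ≤ ∫ x, h x := by
  have e1 := lintegral_eq_lintegral_meas_lt volume (Eventually.of_forall hf0) hfm.aemeasurable
  have e2 := lintegral_eq_lintegral_meas_lt volume (Eventually.of_forall hg0) hgm.aemeasurable
  have e3 := lintegral_eq_lintegral_meas_lt volume (Eventually.of_forall hh0) hhm.aemeasurable
  have hanti : ∀ u : ℝ → ℝ, Measurable (fun t => volume {x | t < u x}) := fun u =>
    Antitone.measurable fun t t' htt => measure_mono fun x (hx : t' < u x) => lt_of_le_of_lt htt hx
  have hle : ENNReal.ofReal a * (∫⁻ x, ENNReal.ofReal (f x)) +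
      ENNReal.ofReal b * (∫⁻ x, ENNReal.ofReal (g x)) ≤ ∫⁻ x, ENNReal.ofReal (h x) := by
    rw [e1, e2, e3, ← lintegral_const_mul _ (hanti f), ← lintegral_const_mul _ (hanti g),
      ← lintegral_add_left ((hanti f).const_mul _)]
    refine lintegral_mono_ae ?_
    filter_upwards [self_mem_ae_restrict measurableSet_Ioi] with t ht
    have ht0 : 0 < t := ht
    rcases lt_or_ge t 1 with h1 | h1
    · refine volume_ge_of_ordConnected ha hb (hfs t h1) (hhc t) ?_ (hgs t h1)
      intro x hx y hy
      have hx' : t < f x := hx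
      have hy' : t < g y := hy
      refine lt_of_lt_of_le ?_ (H x y)
      calc t = t ^ a * t ^ b := by rw [← Real.rpow_add ht0, hab, Real.rpow_one]
        _ < f x ^ a * g y ^ b := by
          apply mul_lt_mul''
          · exact Real.rpow_lt_rpow ht0.le hx' ha
          · exact Real.rpow_lt_rpow ht0.le hy' hb
          · positivity
          · positivity
    · have z1 : {x | t < f x} = ∅ := by
        ext x; simpa using (hf1 x).trans h1
      have z2 : {x | t < g x} = ∅ := by
        ext x; simpa using (hg1 x).trans h1
      simp [z1, z2]
  rw [← ofReal_integral_eq_lintegral_ofReal hfi (Eventually.of_forall hf0),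
    ← ofReal_integral_eq_lintegral_ofReal hgi (Eventually.of_forall hg0),
    ← ofReal_integral_eq_lintegral_ofReal hhi (Eventually.of_forall hh0),
    ← ENNReal.ofReal_mul ha.le, ← ENNReal.ofReal_mul hb.le, ← ENNReal.ofReal_add
      (mul_nonneg ha.le (integral_nonneg hf0)) (mul_nonneg hb.le (integral_nonneg hg0)),
    ENNReal.ofReal_le_ofReal_iff (integral_nonneg hh0)] at hle
  exact hle

/-- The one-dimensional Prékopa–Leindler inequality, for functions with interval level sets. -/
theorem prekopa_leindler_one_dim {f g h : ℝ → ℝ} {a b : ℝ} (ha : 0 < a) (hb : 0 < b)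
    (hab : a + b = 1)
    (hf0 : ∀ x, 0 < f x) (hg0 : ∀ x, 0 < g x) (hh0 : ∀ x, 0 < h x)
    (hf1 : BddAbove (range f)) (hg1 : BddAbove (range g))
    (hhc : ∀ t, {x | t < h x}.OrdConnected)
    (hfi : Integrable f) (hgi : Integrable g) (hhi : Integrable h)
    (hfm : Measurable f) (hgm : Measurable g) (hhm : Measurable h)
    (H : ∀ x y, f x ^ a * g y ^ b ≤ h (a * x + b * y)) :
    (∫ x, f x) ^ a * (∫ x, g x) ^ b ≤ ∫ x, h x := by
  have aux : ∀ u : ℝ → ℝ, (∀ x, 0 < u x) → BddAbove (range u) →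
      0 < sSup (range u) ∧ (∀ x, u x / sSup (range u) ≤ 1) ∧
      ∀ t < 1, ∃ x, t < u x / sSup (range u) := by
    intro u hu hbd
    have hpos : 0 < sSup (range u) := (hu 0).trans_le (le_csSup hbd ⟨0, rfl⟩)
    refine ⟨hpos, fun x => (div_le_one hpos).2 (le_csSup hbd ⟨x, rfl⟩), fun t ht => ?_⟩
    obtain ⟨_, ⟨x, rfl⟩, hx⟩ := exists_lt_of_lt_csSup (range_nonempty u)
      (show t * sSup (range u) < sSup (range u) by nlinarith)
    exact ⟨x, (lt_div_iff₀ hpos).2 hx⟩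
  obtain ⟨hF, hF1, hF2⟩ := aux f hf0 hf1
  obtain ⟨hG, hG1, hG2⟩ := aux g hg0 hg1
  set F := sSup (range f)
  set G := sSup (range g)
  have hc : 0 < F ^ a * G ^ b := by positivity
  have key := integral_ge_of_normalized (f := fun x => f x / F) (g := fun x => g x / G)
    (h := fun x => h x / (F ^ a * G ^ b)) ha hb hab (fun x => (div_pos (hf0 x) hF).le)
    (fun x => (div_pos (hg0 x) hG).le) (fun x => (div_pos (hh0 x) hc).le) hF1 hG1 hF2 hG2
    (fun t => by
      have : {x | t < h x / (F ^ a * G ^ b)} = {x | t * (F ^ a * G ^ b) < h x} := by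
        ext x; exact lt_div_iff₀ hc
      rw [this]; exact hhc _)
    (hfi.div_const _) (hgi.div_const _) (hhi.div_const _) (hfm.div_const _) (hgm.div_const _)
    (hhm.div_const _) (fun x y => by
      rw [Real.div_rpow (hf0 x).le hF.le, Real.div_rpow (hg0 y).le hG.le, div_mul_div_comm]
      exact div_le_div_of_nonneg_right (H x y) hc.le)
  simp only [integral_div] at key
  have hif : 0 ≤ ∫ x, f x := integral_nonneg fun x => (hf0 x).le
  have hig : 0 ≤ ∫ x, g x := integral_nonneg fun x => (hg0 x).le
  have amgm := Real.geom_mean_le_arith_mean2_weighted ha.le hb.le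
    (div_nonneg hif hF.le) (div_nonneg hig hG.le) hab
  have := amgm.trans key
  rwa [Real.div_rpow hif hF.le, Real.div_rpow hig hG.le, div_mul_div_comm,
    div_le_div_iff_of_pos_right hc] at this

lemma exp_neg_sub_one_add_pos {h : ℝ} (hh : h ≠ 0) : 0 < exp (-h) - 1 + h := by
  have := Real.add_one_lt_exp (neg_ne_zero.2 hh)
  linarith

lemma exp_neg_sub_one_add_ge {h : ℝ} (hh : |h| ≤ 1) : h ^ 2 / 4 ≤ exp (-h) - 1 + h := by
  have h1 := Real.exp_bound (x := -h) (by simpa using hh) (n := 3) (by norm_num)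
  simp [Finset.sum_range_succ, Nat.factorial] at h1
  have h2 := (abs_le.1 h1).1
  have h3 : |h| ^ 3 = |h| * h ^ 2 := by rw [pow_succ, sq_abs]; ring
  rw [h3] at h2
  have h4 : |h| * h ^ 2 ≤ h ^ 2 := by nlinarith [sq_nonneg h]
  nlinarith

lemma analyticAt_dslope {F : ℝ → ℝ} {a x : ℝ} (ha : AnalyticAt ℝ F a) (hx : AnalyticAt ℝ F x) :
    AnalyticAt ℝ (dslope F a) x := by
  by_cases h : x = a
  · subst h
    obtain ⟨p, hp⟩ := ha
    exact ⟨_, hp.has_fpower_series_dslope_fslope⟩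
  · have h1 : AnalyticAt ℝ (fun y => (y - a)⁻¹ • (F y - F a)) x :=
      ((analyticAt_id.sub analyticAt_const).inv (sub_ne_zero.2 h)).smul (hx.sub analyticAt_const)
    refine h1.congr ?_
    filter_upwards [isOpen_ne.mem_nhds h] with y hy
    rw [dslope_of_ne _ hy, slope_def_module]

lemma exists_forall_le_of_tendsto_zero {D : ℝ → ℝ} (hD : ContinuousOn D (Ioi 0))
    (hpos : ∀ s, 0 < s → 0 < D s) (h0 : Tendsto D (𝓝[>] 0) (𝓝 0)) (hinf : Tendsto D atTop (𝓝 0)) :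
    ∃ s₁, 0 < s₁ ∧ ∀ s, 0 < s → D s ≤ D s₁ := by
  have hD1 := hpos 1 one_pos
  obtain ⟨u, hu0, hu⟩ := mem_nhdsGT_iff_exists_Ioo_subset.1 (h0.eventually (gt_mem_nhds hD1))
  obtain ⟨M, hM⟩ := eventually_atTop.1 (hinf.eventually (gt_mem_nhds hD1))
  have hu0' : 0 < u := hu0
  have hl : 0 < min (u / 2) 1 := by positivity
  obtain ⟨s₁, hs₁, hmax⟩ := isCompact_Icc.exists_isMaxOn
    (s := Icc (min (u / 2) 1) (max M 1)) ⟨1, min_le_right _ _, le_max_right _ _⟩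
    (hD.mono fun s hs => hl.trans_le hs.1)
  refine ⟨s₁, hl.trans_le hs₁.1, fun s hs => ?_⟩
  have h1 : D 1 ≤ D s₁ := hmax ⟨min_le_right _ _, le_max_right _ _⟩
  by_cases ha : s < min (u / 2) 1
  · have : s < u := by linarith [ha.trans_le (min_le_left (u / 2) 1)]
    exact (le_of_lt (hu ⟨hs, this⟩)).trans h1
  · by_cases hb : max M 1 < s
    · exact (hM s ((le_max_left _ _).trans hb.le)).le.trans h1
    · exact hmax ⟨not_lt.1 ha, not_lt.1 hb⟩

/-- The function `D` is unimodal with a nondegenerate maximum; its two inverse branches are the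
values of a single analytic function of the square root of the deviation from the maximum. -/
theorem exists_inverse_branch {D : ℝ → ℝ} (hD : ∀ s, 0 < s → AnalyticAt ℝ D s)
    (hpos : ∀ s, 0 < s → 0 < D s) (h0 : Tendsto D (𝓝[>] 0) (𝓝 0)) (hinf : Tendsto D atTop (𝓝 0))
    (hcrit : ∀ s₁, 0 < s₁ → deriv D s₁ = 0 → ∃ m, 0 < m ∧ ∀ s, 0 < s →
      D s ≤ D s₁ * exp (-m * (exp (-(s - s₁)) - 1 + (s - s₁)))) :
    ∃ Z : ℝ, 0 < Z ∧ ∃ S : ℝ → ℝ, (∀ z ∈ Ioo (-Z) Z, AnalyticAt ℝ S z) ∧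
      StrictMonoOn S (Ioo (-Z) Z) ∧ (∀ z ∈ Ioo (-Z) Z, 0 < S z) ∧
      Tendsto S (𝓝[>] (-Z)) (𝓝 0) ∧ Tendsto S (𝓝[<] Z) atTop ∧
      (∀ z ∈ Ioo (-Z) Z, D (S z) = Z ^ 2 - z ^ 2) ∧
      (∀ s, 0 < s → D s ≤ Z ^ 2 ∧ ∃ e : ℝ, (e = 1 ∨ e = -1) ∧ s = S (e * √(Z ^ 2 - D s))) ∧
      ∃ s₁, 0 < s₁ ∧ D s₁ = Z ^ 2 := by
  obtain ⟨s₁, hs₁, hmax⟩ := exists_forall_le_of_tendsto_zero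
    (fun s hs => (hD s hs).continuousAt.continuousWithinAt) hpos h0 hinf
  have hder : deriv D s₁ = 0 := by
    refine IsLocalMax.deriv_eq_zero ?_
    filter_upwards [lt_mem_nhds hs₁] with s hs using hmax s hs
  have huniq : ∀ s, 0 < s → deriv D s = 0 → s = s₁ := by
    intro s hs hd
    by_contra hne
    obtain ⟨m, hm, hle⟩ := hcrit s hs hd
    have h1 := hle s₁ hs₁
    have h2 := exp_neg_sub_one_add_pos (sub_ne_zero.2 (Ne.symm hne))
    have h3 : exp (-m * (exp (-(s₁ - s)) - 1 + (s₁ - s))) < 1 := by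
      rw [Real.exp_lt_one_iff]; nlinarith
    have h4 := hmax s hs
    have := hpos s hs
    nlinarith
  obtain ⟨m, hm, hle⟩ := hcrit s₁ hs₁ hder
  have hDm := hpos s₁ hs₁
  set F : ℝ → ℝ := fun s => D s₁ - D s with hF
  have hFan : ∀ s, 0 < s → AnalyticAt ℝ F s := fun s hs => analyticAt_const.sub (hD s hs)
  set F1 := dslope F s₁ with hF1
  set F2 := dslope F1 s₁ with hF2
  have hF1an : ∀ s, 0 < s → AnalyticAt ℝ F1 s := fun s hs => analyticAt_dslope (hFan _ hs₁)
      (hFan s hs)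
  have hF2an : ∀ s, 0 < s → AnalyticAt ℝ F2 s := fun s hs =>
    analyticAt_dslope (hF1an _ hs₁) (hF1an s hs)
  have hfac : ∀ s, F s = (s - s₁) ^ 2 * F2 s := by
    intro s
    have e1 := sub_smul_dslope F s₁ s
    have e2 := sub_smul_dslope F1 s₁ s
    have e3 : F1 s₁ = 0 := by
      rw [hF1, dslope_same, hF]
      simp [hder]
    have e4 : F s₁ = 0 := by simp [hF]
    rw [e3, sub_zero, smul_eq_mul] at e2
    rw [e4, sub_zero, smul_eq_mul] at e1
    rw [← e1, ← hF1, ← e2]; ring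
  have hFpos : ∀ s, 0 < s → s ≠ s₁ → 0 < F s := by
    intro s hs hne
    have h1 := hle s hs
    have h2 := exp_neg_sub_one_add_pos (sub_ne_zero.2 hne)
    have h3 : exp (-m * (exp (-(s - s₁)) - 1 + (s - s₁))) < 1 := by
      rw [Real.exp_lt_one_iff]; nlinarith
    show 0 < D s₁ - D s
    nlinarith
  have hF2pos : ∀ s, 0 < s → 0 < F2 s := by
    intro s hs
    by_cases hne : s = s₁
    · subst hne
      set c := D s * min m 1 / 8 with hc
      have hcpos : 0 < c := by positivity
      refine hcpos.trans_le ?_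
      have hcont := (hF2an s hs).continuousAt.tendsto.mono_left (nhdsWithin_le_nhds (s := {s}ᶜ))
      refine ge_of_tendsto hcont ?_
      filter_upwards [self_mem_nhdsWithin, nhdsWithin_le_nhds (lt_mem_nhds hs),
        nhdsWithin_le_nhds (Metric.ball_mem_nhds s one_pos)] with t ht ht0 htb
      have hts : t - s ≠ 0 := sub_ne_zero.2 ht
      have hab : |t - s| ≤ 1 := by
        have := Metric.mem_ball.1 htb; rw [Real.dist_eq] at this; exact this.le
      have hg := exp_neg_sub_one_add_ge hab
      set h := t - s
      set k := min m 1 * (h ^ 2 / 4) with hk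
      have hmm : 0 < min m 1 := by positivity
      have hk0 : 0 ≤ k := by positivity
      have hk1 : k ≤ 1 := by
        have : h ^ 2 ≤ 1 := by rw [← sq_abs]; nlinarith [abs_nonneg h]
        have := min_le_right m 1
        nlinarith
      have h1 : exp (-m * (exp (-h) - 1 + h)) ≤ exp (-k) := by
        refine Real.exp_le_exp.2 ?_
        have : k ≤ m * (h ^ 2 / 4) := by
          rw [hk]; gcongr; exact min_le_left _ _
        nlinarith
      have h2 : exp (-k) ≤ 1 - k / 2 := by
        have hb := Real.exp_bound (x := -k) (by rw [abs_neg, abs_of_nonneg hk0]; exact hk1)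
          (n := 2) (by norm_num)
        simp [Finset.sum_range_succ, Nat.factorial] at hb
        have hb' := (abs_le.1 hb).2
        have : k ≤ 1 / 4 := by
          have : h ^ 2 ≤ 1 := by rw [← sq_abs]; nlinarith [abs_nonneg h]
          have := min_le_right m 1
          nlinarith
        nlinarith
      have h3 := hle t ht0
      have h4 : D s * (k / 2) ≤ F t := by
        show _ ≤ D s - D t
        have : D t ≤ D s * (1 - k / 2) := h3.trans
          (mul_le_mul_of_nonneg_left (h1.trans h2) hDm.le)
        linarith
      rw [hfac t] at h4
      have h5 : D s * (k / 2) = h ^ 2 * c := by rw [hk, hc]; ring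
      rw [h5] at h4
      exact le_of_mul_le_mul_left h4 (by positivity)
    · have := hFpos s hs hne
      rw [hfac] at this
      exact pos_of_mul_pos_right this (sq_nonneg _)
  set δ : ℝ → ℝ := fun s => (s - s₁) * √(F2 s) with hδ
  have hδan : ∀ s, 0 < s → AnalyticAt ℝ δ s := fun s hs =>
    (analyticAt_id.sub analyticAt_const).mul
      (((Real.contDiffAt_sqrt (hF2pos s hs).ne').analyticAt).comp (hF2an s hs))
  have hδsq : ∀ s, 0 < s → δ s ^ 2 = D s₁ - D s := by
    intro s hs
    show ((s - s₁) * √(F2 s)) ^ 2 = F s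
    rw [mul_pow, Real.sq_sqrt (hF2pos s hs).le, hfac]
  have hδne : ∀ s, 0 < s → deriv δ s ≠ 0 := by
    intro s hs hd
    by_cases hne : s = s₁
    · subst hne
      have h1 : HasDerivAt δ (1 * √(F2 s) + (s - s) * deriv (fun x => √(F2 x)) s) s := by
        refine ((hasDerivAt_id s).sub_const s).mul (DifferentiableAt.hasDerivAt ?_)
        exact (((Real.contDiffAt_sqrt (hF2pos s hs).ne').analyticAt).comp
          (hF2an s hs)).differentiableAt
      have h2 := h1.deriv
      rw [hd] at h2
      have := Real.sqrt_pos.2 (hF2pos s hs)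
      simp at h2
      linarith
    · apply hne
      refine huniq s hs ?_
      have h1 : HasDerivAt (fun x => D s₁ - δ x ^ 2) (-(↑2 * δ s ^ (2 - 1) * 0)) s := by
        have := ((hδan s hs).differentiableAt.hasDerivAt.pow 2).const_sub (D s₁)
        rwa [hd] at this
      have h2 : D =ᶠ[𝓝 s] fun x => D s₁ - δ x ^ 2 := by
        filter_upwards [lt_mem_nhds hs] with x hx
        rw [hδsq x hx]; ring
      rw [h2.deriv_eq, h1.deriv]; simp
  have hδderiv_cont : ContinuousOn (deriv δ) (Ioi 0) := fun s hs =>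
    (hδan s hs).deriv.continuousAt.continuousWithinAt
  have hδs₁ : 0 < deriv δ s₁ := by
    have h1 : HasDerivAt δ (1 * √(F2 s₁) + (s₁ - s₁) * deriv (fun x => √(F2 x)) s₁) s₁ := by
      refine ((hasDerivAt_id s₁).sub_const s₁).mul (DifferentiableAt.hasDerivAt ?_)
      exact (((Real.contDiffAt_sqrt (hF2pos s₁ hs₁).ne').analyticAt).comp
        (hF2an s₁ hs₁)).differentiableAt
    rw [h1.deriv]
    simpa using hF2pos s₁ hs₁
  have hδpos : ∀ s, 0 < s → 0 < deriv δ s := by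
    intro s hs
    by_contra hneg
    obtain ⟨t, ht, ht0⟩ := isPreconnected_Ioi.intermediate_value (mem_Ioi.2 hs) (mem_Ioi.2 hs₁)
      hδderiv_cont (⟨not_lt.1 hneg, hδs₁.le⟩ : (0 : ℝ) ∈ Icc _ _)
    exact hδne t ht ht0
  have hδcont : ContinuousOn δ (Ioi 0) := fun s hs => (hδan s hs).continuousAt.continuousWithinAt
  have hδmono : StrictMonoOn δ (Ioi 0) :=
    strictMonoOn_of_deriv_pos (convex_Ioi 0) hδcont (by
      rw [interior_Ioi]; exact fun s hs => hδpos s hs)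
  set Z := √(D s₁) with hZ
  have hZpos : 0 < Z := Real.sqrt_pos.2 hDm
  have hZsq : Z ^ 2 = D s₁ := Real.sq_sqrt hDm.le
  have hrange : ∀ s, 0 < s → δ s ∈ Ioo (-Z) Z := by
    intro s hs
    have := hδsq s hs
    have := hpos s hs
    exact abs_lt.1 (abs_lt_of_sq_lt_sq (by linarith) hZpos.le)
  have hright : Tendsto δ atTop (𝓝 Z) := by
    have h1 : Tendsto (fun s => √(D s₁ - D s)) atTop (𝓝 (√(D s₁ - 0))) :=
      (tendsto_const_nhds.sub hinf).sqrt
    rw [sub_zero] at h1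
    refine h1.congr' ?_
    filter_upwards [eventually_gt_atTop s₁] with s hs
    rw [← hδsq s (hs₁.trans hs), Real.sqrt_sq]
    exact mul_nonneg (by linarith) (Real.sqrt_nonneg _)
  have hleft : Tendsto δ (𝓝[>] 0) (𝓝 (-Z)) := by
    have h1 : Tendsto (fun s => -√(D s₁ - D s)) (𝓝[>] 0) (𝓝 (-√(D s₁ - 0))) :=
      (tendsto_const_nhds.sub h0).sqrt.neg
    rw [sub_zero] at h1
    refine h1.congr' ?_
    filter_upwards [self_mem_nhdsWithin, nhdsWithin_le_nhds (gt_mem_nhds hs₁)] with s hs hs'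
    rw [← hδsq s hs, Real.sqrt_sq_eq_abs, abs_of_nonpos, neg_neg]
    exact mul_nonpos_of_nonpos_of_nonneg (by linarith) (Real.sqrt_nonneg _)
  have hsurj : ∀ z ∈ Ioo (-Z) Z, ∃ s ∈ Ioi (0 : ℝ), δ s = z := by
    intro z hz
    obtain ⟨x, hx1, hx2⟩ := ((hleft.eventually (gt_mem_nhds hz.1)).and self_mem_nhdsWithin).exists
    obtain ⟨y, hy1, hy2⟩ := ((hright.eventually (lt_mem_nhds hz.2)).and
      (eventually_gt_atTop 0)).exists
    obtain ⟨t, ht, ht0⟩ := isPreconnected_Ioi.intermediate_value hx2 (mem_Ioi.2 hy2)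
      hδcont (⟨hx1.le, hy1.le⟩ : z ∈ Icc _ _)
    exact ⟨t, ht, ht0⟩
  set S := Function.invFunOn δ (Ioi 0) with hS
  have hSpos : ∀ z ∈ Ioo (-Z) Z, 0 < S z := fun z hz => Function.invFunOn_mem (hsurj z hz)
  have hδS : ∀ z ∈ Ioo (-Z) Z, δ (S z) = z := fun z hz => Function.invFunOn_eq (hsurj z hz)
  have hSδ : ∀ s, 0 < s → S (δ s) = s := fun s hs =>
    hδmono.injOn (hSpos _ (hrange s hs)) hs (hδS _ (hrange s hs))
  have hSmono : StrictMonoOn S (Ioo (-Z) Z) := by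
    intro x hx y hy hxy
    by_contra hcon
    have := hδmono.monotoneOn (hSpos y hy) (hSpos x hx) (not_lt.1 hcon)
    rw [hδS x hx, hδS y hy] at this
    linarith
  refine ⟨Z, hZpos, S, ?_, hSmono, hSpos, ?_, ?_, ?_, ?_, s₁, hs₁, hZsq.symm⟩
  · intro z hz
    have h1 := (analyticAt_comp_iff_of_deriv_ne_zero (g := S) (hδan _ (hSpos z hz))
      (hδne _ (hSpos z hz))).1 (by
        refine analyticAt_id.congr ?_
        filter_upwards [lt_mem_nhds (hSpos z hz)] with s hs
        exact (hSδ s hs).symm)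
    rwa [hδS z hz] at h1
  · rw [Metric.tendsto_nhdsWithin_nhds]
    intro ε hε
    refine ⟨δ ε + Z, by linarith [(hrange ε hε).1], fun {z} hz hd => ?_⟩
    rw [Real.dist_eq, abs_of_pos (by linarith [show -Z < z from hz])] at hd
    have hz' : z ∈ Ioo (-Z) Z := ⟨hz, by linarith [(hrange ε hε).2]⟩
    have := hSmono hz' (hrange ε hε) (by linarith)
    rw [hSδ ε hε] at this
    rw [Real.dist_eq, sub_zero, abs_of_pos (hSpos z hz')]
    exact this
  · refine tendsto_atTop.2 fun M => ?_
    have hM : 0 < max M 1 := by positivity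
    filter_upwards [Ioo_mem_nhdsLT (hrange _ hM).2] with z hz
    have hz' : z ∈ Ioo (-Z) Z := ⟨(hrange _ hM).1.trans hz.1, hz.2⟩
    have := hSmono (hrange _ hM) hz' hz.1
    rw [hSδ _ hM] at this
    exact (le_max_left _ _).trans this.le
  · intro z hz
    have := hδsq _ (hSpos z hz)
    rw [hδS z hz] at this
    linarith
  · intro s hs
    refine ⟨hZsq ▸ hmax s hs, ?_⟩
    rw [hZsq, ← hδsq s hs, Real.sqrt_sq_eq_abs]
    rcases le_total 0 (δ s) with h | h
    · exact ⟨1, Or.inl rfl, by rw [abs_of_nonneg h, one_mul, hSδ s hs]⟩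
    · exact ⟨-1, Or.inr rfl, by rw [abs_of_nonpos h, neg_one_mul, neg_neg, hSδ s hs]⟩

lemma integrableOn_pow_mul_exp_neg_mul (n : ℕ) {b : ℝ} (hb : 0 < b) :
    IntegrableOn (fun u : ℝ => u ^ n * exp (-(b * u))) (Ioi 0) := by
  have := integrableOn_rpow_mul_exp_neg_mul_rpow (s := n) (p := 1) (b := b)
    (by have : (0 : ℝ) ≤ n := Nat.cast_nonneg n
        linarith) one_pos hb
  refine this.congr_fun (fun u _ => ?_) measurableSet_Ioi
  simp [Real.rpow_natCast]

lemma integrableOn_exp_neg_mul {b : ℝ} (hb : 0 < b) :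
    IntegrableOn (fun u : ℝ => exp (-(b * u))) (Ioi 0) := by
  simpa using integrableOn_pow_mul_exp_neg_mul 0 hb

lemma integrableOn_mul_exp_neg_mul {b : ℝ} (hb : 0 < b) :
    IntegrableOn (fun u : ℝ => u * exp (-(b * u))) (Ioi 0) := by
  simpa using integrableOn_pow_mul_exp_neg_mul 1 hb

lemma integral_mul_exp_neg_mul {b : ℝ} (hb : 0 < b) :
    ∫ u in Ioi (0 : ℝ), u * exp (-(b * u)) = 1 / b ^ 2 := by
  have := Real.integral_rpow_mul_exp_neg_mul_Ioi (a := 2) two_pos hb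
  norm_num at this
  rw [this]; simp

lemma integral_exp_neg_mul {b : ℝ} (hb : 0 < b) :
    ∫ u in Ioi (0 : ℝ), exp (-(b * u)) = 1 / b := by
  have := Real.integral_rpow_mul_exp_neg_mul_Ioi (a := 1) one_pos hb
  norm_num at this
  rw [this]; simp

/-- The normalized integral whose product with `1 - exp (-s)` gives the divergence derivative. -/
noncomputable def gapInt (c s : ℝ) : ℝ :=
  ∫ u in Ioi (0 : ℝ), u * exp (-u) / (1 + c * exp (s - (1 - exp (-s)) * u))

/-- The derivative, in the logarithmic scale gap `s`, of the divergence term. -/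
noncomputable def gapDeriv (p c s : ℝ) : ℝ := p * (1 - exp (-s)) * gapInt c s

lemma integrableOn_mul_exp_neg : IntegrableOn (fun u : ℝ => u * exp (-u)) (Ioi 0) := by
  simpa using integrableOn_mul_exp_neg_mul one_pos

lemma integral_mul_exp_neg : ∫ u in Ioi (0 : ℝ), u * exp (-u) = 1 := by
  simpa using integral_mul_exp_neg_mul one_pos

lemma integrableOn_gapInt {c : ℝ} (hc : 0 < c) (s : ℝ) :
    IntegrableOn (fun u : ℝ => u * exp (-u) / (1 + c * exp (s - (1 - exp (-s)) * u))) (Ioi 0) := by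
  refine integrableOn_mul_exp_neg.mono' (Measurable.aestronglyMeasurable (by fun_prop)) ?_
  filter_upwards [self_mem_ae_restrict measurableSet_Ioi] with u hu
  have hu0 : 0 < u := hu
  rw [Real.norm_of_nonneg (by positivity)]
  refine div_le_self (by positivity) ?_
  have : 0 < c * exp (s - (1 - exp (-s)) * u) := by positivity
  linarith

lemma gapInt_le_one {c : ℝ} (hc : 0 < c) (s : ℝ) : gapInt c s ≤ 1 := by
  rw [← integral_mul_exp_neg]
  refine setIntegral_mono_on (integrableOn_gapInt hc s) integrableOn_mul_exp_neg measurableSet_Ioi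
      ?_
  intro u hu
  have hu0 : 0 < u := hu
  refine div_le_self (by positivity) ?_
  have : 0 < c * exp (s - (1 - exp (-s)) * u) := by positivity
  linarith

lemma gapInt_ge {c : ℝ} (hc : 0 < c) {s : ℝ} (hs : 0 < s) : 1 / (1 + c * exp s) ≤ gapInt c s := by
  have h1 : ∫ u in Ioi (0 : ℝ), u * exp (-u) / (1 + c * exp s) = 1 / (1 + c * exp s) := by
    rw [integral_div, integral_mul_exp_neg]
  rw [← h1]
  refine setIntegral_mono_on (integrableOn_mul_exp_neg.div_const _) (integrableOn_gapInt hc s)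
    measurableSet_Ioi ?_
  intro u hu
  have hu0 : 0 < u := hu
  have hq : 0 ≤ 1 - exp (-s) := by
    have := Real.exp_le_one_iff.2 (show -s ≤ 0 by linarith)
    linarith
  gcongr
  nlinarith

lemma gapInt_pos {c : ℝ} (hc : 0 < c) {s : ℝ} (hs : 0 < s) : 0 < gapInt c s :=
  lt_of_lt_of_le (by positivity) (gapInt_ge hc hs)

lemma one_sub_exp_neg_pos {s : ℝ} (hs : 0 < s) : 0 < 1 - exp (-s) := by
  have := Real.exp_lt_one_iff.2 (show -s < 0 by linarith)
  linarith

lemma gapDeriv_pos {p c : ℝ} (hp : 0 < p) (hc : 0 < c) {s : ℝ} (hs : 0 < s) :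
    0 < gapDeriv p c s :=
  mul_pos (mul_pos hp (one_sub_exp_neg_pos hs)) (gapInt_pos hc hs)

lemma gapDeriv_le {p c : ℝ} (hp : 0 < p) (hc : 0 < c) {s : ℝ} (hs : 0 < s) :
    gapDeriv p c s ≤ p * (1 - exp (-s)) :=
  mul_le_of_le_one_right (mul_pos hp (one_sub_exp_neg_pos hs)).le (gapInt_le_one hc s)

lemma gapDeriv_lt {p c : ℝ} (hp : 0 < p) (hc : 0 < c) {s : ℝ} (hs : 0 < s) :
    gapDeriv p c s < p := by
  refine (gapDeriv_le hp hc hs).trans_lt ?_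
  have := Real.exp_pos (-s)
  nlinarith

lemma gapDeriv_ge {p c : ℝ} (hp : 0 < p) (hc : 0 < c) :
    ∃ k, 0 < k ∧ ∀ s, 0 < s → s ≤ 1 → k * s ≤ gapDeriv p c s := by
  refine ⟨p / 2 * (1 / (1 + c * exp 1)), by positivity, fun s hs hs1 => ?_⟩
  have h1 : s / 2 ≤ 1 - exp (-s) := by
    have hb := Real.exp_bound (x := -s) (by rw [abs_neg, abs_of_pos hs]; exact hs1)
      (n := 2) (by norm_num)
    simp [Finset.sum_range_succ, Nat.factorial] at hb
    rcases le_total s (1 / 2) with h | h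
    · have hb' := (abs_le.1 hb).2
      nlinarith
    · have e1 : exp (-s) ≤ exp (-(1/2)) := Real.exp_le_exp.2 (by linarith)
      have e2 : exp (-(1/2) : ℝ) ≤ 2⁻¹ + 2⁻¹ / 2 * (1 / 1) := by
        have hb2 := Real.exp_bound (x := -(1/2)) (by norm_num [abs_of_pos]) (n := 2) (by norm_num)
        norm_num [Finset.sum_range_succ, Nat.factorial] at hb2
        have := (abs_le.1 hb2).2
        linarith
      have e3 : 1 + s ≤ exp s := by linarith [Real.add_one_le_exp s]
      have e4 : exp (-s) ≤ 1 / (1 + s) := by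
        rw [Real.exp_neg, ← one_div]; gcongr
      have e5 : 1 / (1 + s) ≤ 1 - s / 2 := by
        rw [div_le_iff₀ (by linarith)]; nlinarith
      linarith
  have h2 := gapInt_ge hc hs
  have h3 : 1 / (1 + c * exp 1) ≤ 1 / (1 + c * exp s) := by gcongr
  unfold gapDeriv
  calc p / 2 * (1 / (1 + c * exp 1)) * s = p * (s / 2) * (1 / (1 + c * exp 1)) := by ring
    _ ≤ p * (1 - exp (-s)) * gapInt c s := by
      gcongr
      · exact mul_nonneg hp.le (one_sub_exp_neg_pos hs).le
      · exact h3.trans h2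

lemma tendsto_gapDeriv_zero {p c : ℝ} (hp : 0 < p) (hc : 0 < c) :
    Tendsto (gapDeriv p c) (𝓝[>] 0) (𝓝 0) := by
  have h1 : Tendsto (fun s : ℝ => p * (1 - exp (-s))) (𝓝[>] 0) (𝓝 0) := by
    have : Continuous fun s : ℝ => p * (1 - exp (-s)) := by fun_prop
    have := (this.tendsto 0).mono_left (nhdsWithin_le_nhds (s := Ioi 0))
    simpa using this
  refine tendsto_of_tendsto_of_tendsto_of_le_of_le' tendsto_const_nhds h1 ?_ ?_
  · filter_upwards [self_mem_nhdsWithin] with s hs using (gapDeriv_pos hp hc hs).le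
  · filter_upwards [self_mem_nhdsWithin] with s hs using gapDeriv_le hp hc hs

lemma tendsto_gapDeriv_atTop {p c : ℝ} (hp : 0 < p) (hc : 0 < c) :
    Tendsto (gapDeriv p c) atTop (𝓝 0) := by
  have h1 : Tendsto (gapInt c) atTop (𝓝 0) := by
    have : Tendsto (gapInt c) atTop (𝓝 (∫ _ in Ioi (0 : ℝ), (0 : ℝ))) := by
      refine tendsto_integral_filter_of_dominated_convergence (fun u => u * exp (-u)) ?_ ?_
        integrableOn_mul_exp_neg ?_
      · exact Eventually.of_forall fun s => Measurable.aestronglyMeasurable (by fun_prop)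
      · refine Eventually.of_forall fun s => ?_
        filter_upwards [self_mem_ae_restrict measurableSet_Ioi] with u hu
        have hu0 : 0 < u := hu
        rw [Real.norm_of_nonneg (by positivity)]
        refine div_le_self (by positivity) ?_
        have : 0 < c * exp (s - (1 - exp (-s)) * u) := by positivity
        linarith
      · filter_upwards [self_mem_ae_restrict measurableSet_Ioi] with u hu
        have hu0 : 0 < u := hu
        refine Tendsto.const_div_atTop ?_ _
        refine tendsto_atTop_add_const_left _ _ (Tendsto.const_mul_atTop hc ?_)
        refine Real.tendsto_exp_atTop.comp ?_
        refine tendsto_atTop_mono (fun s => ?_) (tendsto_atTop_add_const_right _ (-u) tendsto_id)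
        have := Real.exp_pos (-s)
        simp only [id]
        nlinarith
    simpa using this
  refine squeeze_zero' (g := fun s => p * gapInt c s) ?_ ?_ (by simpa using h1.const_mul p)
  · filter_upwards [eventually_gt_atTop 0] with s hs using (gapDeriv_pos hp hc hs).le
  · filter_upwards [eventually_gt_atTop 0] with s hs
    unfold gapDeriv
    have := gapInt_pos hc hs
    have := Real.exp_pos (-s)
    gcongr
    nlinarith

/-- The integrand of `gapInt` after the substitution `u = exp x`. -/
noncomputable def gapKernel (c s x : ℝ) : ℝ :=
  exp (2 * x) / (exp (exp x) + c * exp (s + exp (x - s)))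

lemma gapKernel_pos {c : ℝ} (hc : 0 < c) (s x : ℝ) : 0 < gapKernel c s x := by
  unfold gapKernel; positivity

lemma image_exp_univ : exp '' univ = Ioi (0 : ℝ) := by rw [image_univ, Real.range_exp]

lemma gapKernel_eq (c s x : ℝ) : gapKernel c s x =
    |exp x| • (exp x * exp (-exp x) / (1 + c * exp (s - (1 - exp (-s)) * exp x))) := by
  rw [abs_of_pos (exp_pos x), smul_eq_mul]
  unfold gapKernel
  have e1 : s + exp (x - s) = exp x + (s - (1 - exp (-s)) * exp x) := by
    rw [sub_eq_add_neg x s, Real.exp_add]; ring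
  have e2 : exp (2 * x) = exp x * exp x := by rw [two_mul, Real.exp_add]
  rw [e1, Real.exp_add (exp x), e2, Real.exp_neg (exp x)]
  have h := (exp_pos (exp x)).ne'
  rw [show exp (exp x) + c * (exp (exp x) * exp (s - (1 - exp (-s)) * exp x)) =
    exp (exp x) * (1 + c * exp (s - (1 - exp (-s)) * exp x)) by ring, ← div_div]
  field_simp

lemma gapInt_eq_integral (c s : ℝ) : gapInt c s = ∫ x, gapKernel c s x := by
  have := integral_image_eq_integral_abs_deriv_smul (s := univ) (f := exp) (f' := exp)
    MeasurableSet.univ (fun x _ => (Real.hasDerivAt_exp x).hasDerivWithinAt)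
    Real.exp_injective.injOn
    (fun u : ℝ => u * exp (-u) / (1 + c * exp (s - (1 - exp (-s)) * u)))
  rw [image_exp_univ, setIntegral_univ] at this
  unfold gapInt
  rw [this]
  exact integral_congr_ae (Eventually.of_forall fun x => (gapKernel_eq c s x).symm)

lemma integrable_gapKernel {c : ℝ} (hc : 0 < c) (s : ℝ) : Integrable (gapKernel c s) := by
  have := (integrableOn_image_iff_integrableOn_abs_deriv_smul (s := univ) (f := exp) (f' := exp)
    MeasurableSet.univ (fun x _ => (Real.hasDerivAt_exp x).hasDerivWithinAt)
    Real.exp_injective.injOn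
    (fun u : ℝ => u * exp (-u) / (1 + c * exp (s - (1 - exp (-s)) * u)))).1 (by
      rw [image_exp_univ]; exact integrableOn_gapInt hc s)
  rw [integrableOn_univ] at this
  exact this.congr (Eventually.of_forall fun x => (gapKernel_eq c s x).symm)

lemma measurable_gapKernel (c s : ℝ) : Measurable (gapKernel c s) := by
  unfold gapKernel; fun_prop

lemma gapKernel_le {c : ℝ} (hc : 0 < c) (s x : ℝ) : gapKernel c s x ≤ 2 := by
  unfold gapKernel
  rw [div_le_iff₀ (by positivity), two_mul x, Real.exp_add]
  have h1 := Real.quadratic_le_exp_of_nonneg (exp_pos x).le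
  have h2 : 0 < c * exp (s + exp (x - s)) := by positivity
  nlinarith [exp_pos x]

lemma rpow_mul_rpow_add_le {x₁ x₂ y₁ y₂ a b : ℝ} (hx₁ : 0 < x₁) (hx₂ : 0 < x₂) (hy₁ : 0 < y₁)
    (hy₂ : 0 < y₂) (ha : 0 ≤ a) (hb : 0 ≤ b) (hab : a + b = 1) :
    x₁ ^ a * y₁ ^ b + x₂ ^ a * y₂ ^ b ≤ (x₁ + x₂) ^ a * (y₁ + y₂) ^ b := by
  have hx : 0 < x₁ + x₂ := by positivity
  have hy : 0 < y₁ + y₂ := by positivity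
  have h1 := Real.geom_mean_le_arith_mean2_weighted ha hb (div_pos hx₁ hx).le (div_pos hy₁ hy).le
      hab
  have h2 := Real.geom_mean_le_arith_mean2_weighted ha hb (div_pos hx₂ hx).le (div_pos hy₂ hy).le
      hab
  rw [Real.div_rpow hx₁.le hx.le, Real.div_rpow hy₁.le hy.le, div_mul_div_comm] at h1
  rw [Real.div_rpow hx₂.le hx.le, Real.div_rpow hy₂.le hy.le, div_mul_div_comm] at h2
  have h3 : a * (x₁ / (x₁ + x₂)) + b * (y₁ / (y₁ + y₂)) +
      (a * (x₂ / (x₁ + x₂)) + b * (y₂ / (y₁ + y₂))) = 1 := by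
    rw [← hab]; field_simp; ring
  have h4 := add_le_add h1 h2
  rw [h3, ← add_div, div_le_one (by positivity)] at h4
  exact h4

lemma exp_rpow_mul (x y a b : ℝ) : exp x ^ a * exp y ^ b = exp (a * x + b * y) := by
  rw [← Real.exp_mul, ← Real.exp_mul, ← Real.exp_add]; ring_nf

lemma exp_convex_comb_le {x y a b : ℝ} (ha : 0 ≤ a) (hb : 0 ≤ b) (hab : a + b = 1) :
    exp (a * x + b * y) ≤ a * exp x + b * exp y :=
  convexOn_exp.2 (mem_univ x) (mem_univ y) ha hb hab

lemma gapKernel_rpow_mul_le {c : ℝ} (hc : 0 < c) {s t x y a b : ℝ} (ha : 0 ≤ a) (hb : 0 ≤ b)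
    (hab : a + b = 1) :
    gapKernel c s x ^ a * gapKernel c t y ^ b ≤ gapKernel c (a * s + b * t) (a * x + b * y) := by
  unfold gapKernel
  rw [Real.div_rpow (by positivity) (by positivity), Real.div_rpow (by positivity) (by positivity),
    div_mul_div_comm, exp_rpow_mul]
  have e : a * (2 * x) + b * (2 * y) = 2 * (a * x + b * y) := by ring
  rw [e]
  refine div_le_div_of_nonneg_left (by positivity) (by positivity) ?_
  refine le_trans ?_ (rpow_mul_rpow_add_le (exp_pos _) (by positivity) (exp_pos _) (by positivity)
    ha hb hab)
  rw [Real.mul_rpow hc.le (exp_pos _).le, Real.mul_rpow hc.le (exp_pos _).le, exp_rpow_mul,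
    show c ^ a * exp (s + exp (x - s)) ^ a * (c ^ b * exp (t + exp (y - t)) ^ b) =
      (c ^ a * c ^ b) * (exp (s + exp (x - s)) ^ a * exp (t + exp (y - t)) ^ b) by ring,
    ← Real.rpow_add hc, hab, Real.rpow_one, exp_rpow_mul]
  have h1 := exp_convex_comb_le (x := x) (y := y) ha hb hab
  have h2 := exp_convex_comb_le (x := x - s) (y := y - t) ha hb hab
  have e2 : a * (x - s) + b * (y - t) = a * x + b * y - (a * s + b * t) := by ring
  rw [e2] at h2
  have h3 : a * s + b * t + exp (a * x + b * y - (a * s + b * t)) ≤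
      a * (s + exp (x - s)) + b * (t + exp (y - t)) := by linarith
  exact add_le_add (Real.exp_le_exp.2 h1)
    (mul_le_mul_of_nonneg_left (Real.exp_le_exp.2 h3) hc.le)

lemma gapInt_rpow_mul_le {c : ℝ} (hc : 0 < c) {s t a b : ℝ} (ha : 0 < a) (hb : 0 < b)
    (hab : a + b = 1) : gapInt c s ^ a * gapInt c t ^ b ≤ gapInt c (a * s + b * t) := by
  rw [gapInt_eq_integral, gapInt_eq_integral, gapInt_eq_integral]
  refine prekopa_leindler_one_dim ha hb hab (gapKernel_pos hc s) (gapKernel_pos hc t)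
    (gapKernel_pos hc _) ⟨2, ?_⟩ ⟨2, ?_⟩ ?_ (integrable_gapKernel hc _) (integrable_gapKernel hc _)
    (integrable_gapKernel hc _) (measurable_gapKernel _ _) (measurable_gapKernel _ _)
    (measurable_gapKernel _ _) fun x y => gapKernel_rpow_mul_le hc ha.le hb.le hab
  · rintro _ ⟨x, rfl⟩; exact gapKernel_le hc _ _
  · rintro _ ⟨x, rfl⟩; exact gapKernel_le hc _ _
  · intro τ
    refine Set.OrdConnected.mk fun x hx y hy z hz => ?_
    have hz' : z ∈ segment ℝ x y := by rwa [segment_eq_Icc (hz.1.trans hz.2)]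
    obtain ⟨a', b', ha', hb', hab', rfl⟩ := hz'
    have hx' : τ < gapKernel c _ x := hx
    have hy' : τ < gapKernel c _ y := hy
    have h := gapKernel_rpow_mul_le hc (s := a * s + b * t) (t := a * s + b * t) (x := x) (y := y)
      ha' hb' hab'
    have e : a' * (a * s + b * t) + b' * (a * s + b * t) = a * s + b * t := by
      rw [← add_mul, hab', one_mul]
    rw [e] at h
    refine lt_of_lt_of_le ?_ h
    set m := min (gapKernel c (a * s + b * t) x) (gapKernel c (a * s + b * t) y)
    have hm : 0 < m := lt_min (gapKernel_pos hc _ _) (gapKernel_pos hc _ _)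
    calc τ < m := lt_min hx' hy'
      _ = m ^ a' * m ^ b' := by rw [← Real.rpow_add hm, hab', Real.rpow_one]
      _ ≤ _ := mul_le_mul (Real.rpow_le_rpow hm.le (min_le_left _ _) ha')
        (Real.rpow_le_rpow hm.le (min_le_right _ _) hb') (by positivity)
        (Real.rpow_nonneg (gapKernel_pos hc _ _).le _)

lemma concaveOn_log_gapInt {c : ℝ} (hc : 0 < c) :
    ConcaveOn ℝ (Ioi 0) fun s => log (gapInt c s) := by
  refine concaveOn_iff_forall_pos.2 ⟨convex_Ioi 0, fun s hs t ht a b ha hb hab => ?_⟩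
  have h := gapInt_rpow_mul_le hc (s := s) (t := t) ha hb hab
  have hs' := gapInt_pos hc hs
  have ht' := gapInt_pos hc ht
  have := Real.log_le_log (by positivity) h
  rw [Real.log_mul (by positivity) (by positivity), Real.log_rpow hs', Real.log_rpow ht'] at this
  simpa using this

lemma ConcaveOn.le_tangent {f : ℝ → ℝ} {f' x y : ℝ} {S : Set ℝ} (hf : ConcaveOn ℝ S f) (hx : x ∈ S)
    (hy : y ∈ S) (h : HasDerivAt f f' x) : f y ≤ f x + f' * (y - x) := by
  rcases lt_trichotomy x y with hxy | rfl | hxy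
  · have := hf.slope_le_of_hasDerivAt hx hy hxy h
    rw [slope_def_field, div_le_iff₀ (sub_pos.2 hxy)] at this
    linarith
  · simp
  · have := hf.le_slope_of_hasDerivAt hy hx hxy h
    rw [slope_def_field, le_div_iff₀ (sub_pos.2 hxy)] at this
    linarith

lemma gapDeriv_le_of_deriv_eq_zero {p c : ℝ} (hp : 0 < p) (hc : 0 < c)
    (hd : ∀ s, 0 < s → DifferentiableAt ℝ (gapDeriv p c) s) {s₁ : ℝ} (hs₁ : 0 < s₁)
    (h0 : deriv (gapDeriv p c) s₁ = 0) : ∃ m, 0 < m ∧ ∀ s, 0 < s →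
      gapDeriv p c s ≤ gapDeriv p c s₁ * exp (-m * (exp (-(s - s₁)) - 1 + (s - s₁))) := by
  have hq := one_sub_exp_neg_pos hs₁
  have hlog : ∀ s, 0 < s → log (gapInt c s) =
      log (gapDeriv p c s) - log p - log (1 - exp (-s)) := by
    intro s hs
    have := one_sub_exp_neg_pos hs
    have := gapInt_pos hc hs
    unfold gapDeriv
    rw [Real.log_mul (by positivity) (by positivity), Real.log_mul (by positivity) (by positivity)]
    ring
  set m := exp (-s₁) / (1 - exp (-s₁)) with hm
  have hmpos : 0 < m := by positivity
  refine ⟨m, hmpos, fun s hs => ?_⟩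
  have hder : HasDerivAt (fun s => log (gapInt c s)) (-m) s₁ := by
    have h1 : HasDerivAt (fun s => log (gapDeriv p c s)) 0 s₁ := by
      have := (hd s₁ hs₁).hasDerivAt.log (gapDeriv_pos hp hc hs₁).ne'
      rwa [h0, zero_div] at this
    have h2 : HasDerivAt (fun s : ℝ => log (1 - exp (-s))) m s₁ := by
      have := (((hasDerivAt_neg s₁).exp).const_sub 1).log hq.ne'
      convert this using 1
      rw [hm]; ring
    have h3 := (h1.sub_const (log p)).sub h2
    rw [zero_sub] at h3
    refine h3.congr_of_eventuallyEq ?_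
    filter_upwards [lt_mem_nhds hs₁] with t ht using hlog t ht
  have htan := (concaveOn_log_gapInt hc).le_tangent (mem_Ioi.2 hs₁) (mem_Ioi.2 hs) hder
  rw [hlog s hs, hlog s₁ hs₁] at htan
  have hqs := one_sub_exp_neg_pos hs
  have hratio : log (1 - exp (-s)) - log (1 - exp (-s₁)) ≤ m * (1 - exp (-(s - s₁))) := by
    rw [← Real.log_div hqs.ne' hq.ne']
    refine (Real.log_le_sub_one_of_pos (by positivity)).trans (le_of_eq ?_)
    have : exp (-s₁) * exp (-(s - s₁)) = exp (-s) := by rw [← Real.exp_add]; ring_nf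
    rw [hm]
    field_simp
    linarith
  have hfin : log (gapDeriv p c s) ≤
      log (gapDeriv p c s₁ * exp (-m * (exp (-(s - s₁)) - 1 + (s - s₁)))) := by
    rw [Real.log_mul (gapDeriv_pos hp hc hs₁).ne' (exp_pos _).ne', Real.log_exp]
    linarith
  exact (Real.log_le_log_iff (gapDeriv_pos hp hc hs)
    (mul_pos (gapDeriv_pos hp hc hs₁) (exp_pos _))).1 hfin

/-- The holomorphic extension of `gapDeriv` in the variable `z = exp (-s)`. -/
noncomputable def gapDerivC (p c : ℝ) (z : ℂ) : ℂ :=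
  p / (1 - z) * ∫ v : ℝ in Ioi 0,
    ((v : ℂ) * Complex.exp (-(v / (1 - z)))) * (z / (z + c * Complex.exp (-v)))

lemma gapDerivC_ofReal (p c : ℝ) {s : ℝ} (hs : 0 < s) :
    gapDerivC p c (exp (-s) : ℝ) = (gapDeriv p c s : ℝ) := by
  have hq := one_sub_exp_neg_pos hs
  set q := 1 - exp (-s) with hqdef
  have h1 : ∫ v : ℝ in Ioi 0, ((v : ℂ) * Complex.exp (-(v / (1 - (exp (-s) : ℝ))))) *
      ((exp (-s) : ℝ) / ((exp (-s) : ℝ) + c * Complex.exp (-v))) =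
      ((∫ v : ℝ in Ioi 0, (v * exp (-(v / q))) * (exp (-s) / (exp (-s) + c * exp (-v))) : ℝ) : ℂ) :=
    by
    rw [← integral_complex_ofReal]
    refine integral_congr_ae (Eventually.of_forall fun v => ?_)
    simp only [hqdef]
    push_cast
    rfl
  unfold gapDerivC
  rw [h1]
  have h2 := integral_comp_mul_left_Ioi
    (fun v => (v * exp (-(v / q))) * (exp (-s) / (exp (-s) + c * exp (-v)))) 0 hq
  rw [mul_zero, smul_eq_mul] at h2
  have h3 : ∫ v : ℝ in Ioi 0, (v * exp (-(v / q))) * (exp (-s) / (exp (-s) + c * exp (-v))) =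
      q * ∫ u in Ioi (0 : ℝ), (q * u * exp (-(q * u / q))) *
        (exp (-s) / (exp (-s) + c * exp (-(q * u)))) := by
    rw [h2, mul_inv_cancel_left₀ hq.ne']
  have h4 : ∫ u in Ioi (0 : ℝ), (q * u * exp (-(q * u / q))) *
        (exp (-s) / (exp (-s) + c * exp (-(q * u)))) = q * gapInt c s := by
    unfold gapInt
    rw [← integral_const_mul]
    refine integral_congr_ae (Eventually.of_forall fun u => ?_)
    simp only
    have e1 : q * u / q = u := by field_simp
    have e2 : exp (s - (1 - exp (-s)) * u) = exp (-(q * u)) / exp (-s) := by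
      rw [← Real.exp_sub]; congr 1; rw [hqdef]; ring
    rw [e1, e2]
    have := exp_pos (-s)
    have e3 : 1 + c * (exp (-(q * u)) / exp (-s)) = (exp (-s) + c * exp (-(q * u))) / exp (-s) := by
      field_simp
    rw [e3, div_div_eq_mul_div]
    ring
  rw [h3, h4]
  unfold gapDeriv
  rw [← hqdef]
  have hqC : (1 - ((exp (-s) : ℝ) : ℂ)) = (q : ℂ) := by rw [hqdef]; push_cast; ring
  rw [hqC]
  have : (q : ℂ) ≠ 0 := by exact_mod_cast hq.ne'
  push_cast
  field_simp

lemma norm_div_add_le {c : ℝ} (hc : 0 < c) {z : ℂ} (_hz : 0 < z.re) (v : ℝ) :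
    z.re ≤ ‖z + c * Complex.exp (-v)‖ := by
  have h1 : (z + c * Complex.exp (-v)).re = z.re + c * exp (-v) := by
    have : (c : ℂ) * Complex.exp (-v) = ((c * exp (-v) : ℝ) : ℂ) := by push_cast; rfl
    rw [this, Complex.add_re, Complex.ofReal_re]
  have h2 := Complex.re_le_norm (z + c * Complex.exp (-v))
  rw [h1] at h2
  have : 0 < c * exp (-v) := by positivity
  linarith

lemma add_exp_ne_zero {c : ℝ} (hc : 0 < c) {z : ℂ} (hz : 0 < z.re) (v : ℝ) :
    z + c * Complex.exp (-v) ≠ 0 :=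
  norm_pos_iff.1 (hz.trans_le (norm_div_add_le hc hz v))

lemma one_sub_ne_zero_of_re_lt {z : ℂ} (hz : z.re < 1) : 1 - z ≠ 0 := by
  intro h
  have := congrArg Complex.re h
  simp at this
  linarith

lemma norm_exp_neg_div (z : ℂ) (v : ℝ) :
    ‖Complex.exp (-(v / (1 - z)))‖ = exp (-((1 - z)⁻¹.re * v)) := by
  rw [Complex.norm_exp, div_eq_mul_inv, Complex.neg_re, Complex.re_ofReal_mul, mul_comm]

lemma re_inv_one_sub_pos {z : ℂ} (hz : z.re < 1) : 0 < (1 - z)⁻¹.re := by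
  rw [Complex.inv_re]
  refine div_pos ?_ (Complex.normSq_pos.2 (one_sub_ne_zero_of_re_lt hz))
  simp; linarith

lemma differentiableOn_gapDerivC (p : ℝ) {c : ℝ} (hc : 0 < c) :
    DifferentiableOn ℂ (gapDerivC p c) {z | 0 < z.re ∧ z.re < 1} := by
  have h1 : DifferentiableOn ℂ (fun z : ℂ => (p : ℂ) / (1 - z)) {z | 0 < z.re ∧ z.re < 1} := by
    intro z hz
    exact (DifferentiableAt.div (by fun_prop) (by fun_prop)
      (one_sub_ne_zero_of_re_lt hz.2)).differentiableWithinAt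
  refine h1.mul (differentiableOn_integral_of_dominated ?_ ?_ ?_)
  · intro z _
    exact Measurable.aestronglyMeasurable (by fun_prop)
  · refine Eventually.of_forall fun v z hz => DifferentiableAt.differentiableWithinAt ?_
    have h1 := one_sub_ne_zero_of_re_lt hz.2
    have h2 := add_exp_ne_zero hc hz.1 v
    refine DifferentiableAt.mul ((differentiableAt_const _).mul ?_)
      (differentiableAt_id.div (by fun_prop) h2)
    refine DifferentiableAt.cexp (DifferentiableAt.neg ?_)
    exact DifferentiableAt.div (by fun_prop) (by fun_prop) h1
  · intro z₀ hz₀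
    have hκ := re_inv_one_sub_pos hz₀.2
    set κ := (1 - z₀)⁻¹.re with hκdef
    have c1 : ContinuousAt (fun z : ℂ => (1 - z)⁻¹.re) z₀ :=
      Complex.continuous_re.continuousAt.comp
        (ContinuousAt.inv₀ (by fun_prop) (one_sub_ne_zero_of_re_lt hz₀.2))
    have c2 : ContinuousAt (fun z : ℂ => ‖z‖ / z.re) z₀ :=
      ContinuousAt.div (by fun_prop) Complex.continuous_re.continuousAt hz₀.1.ne'
    have e1 : ∀ᶠ z in 𝓝 z₀, κ / 2 < (1 - z)⁻¹.re := c1.eventually (lt_mem_nhds (by linarith))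
    have e2 : ∀ᶠ z in 𝓝 z₀, ‖z‖ / z.re < ‖z₀‖ / z₀.re + 1 :=
      c2.eventually (gt_mem_nhds (by linarith))
    have e3 : ∀ᶠ z in 𝓝 z₀, 0 < z.re ∧ z.re < 1 :=
      (Complex.continuous_re.continuousAt.eventually (lt_mem_nhds hz₀.1)).and
        (Complex.continuous_re.continuousAt.eventually (gt_mem_nhds hz₀.2))
    obtain ⟨r, hr, hball⟩ := Metric.eventually_nhds_iff_ball.1 (e1.and (e2.and e3))
    refine ⟨r, hr, fun z hz => (hball z hz).2.2,
      fun v => v * exp (-(κ / 2 * v)) * (‖z₀‖ / z₀.re + 1),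
      (integrableOn_mul_exp_neg_mul (by linarith)).mul_const _, ?_⟩
    filter_upwards [self_mem_ae_restrict measurableSet_Ioi] with v hv z hz
    have hv0 : 0 < v := hv
    obtain ⟨h1, h2, h3, h4⟩ := hball z hz
    rw [norm_mul, norm_mul, norm_exp_neg_div, norm_div, Complex.norm_real,
        Real.norm_of_nonneg hv0.le]
    have h5 : ‖z‖ / ‖z + c * Complex.exp (-v)‖ ≤ ‖z₀‖ / z₀.re + 1 :=
      (div_le_div_of_nonneg_left (norm_nonneg _) h3 (norm_div_add_le hc h3 v)).trans h2.le
    gcongr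

lemma analyticAt_gapDerivC (p : ℝ) {c : ℝ} (hc : 0 < c) {z : ℂ} (h0 : 0 < z.re) (h1 : z.re < 1) :
    AnalyticAt ℂ (gapDerivC p c) z := by
  refine (differentiableOn_gapDerivC p hc).analyticAt ?_
  exact ((isOpen_lt continuous_const Complex.continuous_re).inter
    (isOpen_lt Complex.continuous_re continuous_const)).mem_nhds ⟨h0, h1⟩

lemma analyticAt_gapDerivC_exp (p : ℝ) {c : ℝ} (hc : 0 < c) {s : ℝ} (hs : 0 < s) :
    AnalyticAt ℂ (fun z : ℂ => gapDerivC p c (Complex.exp (-z))) s := by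
  have h1 : Complex.exp (-(s : ℂ)) = ((exp (-s) : ℝ) : ℂ) := by push_cast; rfl
  have h2 : AnalyticAt ℂ (gapDerivC p c) (Complex.exp (-(s : ℂ))) := by
    rw [h1]
    refine analyticAt_gapDerivC p hc ?_ ?_
    · rw [Complex.ofReal_re]; exact exp_pos _
    · rw [Complex.ofReal_re]; linarith [one_sub_exp_neg_pos hs]
  exact h2.fun_comp (f := fun z : ℂ => Complex.exp (-z)) (analyticAt_id.neg.cexp)

lemma gapDeriv_eq_re (p c : ℝ) {s : ℝ} (hs : 0 < s) :
    gapDeriv p c s = (gapDerivC p c (Complex.exp (-(s : ℂ)))).re := by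
  have h1 : Complex.exp (-(s : ℂ)) = ((exp (-s) : ℝ) : ℂ) := by push_cast; rfl
  rw [h1, gapDerivC_ofReal p c hs, Complex.ofReal_re]

lemma analyticAt_gapDeriv (p : ℝ) {c : ℝ} (hc : 0 < c) {s : ℝ} (hs : 0 < s) :
    AnalyticAt ℝ (gapDeriv p c) s := by
  refine (analyticAt_gapDerivC_exp p hc hs).re_ofReal.congr ?_
  filter_upwards [lt_mem_nhds hs] with t ht
  exact (gapDeriv_eq_re p c ht).symm

lemma tendsto_pow_mul_exp_neg_mul_atTop (n : ℕ) {b : ℝ} (hb : 0 < b) :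
    Tendsto (fun v : ℝ => v ^ n * exp (-(b * v))) atTop (𝓝 0) := by
  have := tendsto_rpow_mul_exp_neg_mul_atTop_nhds_zero n b hb
  refine this.congr fun v => ?_
  rw [Real.rpow_natCast, neg_mul]

lemma integrableOn_mul_cexp_neg_div {z : ℂ} (hz : z.re < 1) :
    IntegrableOn (fun v : ℝ => (v : ℂ) * Complex.exp (-(v / (1 - z)))) (Ioi 0) := by
  refine (integrableOn_mul_exp_neg_mul (re_inv_one_sub_pos hz)).mono'
    (Measurable.aestronglyMeasurable (by fun_prop)) ?_
  filter_upwards [self_mem_ae_restrict measurableSet_Ioi] with v hv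
  rw [norm_mul, norm_exp_neg_div, Complex.norm_real, Real.norm_of_nonneg (le_of_lt hv)]

lemma integral_mul_cexp_neg_div {z : ℂ} (hz : z.re < 1) :
    ∫ v : ℝ in Ioi 0, (v : ℂ) * Complex.exp (-(v / (1 - z))) = (1 - z) ^ 2 := by
  have hW := one_sub_ne_zero_of_re_lt hz
  have hκ := re_inv_one_sub_pos hz
  set W := 1 - z with hWdef
  have hder : ∀ v : ℝ, HasDerivAt (fun v : ℝ => -((v * W + W ^ 2) * Complex.exp (-(v / W))))
      ((v : ℂ) * Complex.exp (-(v / W))) v := by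
    intro v
    have h1 : HasDerivAt (fun v : ℂ => -((v * W + W ^ 2) * Complex.exp (-(v / W))))
      ((v : ℂ) * Complex.exp (-(v / W))) (v : ℂ) := by
      have := ((((hasDerivAt_id (v : ℂ)).mul_const W).add_const (W ^ 2)).mul
        ((((hasDerivAt_id (v : ℂ)).div_const W).neg).cexp)).neg
      refine this.congr_deriv ?_
      simp only [id, Pi.neg_apply]
      field_simp
      ring
    exact h1.comp_ofReal
  have hlim : Tendsto (fun v : ℝ => -((v * W + W ^ 2) * Complex.exp (-(v / W)))) atTop (𝓝 0) := by
    have h1 := (tendsto_pow_mul_exp_neg_mul_atTop 1 hκ).mul_const ‖W‖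
    have h2 := (tendsto_pow_mul_exp_neg_mul_atTop 0 hκ).mul_const (‖W‖ ^ 2)
    have h3 := h1.add h2
    simp only [zero_mul, add_zero] at h3
    refine squeeze_zero_norm' ?_ h3
    filter_upwards [eventually_ge_atTop 0] with v hv
    rw [norm_neg, norm_mul, hWdef, norm_exp_neg_div, ← hWdef]
    have : ‖(v : ℂ) * W + W ^ 2‖ ≤ v * ‖W‖ + ‖W‖ ^ 2 := by
      refine (norm_add_le _ _).trans (le_of_eq ?_)
      rw [norm_mul, norm_pow, Complex.norm_real, Real.norm_of_nonneg hv]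
    have h4 := mul_le_mul_of_nonneg_right this (exp_pos (-(W⁻¹.re * v))).le
    refine h4.trans (le_of_eq ?_)
    ring
  rw [integral_Ioi_of_hasDerivAt_of_tendsto' (fun v _ => hder v)
    (integrableOn_mul_cexp_neg_div hz) hlim]
  simp

lemma norm_gapDerivC_sub_le (p : ℝ) {c : ℝ} (hc : 0 < c) {z : ℂ} (h0 : 0 < z.re) (h1 : z.re < 1) :
    ‖gapDerivC p c z - p * (1 - z)‖ ≤ ‖(p : ℂ) / (1 - z)‖ * (c / z.re) := by
  have hne := one_sub_ne_zero_of_re_lt h1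
  have hκ := re_inv_one_sub_pos h1
  have hi := integrableOn_mul_cexp_neg_div h1
  have hbd : ∀ᵐ v : ℝ ∂(volume.restrict (Ioi (0 : ℝ))), ‖(v : ℂ) * Complex.exp (-(v / (1 - z))) *
      (c * Complex.exp (-v) / (z + c * Complex.exp (-v)))‖ ≤ v * exp (-v) * (c / z.re) := by
    filter_upwards [self_mem_ae_restrict measurableSet_Ioi] with v hv
    have hv0 : 0 < v := hv
    have e1 : ‖(c : ℂ) * Complex.exp (-v)‖ = c * exp (-v) := by
      have : (c : ℂ) * Complex.exp (-v) = ((c * exp (-v) : ℝ) : ℂ) := by push_cast; rfl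
      rw [this, Complex.norm_real, Real.norm_of_nonneg (by positivity)]
    have e2 : exp (-((1 - z)⁻¹.re * v)) ≤ 1 := by
      rw [Real.exp_le_one_iff]; nlinarith
    rw [norm_mul, norm_mul, norm_exp_neg_div, norm_div, Complex.norm_real,
      Real.norm_of_nonneg hv0.le, e1]
    have e3 := norm_div_add_le hc h0 v
    calc v * exp (-((1 - z)⁻¹.re * v)) * (c * exp (-v) / ‖z + c * Complex.exp (-v)‖)
        ≤ v * 1 * (c * exp (-v) / z.re) := by gcongr
      _ = v * exp (-v) * (c / z.re) := by ring
  have hib : IntegrableOn (fun v : ℝ => v * exp (-v) * (c / z.re)) (Ioi 0) :=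
    integrableOn_mul_exp_neg.mul_const _
  have hi2 : IntegrableOn (fun v : ℝ => (v : ℂ) * Complex.exp (-(v / (1 - z))) *
      (c * Complex.exp (-v) / (z + c * Complex.exp (-v)))) (Ioi 0) :=
    Integrable.mono' hib (Measurable.aestronglyMeasurable (by fun_prop)) hbd
  have hsplit : ∫ v : ℝ in Ioi 0,
      ((v : ℂ) * Complex.exp (-(v / (1 - z)))) * (z / (z + c * Complex.exp (-v))) =
      (1 - z) ^ 2 - ∫ v : ℝ in Ioi 0, (v : ℂ) * Complex.exp (-(v / (1 - z))) *
      (c * Complex.exp (-v) / (z + c * Complex.exp (-v))) := by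
    rw [← integral_mul_cexp_neg_div h1, ← integral_sub hi hi2]
    refine integral_congr_ae (Eventually.of_forall fun v => ?_)
    simp only
    have := add_exp_ne_zero hc h0 v
    field_simp
    ring
  unfold gapDerivC
  rw [hsplit, mul_sub]
  have e : (p : ℂ) / (1 - z) * (1 - z) ^ 2 = p * (1 - z) := by field_simp
  rw [e, sub_sub_cancel_left, norm_neg, norm_mul]
  gcongr
  refine (norm_integral_le_of_norm_le hib hbd).trans (le_of_eq ?_)
  rw [integral_mul_const, integral_mul_exp_neg, one_mul]

lemma tendsto_gapDerivC_div (p : ℝ) {c : ℝ} (hc : 0 < c) :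
    Tendsto (fun T : ℝ => gapDerivC p c (1 / 2 + T * Complex.I) / T) atTop
      (𝓝 (-(p * Complex.I))) := by
  have hre : ∀ T : ℝ, ((1 / 2 + T * Complex.I : ℂ)).re = 1 / 2 := by intro T; simp
  have hinv : Tendsto (fun T : ℝ => T⁻¹) atTop (𝓝 0) := tendsto_inv_atTop_zero
  have h1 : Tendsto (fun T : ℝ => (p : ℂ) * (1 - (1 / 2 + T * Complex.I)) / T) atTop
      (𝓝 (-(p * Complex.I))) := by
    have h2 : Tendsto (fun T : ℝ => (p : ℂ) * (1 / 2) * ((T⁻¹ : ℝ) : ℂ) - p * Complex.I) atTop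
        (𝓝 ((p : ℂ) * (1 / 2) * ((0 : ℝ) : ℂ) - p * Complex.I)) :=
      (((Complex.continuous_ofReal.tendsto 0).comp hinv).const_mul _).sub_const _
    simp only [Complex.ofReal_zero, mul_zero, zero_sub] at h2
    refine h2.congr' ?_
    filter_upwards [eventually_ne_atTop 0] with T hT
    have : (T : ℂ) ≠ 0 := by exact_mod_cast hT
    push_cast
    field_simp
    ring
  have h3 : Tendsto (fun T : ℝ => (gapDerivC p c (1 / 2 + T * Complex.I) -
      p * (1 - (1 / 2 + T * Complex.I))) / T) atTop (𝓝 0) := by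
    refine squeeze_zero_norm' (a := fun T : ℝ => |p| * 2 * (c * 2) * T⁻¹) ?_
      (by simpa using hinv.const_mul (|p| * 2 * (c * 2)))
    filter_upwards [eventually_gt_atTop 0] with T hT
    rw [norm_div, Complex.norm_real, Real.norm_of_nonneg hT.le, div_eq_mul_inv]
    gcongr
    refine (norm_gapDerivC_sub_le p hc (by rw [hre]; norm_num) (by rw [hre]; norm_num)).trans ?_
    rw [hre, norm_div, Complex.norm_real, Real.norm_eq_abs, div_div_eq_mul_div, div_one]
    gcongr
    rw [div_le_iff₀ (norm_pos_iff.2 (one_sub_ne_zero_of_re_lt (by rw [hre]; norm_num)))]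
    have : 1 / 2 ≤ ‖(1 - (1 / 2 + T * Complex.I) : ℂ)‖ := by
      have := Complex.re_le_norm (1 - (1 / 2 + T * Complex.I) : ℂ)
      rw [Complex.sub_re, hre] at this
      norm_num at this ⊢
      linarith
    nlinarith [abs_nonneg p]
  have h4 := h1.add h3
  rw [add_zero] at h4
  refine h4.congr fun T => ?_
  rw [← add_div]; ring_nf

/-- The mixture of a unit-rate and a rate-`r` exponential density. -/
noncomputable def expMix (p q r u : ℝ) : ℝ := p * exp (-u) + q * (r * exp (-(r * u)))

/-- The (negative) differential entropy of `expMix`. -/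
noncomputable def negEnt (p q r : ℝ) : ℝ :=
  ∫ u in Ioi (0 : ℝ), expMix p q r u * log (expMix p q r u)

lemma expMix_pos {p q r : ℝ} (hp : 0 < p) (hq : 0 < q) (hr : 0 < r) (u : ℝ) :
    0 < expMix p q r u := by unfold expMix; positivity

lemma abs_log_le_of_exp_bounds {x c C u : ℝ} (hc : 0 < c) (hu : 0 ≤ u)
    (h1 : c * exp (-u) ≤ x) (h2 : x ≤ C) : |log x| ≤ |log c| + |log C| + u := by
  have hx : 0 < x := lt_of_lt_of_le (by positivity) h1
  have e1 := Real.log_le_log (by positivity) h1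
  rw [Real.log_mul hc.ne' (exp_pos _).ne', Real.log_exp] at e1
  have e2 := Real.log_le_log hx h2
  rw [abs_le]
  have := neg_abs_le (log c)
  have := le_abs_self (log C)
  have := abs_nonneg (log c)
  have := abs_nonneg (log C)
  constructor <;> linarith

lemma abs_log_expMix_le {p q r R : ℝ} (hp : 0 < p) (hq : 0 < q) (hr : 0 < r) (hR : r ≤ R) {u : ℝ}
    (hu : 0 ≤ u) : |log (expMix p q r u)| ≤ |log p| + |log (p + q * R)| + u := by
  refine abs_log_le_of_exp_bounds hp hu ?_ ?_
  · unfold expMix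
    have : 0 < q * (r * exp (-(r * u))) := by positivity
    linarith
  · unfold expMix
    have h1 : exp (-u) ≤ 1 := Real.exp_le_one_iff.2 (by linarith)
    have h2 : exp (-(r * u)) ≤ 1 := Real.exp_le_one_iff.2 (by nlinarith)
    have h3 : r * exp (-(r * u)) ≤ R * 1 :=
      mul_le_mul hR h2 (exp_pos _).le (hr.le.trans hR)
    nlinarith

lemma hasDerivAt_expMix_rate (p q r u : ℝ) :
    HasDerivAt (fun r => expMix p q r u) (q * ((1 - r * u) * exp (-(r * u)))) r := by
  unfold expMix
  have h1 : HasDerivAt (fun r : ℝ => exp (-(r * u))) (exp (-(r * u)) * -(1 * u)) r :=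
    (((hasDerivAt_id r).mul_const u).neg).exp
  have := (((hasDerivAt_id r).mul h1).const_mul q).const_add (p * exp (-u))
  refine this.congr_deriv ?_
  simp only [id]
  ring

lemma hasDerivAt_expMix (p q r u : ℝ) :
    HasDerivAt (expMix p q r) (-(p * exp (-u) + q * (r ^ 2 * exp (-(r * u))))) u := by
  unfold expMix
  have h1 : HasDerivAt (fun u : ℝ => exp (-(r * u))) (exp (-(r * u)) * -(r * 1)) u :=
    (((hasDerivAt_id u).const_mul r).neg).exp
  have h2 : HasDerivAt (fun u : ℝ => exp (-u)) (exp (-u) * -1) u := (hasDerivAt_neg u).exp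
  have := (h2.const_mul p).add ((h1.const_mul r).const_mul q)
  refine this.congr_deriv ?_
  ring

lemma measurable_expMix (p q r : ℝ) : Measurable (expMix p q r) := by unfold expMix; fun_prop

lemma integrableOn_affine_sq_mul_exp (A B : ℝ) {b : ℝ} (hb : 0 < b) :
    IntegrableOn (fun u : ℝ => (1 + A * u) * (B + u) * exp (-(b * u))) (Ioi 0) := by
  have h0 := (integrableOn_pow_mul_exp_neg_mul 0 hb).const_mul B
  have h1 := (integrableOn_pow_mul_exp_neg_mul 1 hb).const_mul (1 + A * B)
  have h2 := (integrableOn_pow_mul_exp_neg_mul 2 hb).const_mul A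
  refine ((h0.add h1).add h2).congr (Eventually.of_forall fun u => ?_)
  simp only [Pi.add_apply]
  ring

lemma integrableOn_negEnt {p q r : ℝ} (hp : 0 < p) (hq : 0 < q) (hr : 0 < r) :
    IntegrableOn (fun u => expMix p q r u * log (expMix p q r u)) (Ioi 0) := by
  set C := |log p| + |log (p + q * r)| with hC
  have h1 := (integrableOn_affine_sq_mul_exp 0 C one_pos).const_mul p
  have h2 := (integrableOn_affine_sq_mul_exp 0 C hr).const_mul (q * r)
  refine (h1.add h2).mono' (((measurable_expMix p q r).mul
    (measurable_expMix p q r).log).aestronglyMeasurable) ?_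
  filter_upwards [self_mem_ae_restrict measurableSet_Ioi] with u hu
  have hu0 : 0 < u := hu
  rw [norm_mul, Real.norm_eq_abs, Real.norm_eq_abs, abs_of_pos (expMix_pos hp hq hr u)]
  refine (mul_le_mul_of_nonneg_left (abs_log_expMix_le hp hq hr le_rfl hu0.le)
    (expMix_pos hp hq hr u).le).trans (le_of_eq ?_)
  simp only [Pi.add_apply, ← hC]
  unfold expMix
  ring_nf

lemma hasDerivAt_negEnt_aux {p q r : ℝ} (hp : 0 < p) (hq : 0 < q) (hr : 0 < r) :
    IntegrableOn (fun u => q * ((1 - r * u) * exp (-(r * u))) * (log (expMix p q r u) + 1))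
        (Ioi 0) ∧
    HasDerivAt (negEnt p q)
      (∫ u in Ioi (0 : ℝ), q * ((1 - r * u) * exp (-(r * u))) * (log (expMix p q r u) + 1)) r := by
  set C := |log p| + |log (p + q * (2 * r))| with hC
  refine hasDerivAt_integral_of_dominated_loc_of_deriv_le (s := Ioo (r / 2) (2 * r)) (x₀ := r)
    (μ := volume.restrict (Ioi 0)) (F := fun r u => expMix p q r u * log (expMix p q r u))
    (F' := fun r u => q * ((1 - r * u) * exp (-(r * u))) * (log (expMix p q r u) + 1))
    (bound := fun u => q * ((1 + 2 * r * u) * (C + 1 + u) * exp (-(r / 2 * u))))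
    (Ioo_mem_nhds (by linarith) (by linarith)) ?_ (integrableOn_negEnt hp hq hr) ?_ ?_ ?_ ?_
  · exact Eventually.of_forall fun x => ((measurable_expMix p q x).mul
      (measurable_expMix p q x).log).aestronglyMeasurable
  · have := (measurable_expMix p q r).log
    exact Measurable.aestronglyMeasurable (by fun_prop)
  · filter_upwards [self_mem_ae_restrict measurableSet_Ioi] with u hu x hx
    have hu0 : 0 < u := hu
    have hx0 : 0 < x := by linarith [hx.1]
    rw [norm_mul, norm_mul, norm_mul, Real.norm_of_nonneg hq.le, Real.norm_of_nonneg (exp_pos _).le,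
      mul_assoc]
    have e1 : ‖1 - x * u‖ ≤ 1 + 2 * r * u := by
      rw [Real.norm_eq_abs, abs_le]
      have := mul_le_mul_of_nonneg_right hx.2.le hu0.le
      have := mul_pos hx0 hu0
      constructor <;> nlinarith
    have e2 : exp (-(x * u)) ≤ exp (-(r / 2 * u)) := by
      refine Real.exp_le_exp.2 ?_
      have := mul_le_mul_of_nonneg_right hx.1.le hu0.le
      linarith
    have e3 : ‖log (expMix p q x u) + 1‖ ≤ C + 1 + u := by
      have := abs_log_expMix_le hp hq hx0 hx.2.le hu0.le
      refine (norm_add_le _ _).trans ?_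
      rw [norm_one, Real.norm_eq_abs]
      linarith
    have : 0 ≤ C := by positivity
    calc q * (‖1 - x * u‖ * exp (-(x * u)) * ‖log (expMix p q x u) + 1‖)
        ≤ q * ((1 + 2 * r * u) * exp (-(r / 2 * u)) * (C + 1 + u)) := by gcongr
      _ = _ := by ring
  · exact (integrableOn_affine_sq_mul_exp (2 * r) (C + 1) (by linarith)).const_mul q
  · refine Eventually.of_forall fun u x hx => ?_
    have hx0 : 0 < x := by linarith [hx.1]
    have h1 := hasDerivAt_expMix_rate p q x u
    have hpos := expMix_pos hp hq hx0 u
    refine (h1.mul (h1.log hpos.ne')).congr_deriv ?_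
    field_simp

lemma hasDerivAt_negEnt {p q r : ℝ} (hp : 0 < p) (hq : 0 < q) (hr : 0 < r) :
    HasDerivAt (negEnt p q) (q * ∫ u in Ioi (0 : ℝ), u * exp (-(r * u)) *
      (r + (1 - r) * (p * exp (-u) / expMix p q r u))) r := by
  obtain ⟨hi, hd⟩ := hasDerivAt_negEnt_aux hp hq hr
  refine hd.congr_deriv ?_
  set C := |log p| + |log (p + q * r)| with hC
  have hcancel : ∀ u, (p * exp (-u) + q * (r ^ 2 * exp (-(r * u)))) / expMix p q r u =
      r + (1 - r) * (p * exp (-u) / expMix p q r u) := by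
    intro u
    have hpos := expMix_pos hp hq hr u
    rw [div_eq_iff hpos.ne', add_mul, mul_assoc, div_mul_cancel₀ _ hpos.ne']
    unfold expMix; ring
  have hbd : ∀ u, |r + (1 - r) * (p * exp (-u) / expMix p q r u)| ≤ r + |1 - r| := by
    intro u
    have hpos := expMix_pos hp hq hr u
    have h1 : p * exp (-u) / expMix p q r u ≤ 1 := by
      rw [div_le_one hpos]; unfold expMix
      have : 0 < q * (r * exp (-(r * u))) := by positivity
      linarith
    have h0 : 0 ≤ p * exp (-u) / expMix p q r u := by positivity
    refine (abs_add_le _ _).trans ?_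
    rw [abs_of_pos hr, abs_mul, abs_of_nonneg h0]
    have := mul_le_of_le_one_right (abs_nonneg (1 - r)) h1
    linarith
  have hi2 : IntegrableOn (fun u => u * exp (-(r * u)) *
      (r + (1 - r) * (p * exp (-u) / expMix p q r u))) (Ioi 0) := by
    have hm := measurable_expMix p q r
    refine ((integrableOn_mul_exp_neg_mul hr).mul_const (r + |1 - r|)).mono'
      (Measurable.aestronglyMeasurable (by fun_prop)) ?_
    filter_upwards [self_mem_ae_restrict measurableSet_Ioi] with u hu
    have hu0 : 0 < u := hu
    rw [norm_mul, Real.norm_of_nonneg (show 0 ≤ u * exp (-(r * u)) by positivity)]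
    exact mul_le_mul_of_nonneg_left (hbd u) (by positivity)
  have hG : ∀ u : ℝ, HasDerivAt (fun u => q * (u * exp (-(r * u)) * (log (expMix p q r u) + 1)))
      (q * ((1 - r * u) * exp (-(r * u))) * (log (expMix p q r u) + 1) -
        q * (u * exp (-(r * u)) * (r + (1 - r) * (p * exp (-u) / expMix p q r u)))) u := by
    intro u
    have h1 : HasDerivAt (fun u : ℝ => exp (-(r * u))) (exp (-(r * u)) * -(r * 1)) u :=
      (((hasDerivAt_id u).const_mul r).neg).exp
    have h2 := ((hasDerivAt_expMix p q r u).log (expMix_pos hp hq hr u).ne').add_const 1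
    rw [neg_div, hcancel] at h2
    refine ((((hasDerivAt_id u).mul h1).mul h2).const_mul q).congr_deriv ?_
    simp only [id, Pi.mul_apply]
    ring
  have hlim : Tendsto (fun u => q * (u * exp (-(r * u)) * (log (expMix p q r u) + 1))) atTop
      (𝓝 0) := by
    have t1 := (tendsto_pow_mul_exp_neg_mul_atTop 1 hr).const_mul (q * (C + 1))
    have t2 := (tendsto_pow_mul_exp_neg_mul_atTop 2 hr).const_mul q
    have t3 := t1.add t2
    simp only [mul_zero, add_zero] at t3
    refine squeeze_zero_norm' ?_ t3
    filter_upwards [eventually_ge_atTop 0] with u hu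
    rw [norm_mul, norm_mul, Real.norm_of_nonneg hq.le,
      Real.norm_of_nonneg (show 0 ≤ u * exp (-(r * u)) by positivity)]
    have e3 : ‖log (expMix p q r u) + 1‖ ≤ C + 1 + u := by
      have := abs_log_expMix_le hp hq hr le_rfl hu
      refine (norm_add_le _ _).trans ?_
      rw [norm_one, Real.norm_eq_abs]
      linarith
    calc q * (u * exp (-(r * u)) * ‖log (expMix p q r u) + 1‖)
        ≤ q * (u * exp (-(r * u)) * (C + 1 + u)) := by gcongr
      _ = _ := by ring
  have hint := integral_Ioi_of_hasDerivAt_of_tendsto' (a := 0) (fun u _ => hG u)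
    (hi.sub (hi2.const_mul q)) hlim
  rw [integral_sub hi (hi2.const_mul q), integral_const_mul] at hint
  simp only [zero_mul, mul_zero, sub_zero] at hint
  linarith

lemma negEnt_one {p q : ℝ} (hpq : p + q = 1) : negEnt p q 1 = -1 := by
  have h : ∀ u, expMix p q 1 u = exp (-u) := by
    intro u; unfold expMix; rw [one_mul, one_mul, ← add_mul, hpq, one_mul]
  unfold negEnt
  simp only [h, Real.log_exp]
  have : ∀ u : ℝ, exp (-u) * -u = -(u * exp (-u)) := fun u => by ring
  simp only [this, integral_neg, integral_mul_exp_neg]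

/-- The divergence gap between the two components at logarithmic scale distance `s`. -/
noncomputable def gap (p q s : ℝ) : ℝ := -negEnt p q (exp (-s)) - 1 - q * s

lemma gap_zero {p q : ℝ} (hpq : p + q = 1) : gap p q 0 = 0 := by
  unfold gap; simp [negEnt_one hpq]

lemma mul_deriv_negEnt_exp {p q : ℝ} (hp : 0 < p) (hq : 0 < q) (s : ℝ) :
    exp (-s) * (q * ∫ u in Ioi (0 : ℝ), u * exp (-(exp (-s) * u)) *
      (exp (-s) + (1 - exp (-s)) * (p * exp (-u) / expMix p q (exp (-s)) u))) =
    q + gapDeriv p (p / q) s := by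
  have hr := exp_pos (-s)
  have hpt : ∀ u, q * exp (-s) * (u * exp (-(exp (-s) * u)) *
      (exp (-s) + (1 - exp (-s)) * (p * exp (-u) / expMix p q (exp (-s)) u))) =
      q * exp (-s) ^ 2 * (u * exp (-(exp (-s) * u))) + p * (1 - exp (-s)) *
        (u * exp (-u) / (1 + p / q * exp (s - (1 - exp (-s)) * u))) := by
    intro u
    have e1 : exp (s - (1 - exp (-s)) * u) = exp (-u) / (exp (-s) * exp (-(exp (-s) * u))) := by
      rw [← Real.exp_add, ← Real.exp_sub]; ring_nf
    have hm := expMix_pos hp hq hr u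
    have e2 : 1 + p / q * exp (s - (1 - exp (-s)) * u) =
        expMix p q (exp (-s)) u / (q * (exp (-s) * exp (-(exp (-s) * u)))) := by
      rw [e1]; unfold expMix
      field_simp
      ring
    rw [e2]
    field_simp
  rw [← mul_assoc, mul_comm (exp (-s)) q, ← integral_const_mul]
  simp only [hpt]
  rw [integral_add ((integrableOn_mul_exp_neg_mul hr).const_mul _)
    ((integrableOn_gapInt (div_pos hp hq) s).const_mul _), integral_const_mul, integral_const_mul,
    integral_mul_exp_neg_mul hr]
  unfold gapDeriv gapInt
  field_simp

lemma hasDerivAt_gap {p q : ℝ} (hp : 0 < p) (hq : 0 < q) (s : ℝ) :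
    HasDerivAt (gap p q) (gapDeriv p (p / q) s) s := by
  have h1 : HasDerivAt (fun s : ℝ => exp (-s)) (exp (-s) * -1) s := (hasDerivAt_neg s).exp
  have h2 := (hasDerivAt_negEnt hp hq (exp_pos (-s))).comp s h1
  have h3 := ((h2.neg).sub_const 1).sub ((hasDerivAt_id s).const_mul q)
  refine h3.congr_deriv ?_
  have := mul_deriv_negEnt_exp hp hq s
  linarith

lemma gap_pos {p q : ℝ} (hp : 0 < p) (hq : 0 < q) (hpq : p + q = 1) {s : ℝ} (hs : 0 < s) :
    0 < gap p q s := by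
  have hmono : StrictMonoOn (gap p q) (Ici 0) := by
    refine strictMonoOn_of_deriv_pos (convex_Ici 0)
      (fun x _ => (hasDerivAt_gap hp hq x).continuousAt.continuousWithinAt) fun x hx => ?_
    rw [interior_Ici] at hx
    rw [(hasDerivAt_gap hp hq x).deriv]
    exact gapDeriv_pos hp (div_pos hp hq) hx
  have := hmono (mem_Ici.2 le_rfl) (mem_Ici.2 hs.le) hs
  rwa [gap_zero hpq] at this

lemma analyticAt_gap {p q : ℝ} (hp : 0 < p) (hq : 0 < q) {s : ℝ} (hs : 0 < s) :
    AnalyticAt ℝ (gap p q) s := by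
  refine analyticAt_of_hasDerivAt_re (f' := gapDeriv p (p / q))
    (g := fun z => gapDerivC p (p / q) (Complex.exp (-z)))
    (Eventually.of_forall fun x => hasDerivAt_gap hp hq x)
    (analyticAt_gapDerivC_exp p (div_pos hp hq) hs) ?_
  filter_upwards [lt_mem_nhds hs] with x hx using gapDeriv_eq_re p (p / q) hx

/-- A two-component optimality function `p Φ(α) + q Φ(β) + gap (α - β)`. -/
noncomputable def pairFun (p q : ℝ) (Φ : ℝ → ℝ) (α β : ℝ) : ℝ :=
  p * Φ α + q * Φ β + gap p q (α - β)

/-- Optimality of a profile `Φ` with derivative `w - 1`, on the region `β₀ ≤ β < α ≤ 0`, `m ≤ α`. -/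
structure PairOptimal (p q m β₀ : ℝ) (Φ w : ℝ → ℝ) (W : ℂ → ℂ) : Prop where
  hp : 0 < p
  hq : 0 < q
  hpq : p + q = 1
  hm : m < 0
  hder : ∀ t, HasDerivAt Φ (w t - 1) t
  han : ∀ t, AnalyticAt ℝ Φ t
  hlim : Tendsto w atTop (𝓝 0)
  hW : DifferentiableOn ℂ W {z | 0 < z.re}
  hWw : ∀ t : ℝ, W ((exp t : ℝ) : ℂ) = (w t : ℝ)
  hWlim : ∀ σ : ℝ, 0 < σ → Tendsto (fun T : ℝ => W (σ + T * Complex.I) / T) atTop (𝓝 0)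
  hnonneg : ∀ t ∈ Icc m 0, 0 ≤ Φ t
  hpair : ∀ α ∈ Icc m 0, ∀ β, β₀ ≤ β → β < α → 0 ≤ pairFun p q Φ α β

/-- The contact set of the pair function in the open half `β < α`. -/
def contactSet (p q m β₀ : ℝ) (Φ : ℝ → ℝ) : Set (ℝ × ℝ) :=
  {z | z.1 ∈ Icc m 0 ∧ β₀ ≤ z.2 ∧ z.2 < z.1 ∧ pairFun p q Φ z.1 z.2 = 0}

namespace PairOptimal
variable {p q m β₀ : ℝ} {Φ w : ℝ → ℝ} {W : ℂ → ℂ}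

lemma hc (h : PairOptimal p q m β₀ Φ w W) : 0 < p / q := div_pos h.hp h.hq

lemma continuous_profile (h : PairOptimal p q m β₀ Φ w W) : Continuous Φ :=
  continuous_iff_continuousAt.2 fun t => (h.hder t).continuousAt

lemma continuous_gap (h : PairOptimal p q m β₀ Φ w W) : Continuous (gap p q) :=
  continuous_iff_continuousAt.2 fun t => (hasDerivAt_gap h.hp h.hq t).continuousAt

lemma w_eq (h : PairOptimal p q m β₀ Φ w W) : w = fun t => deriv Φ t + 1 := by
  ext t; rw [(h.hder t).deriv]; ring

lemma analyticAt_w (h : PairOptimal p q m β₀ Φ w W) (t : ℝ) : AnalyticAt ℝ w t := by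
  rw [h.w_eq]
  exact (h.han t).deriv.add analyticAt_const

lemma continuous_w (h : PairOptimal p q m β₀ Φ w W) : Continuous w :=
  continuous_iff_continuousAt.2 fun t => (h.analyticAt_w t).continuousAt

lemma hasDerivAt_left (h : PairOptimal p q m β₀ Φ w W) (α β : ℝ) :
    HasDerivAt (fun α => pairFun p q Φ α β) (p * (w α - 1) + gapDeriv p (p / q) (α - β)) α := by
  unfold pairFun
  have h1 := ((h.hder α).const_mul p).add_const (q * Φ β)
  have h2 := (hasDerivAt_gap h.hp h.hq (α - β)).comp α ((hasDerivAt_id α).sub_const β)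
  refine (h1.add h2).congr_deriv ?_
  ring

lemma hasDerivAt_right (h : PairOptimal p q m β₀ Φ w W) (α β : ℝ) :
    HasDerivAt (fun β => pairFun p q Φ α β) (q * (w β - 1) - gapDeriv p (p / q) (α - β)) β := by
  unfold pairFun
  have h1 := ((h.hder β).const_mul q).const_add (p * Φ α)
  have h2 := (hasDerivAt_gap h.hp h.hq (α - β)).comp β ((hasDerivAt_id β).const_sub α)
  refine (h1.add h2).congr_deriv ?_
  ring

lemma analyticAt_left (h : PairOptimal p q m β₀ Φ w W) {α β : ℝ} (hαβ : β < α) :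
    AnalyticAt ℝ (fun α => pairFun p q Φ α β) α := by
  unfold pairFun
  have h1 : AnalyticAt ℝ (fun α => gap p q (α - β)) α :=
    AnalyticAt.fun_comp (analyticAt_gap h.hp h.hq (by linarith))
        (analyticAt_id.sub analyticAt_const)
  exact ((analyticAt_const.mul (h.han α)).add analyticAt_const).add h1

lemma analyticAt_right (h : PairOptimal p q m β₀ Φ w W) {α β : ℝ} (hαβ : β < α) :
    AnalyticAt ℝ (fun β => pairFun p q Φ α β) β := by
  unfold pairFun
  have h1 : AnalyticAt ℝ (fun β => gap p q (α - β)) β :=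
    AnalyticAt.fun_comp (analyticAt_gap h.hp h.hq (by linarith))
        (analyticAt_const.sub analyticAt_id)
  exact (analyticAt_const.add (analyticAt_const.mul (h.han β))).add h1

lemma snd_lt (h : PairOptimal p q m β₀ Φ w W) {z : ℝ × ℝ} (hz : z ∈ contactSet p q m β₀ Φ) :
    z.2 < m := by
  obtain ⟨h1, h2, h3, h4⟩ := hz
  by_contra! hlt
  have e1 := h.hnonneg _ h1
  have e2 := h.hnonneg z.2 ⟨hlt, by linarith [h1.2]⟩
  have e3 := gap_pos h.hp h.hq h.hpq (s := z.1 - z.2) (by linarith)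
  have := mul_nonneg h.hp.le e1
  have := mul_nonneg h.hq.le e2
  unfold pairFun at h4
  linarith

lemma critical_left (h : PairOptimal p q m β₀ Φ w W) {z : ℝ × ℝ} (hz : z ∈ contactSet p q m β₀ Φ)
    (h1 : m < z.1) (h2 : z.1 < 0) : p * (1 - w z.1) = gapDeriv p (p / q) (z.1 - z.2) := by
  obtain ⟨_, hb, hlt, h0⟩ := hz
  have hmin : IsLocalMin (fun α => pairFun p q Φ α z.2) z.1 := by
    filter_upwards [lt_mem_nhds h1, gt_mem_nhds h2, lt_mem_nhds hlt] with α a1 a2 a3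
    rw [h0]
    exact h.hpair α ⟨a1.le, a2.le⟩ _ hb a3
  have := hmin.hasDerivAt_eq_zero (h.hasDerivAt_left z.1 z.2)
  linarith

lemma critical_right (h : PairOptimal p q m β₀ Φ w W) {z : ℝ × ℝ} (hz : z ∈ contactSet p q m β₀ Φ)
    (h1 : β₀ < z.2) : q * (w z.2 - 1) = gapDeriv p (p / q) (z.1 - z.2) := by
  obtain ⟨ha, _, hlt, h0⟩ := hz
  have hmin : IsLocalMin (fun β => pairFun p q Φ z.1 β) z.2 := by
    filter_upwards [lt_mem_nhds h1, gt_mem_nhds hlt] with β a1 a2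
    rw [h0]
    exact h.hpair _ ha _ a1.le a2
  have := hmin.hasDerivAt_eq_zero (h.hasDerivAt_right z.1 z.2)
  linarith

lemma exists_neg_of_profile (h : PairOptimal p q m β₀ Φ w W) (h0 : Φ m = 0) (h1 : w m = 1)
    {w' : ℝ} (hw' : HasDerivAt w w' m) (hneg : w' < 0) : False := by
  have hs := (hasDerivAt_iff_tendsto_slope.1 hw').mono_left
    (nhdsWithin_mono m (show Ioi m ⊆ {m}ᶜ from fun x hx => ne_of_gt hx))
  have hev : ∀ᶠ t in 𝓝[>] m, w t < 1 := by
    filter_upwards [hs.eventually_lt_const hneg, self_mem_nhdsWithin] with t ht htm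
    have htm' : m < t := htm
    rw [slope_def_field, div_neg_iff] at ht
    rcases ht with ht | ht <;> linarith
  obtain ⟨r, hr, hr'⟩ := mem_nhdsGT_iff_exists_Ioo_subset.1 hev
  have hr1 : m < min r 0 := lt_min hr h.hm
  set x := (m + min r 0) / 2 with hx
  have hmx : m < x := by rw [hx]; linarith
  have hxr : x < r := by have := min_le_left r 0; rw [hx]; linarith
  have hx0 : x < 0 := by have := min_le_right r 0; rw [hx]; linarith [h.hm]
  have hanti : StrictAntiOn Φ (Icc m x) := by
    refine strictAntiOn_of_deriv_neg (convex_Icc m x) h.continuous_profile.continuousOn fun t ht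
        => ?_
    rw [interior_Icc] at ht
    rw [(h.hder t).deriv]
    have : w t < 1 := hr' ⟨ht.1, ht.2.trans hxr⟩
    linarith
  have := hanti (left_mem_Icc.2 hmx.le) (right_mem_Icc.2 hmx.le) hmx
  have := h.hnonneg x ⟨hmx.le, hx0.le⟩
  linarith

lemma exists_separation (h : PairOptimal p q m β₀ Φ w W) :
    ∃ ε, 0 < ε ∧ ∀ z ∈ contactSet p q m β₀ Φ, ε ≤ z.1 - z.2 := by
  by_contra! hcon
  have hex : ∀ n : ℕ, ∃ z ∈ contactSet p q m β₀ Φ, z.1 - z.2 < 1 / ((n : ℝ) + 1) :=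
    fun n => hcon _ (by positivity)
  choose z hz hzn using hex
  obtain ⟨k, hk, hk'⟩ := gapDeriv_ge h.hp h.hc
  have hs0 : Tendsto (fun n => (z n).1 - (z n).2) atTop (𝓝 0) :=
    squeeze_zero (fun n => by linarith [(hz n).2.2.1]) (fun n => (hzn n).le)
      tendsto_one_div_add_atTop_nhds_zero_nat
  have hβ : Tendsto (fun n => (z n).2) atTop (𝓝 m) := by
    have e1 : Tendsto (fun n => m - ((z n).1 - (z n).2)) atTop (𝓝 m) := by
      simpa using hs0.const_sub m
    refine tendsto_of_tendsto_of_tendsto_of_le_of_le e1 tendsto_const_nhds (fun n => ?_)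
      fun n => (h.snd_lt (hz n)).le
    have := (hz n).1.1
    simp only
    linarith
  have hα : Tendsto (fun n => (z n).1) atTop (𝓝 m) := by
    simpa using hs0.add hβ
  have hβm : β₀ < m := lt_of_le_of_lt (hz 0).2.1 (h.snd_lt (hz 0))
  have hsmall := hs0.eventually_lt_const one_pos
  have hcrit := hβ.eventually_const_lt hβm
  have hΦm : Φ m = 0 := by
    have e1 := (h.continuous_profile.tendsto m).comp hα
    have e2 := (h.continuous_profile.tendsto m).comp hβ
    have e3 := (h.continuous_gap.tendsto 0).comp hs0
    have e4 := ((e1.const_mul p).add (e2.const_mul q)).add e3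
    have e5 : p * Φ m + q * Φ m + gap p q 0 = 0 := by
      refine tendsto_nhds_unique e4 ((tendsto_const_nhds (x := (0:ℝ))).congr fun n => ?_)
      exact (hz n).2.2.2.symm
    rw [gap_zero h.hpq, ← add_mul, h.hpq] at e5
    linarith
  have hwm : w m = 1 := by
    have e1 := ((h.continuous_w.tendsto m).comp hβ).sub_const 1 |>.const_mul q
    have e2 : Tendsto (fun n => gapDeriv p (p / q) ((z n).1 - (z n).2)) atTop (𝓝 0) :=
      (tendsto_gapDeriv_zero h.hp h.hc).comp (tendsto_nhdsWithin_iff.2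
        ⟨hs0, Eventually.of_forall fun n => sub_pos.2 (hz n).2.2.1⟩)
    have e3 : q * (w m - 1) = 0 := by
      refine tendsto_nhds_unique e1 (e2.congr' ?_)
      filter_upwards [hcrit] with n hn
      exact (h.critical_right (hz n) hn).symm
    rcases mul_eq_zero.1 e3 with e | e
    · exact absurd e h.hq.ne'
    · linarith
  have hw' := (h.analyticAt_w m).differentiableAt.hasDerivAt
  refine h.exists_neg_of_profile hΦm hwm hw' (lt_of_le_of_lt ?_ (neg_neg_of_pos (div_pos hk h.hq)))
  have hsl := (hasDerivAt_iff_tendsto_slope.1 hw').comp (tendsto_nhdsWithin_iff.2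
    ⟨hβ, Eventually.of_forall fun n => show (z n).2 ∈ ({m}ᶜ : Set ℝ) from (h.snd_lt (hz n)).ne⟩)
  refine le_of_tendsto hsl ?_
  filter_upwards [hcrit, hsmall] with n h1 h2
  have hlt := h.snd_lt (hz n)
  have e1 := h.critical_right (hz n) h1
  have e2 := hk' _ (sub_pos.2 (hz n).2.2.1) h2.le
  have e3 : k * (m - (z n).2) ≤ q * (w (z n).2 - 1) := by
    rw [e1]
    refine le_trans (mul_le_mul_of_nonneg_left ?_ hk.le) e2
    have := (hz n).1.1
    linarith
  rw [Function.comp, slope_def_field, hwm, div_le_iff_of_neg (by linarith)]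
  have : -(k / q) * ((z n).2 - m) = k * (m - (z n).2) / q := by ring
  rw [this, div_le_iff₀ h.hq]
  linarith

lemma deriv_eq_zero_on {f f' : ℝ → ℝ} {s : Set ℝ} (hs : IsOpen s) (h : EqOn f 0 s)
    (hf : ∀ x ∈ s, HasDerivAt f (f' x) x) : ∀ x ∈ s, f' x = 0 := by
  intro x hx
  have h1 : f =ᶠ[𝓝 x] fun _ => 0 := by
    filter_upwards [hs.mem_nhds hx] with y hy using h hy
  exact ((hf x hx).congr_of_eventuallyEq h1.symm).unique (hasDerivAt_const x 0)

lemma false_of_forall_right (h : PairOptimal p q m β₀ Φ w W) {α : ℝ}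
    (heq : ∀ β < α, q * (w β - 1) - gapDeriv p (p / q) (α - β) = 0) : False := by
  set a := exp α with ha
  have ha0 : 0 < a := exp_pos α
  have hac : (a : ℂ) ≠ 0 := by exact_mod_cast ha0.ne'
  set U : Set ℂ := {z | 0 < z.re ∧ z.re < 1} with hU
  have hUo : IsOpen U := (isOpen_lt continuous_const Complex.continuous_re).inter
    (isOpen_lt Complex.continuous_re continuous_const)
  have hUc : IsPreconnected U := by
    have : Convex ℝ U := (convex_halfSpace_re_gt 0).inter (convex_halfSpace_re_lt 1)
    exact this.isPreconnected
  have hf : AnalyticOnNhd ℂ (fun z : ℂ => (q : ℂ) * (W (a * z) - 1)) U := by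
    refine DifferentiableOn.analyticOnNhd ?_ hUo
    refine DifferentiableOn.const_mul (DifferentiableOn.sub_const ?_ 1) _
    refine h.hW.comp (by fun_prop) fun z hz => ?_
    have : 0 < a * z.re := mul_pos ha0 hz.1
    simpa [Complex.mul_re] using this
  have hg : AnalyticOnNhd ℂ (gapDerivC p (p / q)) U :=
    fun z hz => analyticAt_gapDerivC p h.hc hz.1 hz.2
  have hhalf : (1 / 2 : ℂ) ∈ U := by constructor <;> norm_num
  have hreal : ∀ s : ℝ, 0 < s → (q : ℂ) * (W (a * ((exp (-s) : ℝ) : ℂ)) - 1) =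
      gapDerivC p (p / q) ((exp (-s) : ℝ) : ℂ) := by
    intro s hs
    have e1 := heq (α - s) (by linarith)
    have e2 : (a : ℂ) * ((exp (-s) : ℝ) : ℂ) = ((exp (α - s) : ℝ) : ℂ) := by
      rw [← Complex.ofReal_mul, ha, ← Real.exp_add, sub_eq_add_neg]
    rw [e2, h.hWw, gapDerivC_ofReal p _ hs]
    rw [sub_sub_cancel] at e1
    have e3 : gapDeriv p (p / q) s = q * (w (α - s) - 1) := by linarith
    rw [e3]; push_cast; ring
  have hfreq : ∃ᶠ z in 𝓝[≠] (1 / 2 : ℂ), (q : ℂ) * (W (a * z) - 1) = gapDerivC p (p / q) z := by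
    have ht : Tendsto (fun x : ℝ => (x : ℂ)) (𝓝[>] (1 / 2)) (𝓝[≠] (1 / 2 : ℂ)) := by
      refine tendsto_nhdsWithin_iff.2 ⟨?_, ?_⟩
      · have := (Complex.continuous_ofReal.tendsto (1 / 2)).mono_left
          (nhdsWithin_le_nhds (s := Ioi (1 / 2 : ℝ)))
        simpa using this
      · filter_upwards [self_mem_nhdsWithin] with x hx
        intro hx'
        have h1 : x = 1 / 2 := by
          have h2 : (x : ℂ) = ((1 / 2 : ℝ) : ℂ) := by rw [mem_singleton_iff.1 hx']; push_cast; rfl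
          exact_mod_cast h2
        exact (ne_of_gt (show 1 / 2 < x from hx)) h1
    refine ht.frequently (Eventually.frequently ?_)
    filter_upwards [Ioo_mem_nhdsGT (show (1 / 2 : ℝ) < 1 by norm_num)] with x hx
    have hx0 : 0 < x := by linarith [hx.1]
    have := hreal (-log x) (by have := Real.log_neg hx0 hx.2; linarith)
    rwa [neg_neg, Real.exp_log hx0] at this
  have hEq := hf.eqOn_of_preconnected_of_frequently_eq hg hUc hhalf hfreq
  have hlim1 := tendsto_gapDerivC_div p h.hc
  have hinv : Tendsto (fun T : ℝ => ((T⁻¹ : ℝ) : ℂ)) atTop (𝓝 0) := by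
    have := (Complex.continuous_ofReal.tendsto 0).comp tendsto_inv_atTop_zero
    simpa [Function.comp_def] using this
  have hlim2 : Tendsto (fun T : ℝ => (q : ℂ) * (W (a * (1 / 2 + T * Complex.I)) - 1) / T) atTop
      (𝓝 0) := by
    have e1 := (h.hWlim (a / 2) (by positivity)).comp (tendsto_id.const_mul_atTop ha0)
    have e2 := ((e1.const_mul (a : ℂ)).sub hinv).const_mul (q : ℂ)
    simp only [mul_zero, sub_zero] at e2
    refine e2.congr' ?_
    filter_upwards [eventually_gt_atTop 0] with T hT
    have hTc : (T : ℂ) ≠ 0 := by exact_mod_cast hT.ne'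
    have e3 : ((a / 2 : ℝ) : ℂ) + ((a * T : ℝ) : ℂ) * Complex.I = a * (1 / 2 + T * Complex.I) := by
      push_cast; ring
    simp only [Function.comp, id, e3]
    push_cast
    field_simp
  have hz := tendsto_nhds_unique (hlim1.congr fun T => by
    rw [← hEq (show (1 / 2 + T * Complex.I : ℂ) ∈ U by constructor <;> norm_num)]) hlim2
  have : (p : ℂ) = 0 := by simpa using hz
  exact h.hp.ne' (by exact_mod_cast this)

lemma finite_fiber_right (h : PairOptimal p q m β₀ Φ w W) (α : ℝ) :
    {β | (α, β) ∈ contactSet p q m β₀ Φ}.Finite := by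
  by_contra hinf
  obtain ⟨ε, hε, hsep⟩ := h.exists_separation
  obtain ⟨b, hb, hacc⟩ := Set.Infinite.exists_accPt_of_subset_isCompact hinf
    (isCompact_Icc (a := β₀) (b := α - ε)) fun β hβ => ⟨hβ.2.1, by
      have := hsep _ hβ
      simp only at this
      linarith⟩
  have hfreq := accPt_iff_frequently_nhdsNE.1 hacc
  have hEq := AnalyticOnNhd.eqOn_of_preconnected_of_frequently_eq (𝕜 := ℝ) (U := Iio α)
    (f := fun β => pairFun p q Φ α β) (g := 0) (z₀ := b) (fun β hβ => h.analyticAt_right hβ)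
    (fun _ _ => analyticAt_const) isPreconnected_Iio (by
      have := hb.2
      simp only [mem_Iio]
      linarith)
    (hfreq.mono fun β hβ => hβ.2.2.2)
  exact h.false_of_forall_right
    (deriv_eq_zero_on isOpen_Iio hEq fun β _ => h.hasDerivAt_right α β)

lemma finite_fiber_left (h : PairOptimal p q m β₀ Φ w W) (β : ℝ) :
    {α | (α, β) ∈ contactSet p q m β₀ Φ}.Finite := by
  by_contra hinf
  obtain ⟨ε, hε, hsep⟩ := h.exists_separation
  obtain ⟨a, ha, hacc⟩ := Set.Infinite.exists_accPt_of_subset_isCompact hinf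
    (isCompact_Icc (a := β + ε) (b := 0)) fun α hα => ⟨by
      have := hsep _ hα
      simp only at this
      linarith, hα.1.2⟩
  have hfreq := accPt_iff_frequently_nhdsNE.1 hacc
  have hEq := AnalyticOnNhd.eqOn_of_preconnected_of_frequently_eq (𝕜 := ℝ) (U := Ioi β)
    (f := fun α => pairFun p q Φ α β) (g := 0) (z₀ := a) (fun α hα => h.analyticAt_left hα)
    (fun _ _ => analyticAt_const) isPreconnected_Ioi (by
      have := ha.1
      simp only [mem_Ioi]
      linarith)
    (hfreq.mono fun α hα => hα.2.2.2)
  have hd := deriv_eq_zero_on isOpen_Ioi hEq fun α _ => h.hasDerivAt_left α β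
  have e1 : Tendsto (fun α => gapDeriv p (p / q) (α - β)) atTop (𝓝 0) :=
    (tendsto_gapDeriv_atTop h.hp h.hc).comp (tendsto_atTop_add_const_right _ (-β) tendsto_id)
  have e2 := ((h.hlim.sub_const 1).const_mul p).add e1
  have e3 := tendsto_nhds_unique e2 ((tendsto_const_nhds (x := (0:ℝ))).congr' (by
    filter_upwards [eventually_gt_atTop β] with α hα using (hd α hα).symm))
  have := h.hp
  linarith

lemma analyticAt_relation (h : PairOptimal p q m β₀ Φ w W) {t s : ℝ} (hs : 0 < s) :
    AnalyticAt ℝ (fun z : ℝ × ℝ => (q / p * (p * (1 - w (z.1 - z.2))) + p * (1 - w z.1)) ^ 2 +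
      pairFun p q Φ z.1 (z.1 - z.2) ^ 2) (t, s) := by
  have e1 : AnalyticAt ℝ (fun z : ℝ × ℝ => z.1) (t, s) := analyticAt_fst
  have e2 : AnalyticAt ℝ (fun z : ℝ × ℝ => z.1 - z.2) (t, s) := analyticAt_fst.sub analyticAt_snd
  have w1 : AnalyticAt ℝ (fun z : ℝ × ℝ => w z.1) (t, s) := (h.analyticAt_w t).fun_comp e1
  have w2 : AnalyticAt ℝ (fun z : ℝ × ℝ => w (z.1 - z.2)) (t, s) :=
    AnalyticAt.fun_comp (f := fun z : ℝ × ℝ => z.1 - z.2) (h.analyticAt_w (t - s)) e2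
  have f1 : AnalyticAt ℝ (fun z : ℝ × ℝ => Φ z.1) (t, s) := (h.han t).fun_comp e1
  have f2 : AnalyticAt ℝ (fun z : ℝ × ℝ => Φ (z.1 - z.2)) (t, s) :=
    AnalyticAt.fun_comp (f := fun z : ℝ × ℝ => z.1 - z.2) (h.han (t - s)) e2
  have g1 : AnalyticAt ℝ (fun z : ℝ × ℝ => gap p q (z.1 - (z.1 - z.2))) (t, s) := by
    refine AnalyticAt.fun_comp (analyticAt_gap h.hp h.hq ?_) (e1.sub e2)
    simpa using hs
  unfold pairFun
  exact ((analyticAt_const.mul (analyticAt_const.mul (analyticAt_const.sub w2))).add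
    (analyticAt_const.mul (analyticAt_const.sub w1))).pow 2 |>.add
    (((analyticAt_const.mul f1).add (analyticAt_const.mul f2)).add g1 |>.pow 2)

theorem finite_contactSet (h : PairOptimal p q m β₀ Φ w W) : (contactSet p q m β₀ Φ).Finite := by
  by_contra hinf
  have hpp := h.hp
  have hqq := h.hq
  obtain ⟨ε, hε, hsep⟩ := h.exists_separation
  obtain ⟨Z, hZ, S, hS, hmono, hpos, hleft, hright, -, hbr, s₁, hs₁, hDs₁⟩ :=
    exists_inverse_branch (D := gapDeriv p (p / q)) (fun s hs => analyticAt_gapDeriv p h.hc hs)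
      (fun s hs => gapDeriv_pos h.hp h.hc hs) (tendsto_gapDeriv_zero h.hp h.hc)
      (tendsto_gapDeriv_atTop h.hp h.hc) (fun s₁ hs₁ h0 => gapDeriv_le_of_deriv_eq_zero h.hp h.hc
        (fun s hs => (analyticAt_gapDeriv p h.hc hs).differentiableAt) hs₁ h0)
  have hZp : Z ^ 2 < p := hDs₁ ▸ gapDeriv_lt h.hp h.hc hs₁
  set A : ℝ → ℝ := fun t => p * (1 - w t) with hA
  have hAan : ∀ t, AnalyticAt ℝ A t := fun t =>
    analyticAt_const.mul (analyticAt_const.sub (h.analyticAt_w t))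
  have hAlim : Tendsto A atTop (𝓝 p) := by
    simpa using (h.hlim.const_sub 1).const_mul p
  obtain ⟨M, hM⟩ := eventually_atTop.1 (hAlim.eventually_const_lt hZp)
  set R : ℝ × ℝ → ℝ := fun z => (q / p * (p * (1 - w (z.1 - z.2))) + p * (1 - w z.1)) ^ 2 +
      pairFun p q Φ z.1 (z.1 - z.2) ^ 2 with hR
  have hR0 : ∀ z, R z = 0 → q / p * A (z.1 - z.2) + A z.1 = 0 ∧
      pairFun p q Φ z.1 (z.1 - z.2) = 0 := by
    intro z hz
    rw [hR] at hz
    have := (add_eq_zero_iff_of_nonneg (sq_nonneg _) (sq_nonneg _)).1 hz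
    exact ⟨pow_eq_zero_iff (two_ne_zero) |>.1 this.1, pow_eq_zero_iff (two_ne_zero) |>.1 this.2⟩
  have hsys : ArcSystem A S R (fun l => Φ l = 0) Z (q / p) M :=
    { hA := hAan
      hM := hM
      hZ := hZ
      hk := div_pos h.hq h.hp
      hS := hS
      hmono := hmono
      hpos := hpos
      hleft := hleft
      hright := hright
      hR := fun t s hs => h.analyticAt_relation hs
      hRA := fun t s _ hz => by have := (hR0 _ hz).1; simp only at this; linarith
      hRP := by
        intro l hl
        by_contra hne
        have hcont : Continuous fun z : ℝ × ℝ => pairFun p q Φ z.1 (z.1 - z.2) := by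
          have := h.continuous_profile
          have := h.continuous_gap
          unfold pairFun
          fun_prop
        have hval : pairFun p q Φ l (l - 0) = Φ l := by
          unfold pairFun
          rw [sub_zero, sub_self, gap_zero h.hpq, add_zero, ← add_mul, h.hpq, one_mul]
        have hne' : pairFun p q Φ ((l, 0) : ℝ × ℝ).1
            (((l, 0) : ℝ × ℝ).1 - ((l, 0) : ℝ × ℝ).2) ≠ 0 := by
          simpa only [hval] using hne
        have hev := (hcont.tendsto (l, 0)).eventually_ne hne'
        obtain ⟨z, hz1, hz2⟩ := (hl.and_eventually hev).exists
        exact hz2 (hR0 _ hz1.2).2 }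
  set Z' := contactSet p q m β₀ Φ \ ({z | z.1 = m} ∪ {z | z.1 = 0} ∪ {z | z.2 = β₀}) with hZ'
  have hfib : ∀ a, (contactSet p q m β₀ Φ ∩ {z | z.1 = a}).Finite := by
    intro a
    refine ((h.finite_fiber_right a).image (fun β => (a, β))).subset ?_
    rintro ⟨x, y⟩ ⟨hz, hx⟩
    have hx' : x = a := hx
    subst hx'
    exact ⟨y, hz, rfl⟩
  have hfib' : ∀ b, (contactSet p q m β₀ Φ ∩ {z | z.2 = b}).Finite := by
    intro b
    refine ((h.finite_fiber_left b).image (fun α => (α, b))).subset ?_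
    rintro ⟨x, y⟩ ⟨hz, hx⟩
    have hx' : y = b := hx
    subst hx'
    exact ⟨x, hz, rfl⟩
  have hZinf : Z'.Infinite := by
    intro hfin
    refine hinf (((hfin.union (hfib m)).union ((hfib 0).union (hfib' β₀))).subset ?_)
    intro z hz
    by_cases c1 : z.1 = m
    · exact Or.inl (Or.inr ⟨hz, c1⟩)
    by_cases c2 : z.1 = 0
    · exact Or.inr (Or.inl ⟨hz, c2⟩)
    by_cases c3 : z.2 = β₀
    · exact Or.inr (Or.inr ⟨hz, c3⟩)
    exact Or.inl (Or.inl ⟨hz, by rintro ((c | c) | c); exacts [c1 c, c2 c, c3 c]⟩)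
  have hprop : ∀ z ∈ Z', z ∈ contactSet p q m β₀ Φ ∧ m < z.1 ∧ z.1 < 0 ∧ β₀ < z.2 := by
    rintro z ⟨hz, hn⟩
    simp only [mem_union, mem_ofPred_eq, not_or] at hn
    exact ⟨hz, lt_of_le_of_ne hz.1.1 (Ne.symm hn.1.1), lt_of_le_of_ne hz.1.2 hn.1.2,
      lt_of_le_of_ne hz.2.1 (Ne.symm hn.2)⟩
  have hAD : ∀ z ∈ Z', A z.1 = gapDeriv p (p / q) (z.1 - z.2) := fun z hz =>
    h.critical_left (hprop z hz).1 (hprop z hz).2.1 (hprop z hz).2.2.1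
  have hPinf : (Prod.fst '' Z').Infinite := by
    intro hfin
    refine hZinf (Set.Finite.of_finite_fibers Prod.fst hfin fun x _ => ?_)
    exact (hfib x).subset fun z hz => ⟨(hprop z hz.1).1, hz.2⟩
  obtain ⟨a, ha, hacc⟩ := hPinf.exists_accPt_of_subset_isCompact (isCompact_Icc (a := m) (b := 0))
    (by rintro _ ⟨z, hz, rfl⟩; exact (hprop z hz).1.1)
  have hfreq := accPt_iff_frequently_nhdsNE.1 hacc
  obtain ⟨d, hd, hdA⟩ : ∃ d, 0 < d ∧ ∀ z ∈ Z', d ≤ A z.1 := by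
    obtain ⟨z, hz⟩ := hZinf.nonempty
    have hmem : ∀ z ∈ Z', z.1 - z.2 ∈ Icc ε (-β₀) := fun z hz =>
      ⟨hsep z (hprop z hz).1, by linarith [(hprop z hz).2.2.1, (hprop z hz).2.2.2]⟩
    obtain ⟨s, hs, hmin⟩ := (isCompact_Icc (a := ε) (b := -β₀)).exists_isMinOn ⟨_, hmem z hz⟩
      (f := gapDeriv p (p / q)) fun s hs =>
        (analyticAt_gapDeriv p h.hc (hε.trans_le hs.1)).continuousAt.continuousWithinAt
    exact ⟨_, gapDeriv_pos h.hp h.hc (hε.trans_le hs.1), fun z hz => hAD z hz ▸ hmin (hmem z hz)⟩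
  have hAle : ∀ z ∈ Z', A z.1 ≤ Z ^ 2 := fun z hz => by
    rw [hAD z hz]
    exact (hbr _ (sub_pos.2 (hprop z hz).1.2.2.1)).1
  have hAc : Continuous A := continuous_iff_continuousAt.2 fun t => (hAan t).continuousAt
  have hclos : a ∈ closure (Prod.fst '' Z') := mem_closure_iff_clusterPt.2 hacc.clusterPt
  have hA1 : d ≤ A a := by
    have : IsClosed {t | d ≤ A t} := isClosed_le continuous_const hAc
    exact this.closure_subset_iff.2 (by rintro _ ⟨z, hz, rfl⟩; exact hdA z hz) hclos
  have hA2 : A a ≤ Z ^ 2 := by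
    have : IsClosed {t | A t ≤ Z ^ 2} := isClosed_le hAc continuous_const
    exact this.closure_subset_iff.2 (by rintro _ ⟨z, hz, rfl⟩; exact hAle z hz) hclos
  have hne : ∀ᶠ t in 𝓝[≠] a, A t ≠ Z ^ 2 := by
    by_contra hcon
    have hcon' : ∃ᶠ t in 𝓝[≠] a, A t = Z ^ 2 := by
      exact fun hcon' => hcon hcon'
    have hEq := AnalyticOnNhd.eqOn_of_preconnected_of_frequently_eq (𝕜 := ℝ) (U := univ)
      (f := A) (g := fun _ => Z ^ 2) (z₀ := a) (fun t _ => hAan t) (fun _ _ => analyticAt_const)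
      isPreconnected_univ (mem_univ _) hcon'
    exact (hM M le_rfl).ne' (hEq (mem_univ M))
  have hbranch : ∃ᶠ t in 𝓝[≠] a, ((m < t ∧ t < 0) ∧ OnBranch A S R Z 1 t) ∨
      ((m < t ∧ t < 0) ∧ OnBranch A S R Z (-1) t) := by
    refine (hfreq.and_eventually hne).mono ?_
    rintro _ ⟨⟨z, hz, rfl⟩, hzne⟩
    obtain ⟨hc, h1, h2, h3⟩ := hprop z hz
    obtain ⟨e, he, hse⟩ := (hbr _ (sub_pos.2 hc.2.2.1)).2
    rw [← hAD z hz] at hse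
    have hon : OnBranch A S R Z e z.1 := by
      refine ⟨lt_of_le_of_ne (hAle z hz) hzne, ?_⟩
      rw [← hse]
      have e1 := h.critical_right hc h3
      have e2 : p * (1 - w z.1) = _ := hAD z hz
      have e3 : q / p * (p * (1 - w z.2)) + p * (1 - w z.1) = 0 := by
        rw [e2, ← e1]; field_simp; ring
      have e4 : pairFun p q Φ z.1 z.2 = 0 := hc.2.2.2
      simp only [hR, sub_sub_cancel, e3, e4]
      norm_num
    rcases he with rfl | rfl
    · exact Or.inl ⟨⟨h1, h2⟩, hon⟩
    · exact Or.inr ⟨⟨h1, h2⟩, hon⟩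
  have hfinal : ∀ e : ℝ, e = 1 ∨ e = -1 →
      ¬ ∃ᶠ t in 𝓝[≠] a, (m < t ∧ t < 0) ∧ OnBranch A S R Z e t := by
    intro e he hf
    obtain ⟨x, r, hx, hApos, hfr⟩ := hsys.exists_zero_of_frequently
      (Q := fun t => m < t ∧ t < 0) he (hd.trans_le hA1) hA2 hf
    obtain ⟨t, ht, htm⟩ := hfr.exists
    have hanti : StrictAntiOn Φ (Icc x t) := by
      refine strictAntiOn_of_deriv_neg (convex_Icc x t) h.continuous_profile.continuousOn
        fun y hy => ?_
      rw [interior_Icc] at hy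
      rw [(h.hder y).deriv]
      have : 0 < p * (1 - w y) := hApos y ⟨hy.1, hy.2.trans htm.2⟩
      have := (mul_pos_iff_of_pos_left h.hp).1 this
      linarith
    have e1 := hanti (left_mem_Icc.2 htm.1.le) (right_mem_Icc.2 htm.1.le) htm.1
    have e2 := h.hnonneg t ⟨ht.1.le, ht.2.le⟩
    have hx0 : Φ x = 0 := hx
    linarith
  rcases frequently_or_distrib.1 hbranch with hb | hb
  · exact hfinal 1 (Or.inl rfl) hb
  · exact hfinal (-1) (Or.inr rfl) hb

end PairOptimal

lemma integrableOn_expMix {p q r : ℝ} (hr : 0 < r) : IntegrableOn (expMix p q r) (Ioi 0) := by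
  have h1 := (integrableOn_exp_neg_mul one_pos).const_mul p
  have h2 := ((integrableOn_exp_neg_mul hr).const_mul r).const_mul q
  refine (h1.add h2).congr (Eventually.of_forall fun u => ?_)
  simp only [Pi.add_apply, one_mul, expMix]

lemma integral_expMix {p q r : ℝ} (hpq : p + q = 1) (hr : 0 < r) :
    ∫ u in Ioi (0 : ℝ), expMix p q r u = 1 := by
  have h1 := (integrableOn_exp_neg_mul one_pos).const_mul p
  have h2 := ((integrableOn_exp_neg_mul hr).const_mul r).const_mul q
  have : ∀ u, expMix p q r u = p * exp (-(1 * u)) + q * (r * exp (-(r * u))) := by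
    intro u; rw [one_mul, expMix]
  simp only [this]
  rw [integral_add h1 h2, integral_const_mul, integral_const_mul, integral_const_mul,
    integral_exp_neg_mul one_pos, integral_exp_neg_mul hr]
  field_simp
  linarith

lemma expMix_scale (p q α β y : ℝ) :
    p * (exp α * exp (-(exp α * y))) + q * (exp β * exp (-(exp β * y))) =
      exp α * expMix p q (exp (-(α - β))) (exp α * y) := by
  have h1 : exp (-(α - β)) * (exp α * y) = exp β * y := by
    rw [← mul_assoc, ← Real.exp_add]; ring_nf
  have h2 : exp α * exp (-(α - β)) = exp β := by rw [← Real.exp_add]; ring_nf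
  unfold expMix
  rw [h1, ← h2]; ring

/-- The negative entropy of a two-component exponential mixture. -/
lemma integral_mixture_mul_log {p q : ℝ} (hp : 0 < p) (hq : 0 < q) (hpq : p + q = 1) (α β : ℝ) :
    IntegrableOn (fun y => (p * (exp α * exp (-(exp α * y))) + q * (exp β * exp (-(exp β * y)))) *
      log (p * (exp α * exp (-(exp α * y))) + q * (exp β * exp (-(exp β * y))))) (Ioi 0) ∧
    ∫ y in Ioi (0 : ℝ), (p * (exp α * exp (-(exp α * y))) + q * (exp β * exp (-(exp β * y)))) *
      log (p * (exp α * exp (-(exp α * y))) + q * (exp β * exp (-(exp β * y)))) =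
      p * α + q * β - 1 - gap p q (α - β) := by
  have hr := exp_pos (-(α - β))
  set g : ℝ → ℝ := fun u => α * expMix p q (exp (-(α - β))) u +
    expMix p q (exp (-(α - β))) u * log (expMix p q (exp (-(α - β))) u) with hg
  have i1 := (integrableOn_expMix (p := p) (q := q) hr).const_mul α
  have i2 := integrableOn_negEnt hp hq hr
  have hgi : IntegrableOn g (Ioi 0) := i1.add i2
  have hpt : ∀ y, (p * (exp α * exp (-(exp α * y))) + q * (exp β * exp (-(exp β * y)))) *
      log (p * (exp α * exp (-(exp α * y))) + q * (exp β * exp (-(exp β * y)))) =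
      exp α * g (exp α * y) := by
    intro y
    rw [expMix_scale, Real.log_mul (exp_pos _).ne' (expMix_pos hp hq hr _).ne', Real.log_exp, hg]
    ring
  simp only [hpt]
  constructor
  · have := (integrableOn_Ioi_comp_mul_left_iff g 0 (exp_pos α)).2 (by simpa using hgi)
    exact this.const_mul _
  · rw [integral_const_mul, integral_comp_mul_left_Ioi g 0 (exp_pos α), mul_zero, smul_eq_mul,
      mul_inv_cancel_left₀ (exp_pos α).ne', hg, integral_add i1 i2, integral_const_mul,
      integral_expMix hpq hr]
    unfold gap negEnt
    linear_combination (-α) * hpq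

lemma gap_swap {p q : ℝ} (hp : 0 < p) (hq : 0 < q) (hpq : p + q = 1) (s : ℝ) :
    gap p q (-s) = gap q p s := by
  have h1 := (integral_mixture_mul_log hp hq hpq 0 s).2
  have h2 := (integral_mixture_mul_log hq hp (by linarith) s 0).2
  have h3 : ∀ y, p * (exp 0 * exp (-(exp 0 * y))) + q * (exp s * exp (-(exp s * y))) =
      q * (exp s * exp (-(exp s * y))) + p * (exp 0 * exp (-(exp 0 * y))) := fun y => add_comm _ _
  simp only [h3] at h1
  rw [h1] at h2
  rw [zero_sub, sub_zero] at h2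
  linarith

/-- A function on `[0, ∞)` whose derivative `-ρ` lies in `[-1, 0]`. -/
structure SlowDecay (ℓ ρ : ℝ → ℝ) : Prop where
  hder : ∀ y, 0 < y → HasDerivAt ℓ (-ρ y) y
  hcont : ContinuousWithinAt ℓ (Ici 0) 0
  hmeas : Measurable ℓ
  hρ : Measurable ρ
  h0 : ∀ y, 0 < y → 0 ≤ ρ y
  h1 : ∀ y, 0 < y → ρ y ≤ 1
  hbd : ∃ C, ∀ y, 0 < y → |ℓ y| ≤ C + y

namespace SlowDecay
variable {ℓ ρ : ℝ → ℝ}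

lemma integrableOn_exp_mul (h : SlowDecay ℓ ρ) {a : ℝ} (ha : 0 < a) :
    IntegrableOn (fun y => exp (-(a * y)) * ℓ y) (Ioi 0) := by
  obtain ⟨C, hC⟩ := h.hbd
  have hm := h.hmeas
  have i1 := ((integrableOn_exp_neg_mul ha).mul_const C).add (integrableOn_mul_exp_neg_mul ha)
  refine i1.mono' (Measurable.aestronglyMeasurable (by fun_prop)) ?_
  filter_upwards [self_mem_ae_restrict measurableSet_Ioi] with y hy
  rw [norm_mul, Real.norm_of_nonneg (exp_pos _).le, Real.norm_eq_abs]
  refine (mul_le_mul_of_nonneg_left (hC y hy) (exp_pos _).le).trans (le_of_eq ?_)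
  simp only [Pi.add_apply]
  ring

lemma integrableOn_exp_mul_rate (h : SlowDecay ℓ ρ) {a : ℝ} (ha : 0 < a) :
    IntegrableOn (fun y => exp (-(a * y)) * ρ y) (Ioi 0) := by
  have hm := h.hρ
  refine (integrableOn_exp_neg_mul ha).mono' (Measurable.aestronglyMeasurable (by fun_prop)) ?_
  filter_upwards [self_mem_ae_restrict measurableSet_Ioi] with y hy
  rw [norm_mul, Real.norm_of_nonneg (exp_pos _).le, Real.norm_of_nonneg (h.h0 y hy)]
  exact mul_le_of_le_one_right (exp_pos _).le (h.h1 y hy)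

lemma integral_eq (h : SlowDecay ℓ ρ) {a : ℝ} (ha : 0 < a) :
    ∫ y in Ioi (0 : ℝ), a * (exp (-(a * y)) * ℓ y) =
      ℓ 0 - ∫ y in Ioi (0 : ℝ), exp (-(a * y)) * ρ y := by
  obtain ⟨C, hC⟩ := h.hbd
  have i1 := (h.integrableOn_exp_mul ha).const_mul a
  have i2 := h.integrableOn_exp_mul_rate ha
  have hder : ∀ y ∈ Ioi (0 : ℝ), HasDerivAt (fun y => -(exp (-(a * y)) * ℓ y))
      (a * (exp (-(a * y)) * ℓ y) + exp (-(a * y)) * ρ y) y := by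
    intro y hy
    have h1 : HasDerivAt (fun u : ℝ => exp (-(a * u))) (exp (-(a * y)) * -(a * 1)) y :=
      (((hasDerivAt_id y).const_mul a).neg).exp
    refine (h1.mul (h.hder y hy)).neg.congr_deriv ?_
    ring
  have hcw : ContinuousWithinAt (fun y => -(exp (-(a * y)) * ℓ y)) (Ici 0) 0 := by
    have : ContinuousWithinAt (fun y : ℝ => exp (-(a * y))) (Ici 0) 0 := by fun_prop
    exact (this.mul h.hcont).neg
  have hlim : Tendsto (fun y => -(exp (-(a * y)) * ℓ y)) atTop (𝓝 0) := by
    have t1 := (tendsto_pow_mul_exp_neg_mul_atTop 0 ha).mul_const C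
    have t2 := t1.add (tendsto_pow_mul_exp_neg_mul_atTop 1 ha)
    simp only [zero_mul, add_zero] at t2
    refine squeeze_zero_norm' ?_ t2
    filter_upwards [eventually_gt_atTop 0] with y hy
    rw [norm_neg, norm_mul, Real.norm_of_nonneg (exp_pos _).le, Real.norm_eq_abs]
    refine (mul_le_mul_of_nonneg_left (hC y hy) (exp_pos _).le).trans (le_of_eq ?_)
    ring
  have := integral_Ioi_of_hasDerivAt_of_tendsto hcw hder (i1.add i2) hlim
  rw [integral_add i1 i2] at this
  simp only [mul_zero, neg_zero, exp_zero, one_mul, sub_neg_eq_add, zero_add] at this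
  linarith

/-- The complex Laplace moment of the decay rate. -/
noncomputable def moment (ρ : ℝ → ℝ) (b : ℂ) : ℂ :=
  ∫ y : ℝ in Ioi 0, (y : ℂ) * Complex.exp (-(b * y)) * ρ y

lemma norm_moment_integrand_le (h : SlowDecay ℓ ρ) (b : ℂ) {y : ℝ} (hy : 0 < y) :
    ‖(y : ℂ) * Complex.exp (-(b * y)) * ρ y‖ ≤ y * exp (-(b.re * y)) := by
  rw [norm_mul, norm_mul, Complex.norm_real, Complex.norm_real, Complex.norm_exp,
    Real.norm_of_nonneg hy.le, Real.norm_of_nonneg (h.h0 y hy)]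
  have : (-(b * y)).re = -(b.re * y) := by simp
  rw [this]
  exact mul_le_of_le_one_right (by positivity) (h.h1 y hy)

lemma moment_ofReal (ρ : ℝ → ℝ) (a : ℝ) :
    moment ρ a = ((∫ y in Ioi (0 : ℝ), y * exp (-(a * y)) * ρ y : ℝ) : ℂ) := by
  unfold moment
  rw [← integral_complex_ofReal]
  refine integral_congr_ae (Eventually.of_forall fun y => ?_)
  push_cast
  rfl

lemma differentiableOn_moment (h : SlowDecay ℓ ρ) :
    DifferentiableOn ℂ (moment ρ) {z | 0 < z.re} := by
  have hm := h.hρ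
  refine differentiableOn_integral_of_dominated ?_ ?_ ?_
  · exact fun z _ => Measurable.aestronglyMeasurable (by fun_prop)
  · refine Eventually.of_forall fun y => ?_
    fun_prop
  · intro z hz
    have hz' : 0 < z.re := hz
    have hre : ∀ b ∈ Metric.ball z (z.re / 2), z.re / 2 < b.re := by
      intro b hb
      have h1 := Complex.abs_re_le_norm (b - z)
      rw [Metric.mem_ball, dist_eq_norm] at hb
      rw [Complex.sub_re] at h1
      have := neg_abs_le (b.re - z.re)
      linarith
    refine ⟨z.re / 2, by linarith, fun b hb => ?_, fun y => y * exp (-(z.re / 2 * y)),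
      integrableOn_mul_exp_neg_mul (by linarith), ?_⟩
    · have := hre b hb
      simp only [mem_ofPred_eq]
      linarith
    · filter_upwards [self_mem_ae_restrict measurableSet_Ioi] with y hy b hb
      have hy' : 0 < y := hy
      refine (h.norm_moment_integrand_le b hy').trans ?_
      have := mul_le_mul_of_nonneg_right (hre b hb).le hy'.le
      refine mul_le_mul_of_nonneg_left (Real.exp_le_exp.2 (by linarith)) hy'.le

lemma hasDerivAt_laplace (h : SlowDecay ℓ ρ) {a : ℝ} (ha : 0 < a) :
    HasDerivAt (fun a => ∫ y in Ioi (0 : ℝ), exp (-(a * y)) * ρ y)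
      (∫ y in Ioi (0 : ℝ), -(y * exp (-(a * y)) * ρ y)) a := by
  have hm := h.hρ
  refine (hasDerivAt_integral_of_dominated_loc_of_deriv_le (s := Ioi (a / 2)) (x₀ := a)
    (μ := volume.restrict (Ioi 0)) (F := fun a y => exp (-(a * y)) * ρ y)
    (F' := fun a y => -(y * exp (-(a * y)) * ρ y))
    (bound := fun y => y * exp (-(a / 2 * y)))
    (Ioi_mem_nhds (by linarith)) ?_ (h.integrableOn_exp_mul_rate ha) ?_ ?_ ?_ ?_).2
  · exact Eventually.of_forall fun x => Measurable.aestronglyMeasurable (by fun_prop)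
  · exact Measurable.aestronglyMeasurable (by fun_prop)
  · filter_upwards [self_mem_ae_restrict measurableSet_Ioi] with y hy x hx
    have hy' : 0 < y := hy
    have hx' : a / 2 < x := hx
    rw [norm_neg, norm_mul, Real.norm_of_nonneg (h.h0 y hy),
      Real.norm_of_nonneg (show 0 ≤ y * exp (-(x * y)) by positivity)]
    refine (mul_le_of_le_one_right (by positivity) (h.h1 y hy)).trans ?_
    have := mul_le_mul_of_nonneg_right hx'.le hy'.le
    exact mul_le_mul_of_nonneg_left (Real.exp_le_exp.2 (by linarith)) hy'.le
  · exact integrableOn_mul_exp_neg_mul (by linarith)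
  · refine Eventually.of_forall fun y x _ => ?_
    have h1 : HasDerivAt (fun u : ℝ => exp (-(u * y))) (exp (-(x * y)) * -(1 * y)) x :=
      (((hasDerivAt_id x).mul_const y).neg).exp
    refine (h1.mul_const (ρ y)).congr_deriv ?_
    ring

lemma hasDerivAt_integral_exp (h : SlowDecay ℓ ρ) (t : ℝ) :
    HasDerivAt (fun t => ∫ y in Ioi (0 : ℝ), exp t * (exp (-(exp t * y)) * ℓ y))
      (exp t * ∫ y in Ioi (0 : ℝ), y * exp (-(exp t * y)) * ρ y) t := by
  have h1 := ((h.hasDerivAt_laplace (exp_pos t)).comp t (Real.hasDerivAt_exp t)).const_sub (ℓ 0)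
  refine (h1.congr_deriv ?_).congr_of_eventuallyEq
    (Eventually.of_forall fun t => h.integral_eq (exp_pos t))
  rw [integral_neg]
  ring

lemma integral_moment_le (h : SlowDecay ℓ ρ) {a : ℝ} (ha : 0 < a) :
    0 ≤ ∫ y in Ioi (0 : ℝ), y * exp (-(a * y)) * ρ y ∧
    ∫ y in Ioi (0 : ℝ), y * exp (-(a * y)) * ρ y ≤ 1 / a ^ 2 := by
  have hm := h.hρ
  have i1 := integrableOn_mul_exp_neg_mul ha
  have i2 : IntegrableOn (fun y => y * exp (-(a * y)) * ρ y) (Ioi 0) := by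
    refine i1.mono' (Measurable.aestronglyMeasurable (by fun_prop)) ?_
    filter_upwards [self_mem_ae_restrict measurableSet_Ioi] with y hy
    have hy' : 0 < y := hy
    rw [norm_mul, Real.norm_of_nonneg (h.h0 y hy),
      Real.norm_of_nonneg (show 0 ≤ y * exp (-(a * y)) by positivity)]
    exact mul_le_of_le_one_right (by positivity) (h.h1 y hy)
  constructor
  · refine setIntegral_nonneg measurableSet_Ioi fun y hy => ?_
    have hy' : 0 < y := hy
    exact mul_nonneg (by positivity) (h.h0 y hy)
  · rw [← integral_mul_exp_neg_mul ha]
    refine setIntegral_mono_on i2 i1 measurableSet_Ioi fun y hy => ?_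
    have hy' : 0 < y := hy
    exact mul_le_of_le_one_right (by positivity) (h.h1 y hy)

lemma tendsto_moment_vertical (ρ : ℝ → ℝ) (σ : ℝ) :
    Tendsto (fun T : ℝ => moment ρ (σ + T * Complex.I)) atTop (𝓝 0) := by
  set f : ℝ → ℂ := (Ioi (0 : ℝ)).indicator fun y => (y : ℂ) * Complex.exp (-(σ * y)) * ρ y
    with hf
  have h1 := Real.tendsto_integral_exp_smul_cocompact f
  have h2 : Tendsto (fun T : ℝ => T / (2 * π)) atTop (cocompact ℝ) :=
    (tendsto_id.atTop_div_const (by positivity)).mono_right atTop_le_cocompact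
  refine (h1.comp h2).congr fun T => ?_
  rw [Function.comp, moment, ← integral_indicator measurableSet_Ioi]
  refine integral_congr_ae (Eventually.of_forall fun y => ?_)
  simp only [hf]
  by_cases hy : y ∈ Ioi (0 : ℝ)
  · rw [indicator_of_mem hy, indicator_of_mem hy, Circle.smul_def, Real.fourierChar_apply,
      smul_eq_mul]
    have hπ : (π : ℂ) ≠ 0 := by exact_mod_cast Real.pi_ne_zero
    have e1 : ((2 * π * -(y * (T / (2 * π))) : ℝ) : ℂ) * Complex.I = -(T * Complex.I * y) := by
      push_cast; field_simp
    have e2 : Complex.exp (-((σ + T * Complex.I) * y)) =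
        Complex.exp (-(σ * y)) * Complex.exp (-(T * Complex.I * y)) := by
      rw [← Complex.exp_add]; ring_nf
    rw [e1, e2]; ring
  · rw [indicator_of_notMem hy, indicator_of_notMem hy, smul_zero]

end SlowDecay

namespace SlowDecay
variable {ℓ ρ : ℝ → ℝ} {G : ℂ → ℂ} {g : ℝ → ℝ}

/-- The one-component optimality profile. -/
noncomputable def profile (ℓ g : ℝ → ℝ) (C t : ℝ) : ℝ :=
  (∫ y in Ioi (0 : ℝ), exp t * (exp (-(exp t * y)) * ℓ y)) - t + C + g (exp (-t))

/-- The holomorphic extension of the slope of the profile, in the rate variable. -/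
noncomputable def slopeC (ρ : ℝ → ℝ) (G : ℂ → ℂ) (b : ℂ) : ℂ :=
  b * moment ρ b - deriv G b⁻¹ * b⁻¹

lemma hasDerivAt_re (hG : Differentiable ℂ G) (hGg : ∀ x : ℝ, G x = (g x : ℝ)) (x : ℝ) :
    HasDerivAt g (deriv G x).re x := by
  have h1 := (hG x).hasDerivAt.real_of_complex
  simpa only [hGg, Complex.ofReal_re] using h1

lemma deriv_ofReal (hG : Differentiable ℂ G) (hGg : ∀ x : ℝ, G x = (g x : ℝ)) (x : ℝ) :
    ((deriv G x).re : ℂ) = deriv G x := by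
  have h1 : HasDerivAt (fun y : ℝ => ((g y : ℝ) : ℂ)) ((deriv G x).re : ℂ) x :=
    (hasDerivAt_re hG hGg x).ofReal_comp
  have h2 : HasDerivAt (fun y : ℝ => G y) (deriv G x) x := (hG x).hasDerivAt.comp_ofReal
  simp only [hGg] at h2
  exact h1.unique h2

lemma slopeC_exp (hG : Differentiable ℂ G) (hGg : ∀ x : ℝ, G x = (g x : ℝ)) (t : ℝ) :
    slopeC ρ G ((exp t : ℝ) : ℂ) = ((slopeC ρ G ((exp t : ℝ) : ℂ)).re : ℝ) := by
  unfold slopeC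
  rw [moment_ofReal, ← Complex.ofReal_inv, ← deriv_ofReal hG hGg]
  norm_cast

lemma slopeC_exp_re (ρ : ℝ → ℝ) (G : ℂ → ℂ) (t : ℝ) : (slopeC ρ G ((exp t : ℝ) : ℂ)).re =
    exp t * (∫ y in Ioi (0 : ℝ), y * exp (-(exp t * y)) * ρ y) -
      (deriv G ((exp (-t) : ℝ) : ℂ)).re * exp (-t) := by
  unfold slopeC
  rw [moment_ofReal, ← Complex.ofReal_inv, ← Real.exp_neg, Complex.sub_re, Complex.re_ofReal_mul,
    Complex.ofReal_re, Complex.re_mul_ofReal]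

lemma hasDerivAt_profile (h : SlowDecay ℓ ρ) (hG : Differentiable ℂ G)
    (hGg : ∀ x : ℝ, G x = (g x : ℝ)) (C t : ℝ) :
    HasDerivAt (profile ℓ g C) ((slopeC ρ G ((exp t : ℝ) : ℂ)).re - 1) t := by
  have h1 : HasDerivAt (fun t : ℝ => exp (-t)) (exp (-t) * -1) t := (hasDerivAt_neg t).exp
  have h2 := (hasDerivAt_re hG hGg (exp (-t))).comp t h1
  refine ((((h.hasDerivAt_integral_exp t).sub (hasDerivAt_id t)).add_const C).add h2).congr_deriv ?_
  rw [slopeC_exp_re]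
  ring

lemma differentiableOn_slopeC (h : SlowDecay ℓ ρ) (hG : Differentiable ℂ G) :
    DifferentiableOn ℂ (slopeC ρ G) {z | 0 < z.re} := by
  have hne : ∀ z : ℂ, 0 < z.re → z ≠ 0 := by rintro z hz rfl; simp at hz
  have h1 : DifferentiableOn ℂ (fun z : ℂ => z⁻¹) {z | 0 < z.re} :=
    fun z hz => (differentiableAt_inv (hne z hz)).differentiableWithinAt
  have hG' : Differentiable ℂ (deriv G) := fun z => hG.differentiableOn.deriv isOpen_univ
    |>.differentiableAt univ_mem
  exact (differentiableOn_id.mul h.differentiableOn_moment).sub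
    ((hG'.comp_differentiableOn h1).mul h1)

lemma analyticAt_profile (h : SlowDecay ℓ ρ) (hG : Differentiable ℂ G)
    (hGg : ∀ x : ℝ, G x = (g x : ℝ)) (C t : ℝ) : AnalyticAt ℝ (profile ℓ g C) t := by
  refine analyticAt_of_hasDerivAt_re (g := fun z => slopeC ρ G (Complex.exp z) - 1)
    (Eventually.of_forall fun t => h.hasDerivAt_profile hG hGg C t) ?_ ?_
  · have h1 : AnalyticAt ℂ (slopeC ρ G) (Complex.exp t) := by
      refine (h.differentiableOn_slopeC hG).analyticAt
        ((isOpen_lt continuous_const Complex.continuous_re).mem_nhds ?_)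
      rw [← Complex.ofReal_exp]
      exact exp_pos t
    exact (AnalyticAt.fun_comp h1 (Complex.differentiable_exp.analyticAt _)).sub analyticAt_const
  · refine Eventually.of_forall fun x => ?_
    rw [← Complex.ofReal_exp, Complex.sub_re, Complex.one_re]

lemma continuous_deriv_entire (hG : Differentiable ℂ G) : Continuous (deriv G) :=
  (hG.contDiff (n := 1)).continuous_deriv le_rfl

lemma tendsto_slope_atTop (h : SlowDecay ℓ ρ) (hG : Differentiable ℂ G) :
    Tendsto (fun t : ℝ => (slopeC ρ G ((exp t : ℝ) : ℂ)).re) atTop (𝓝 0) := by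
  have he : Tendsto (fun t : ℝ => exp (-t)) atTop (𝓝 0) :=
    Real.tendsto_exp_neg_atTop_nhds_zero
  have e1 : Tendsto (fun t : ℝ => exp t * ∫ y in Ioi (0 : ℝ), y * exp (-(exp t * y)) * ρ y)
      atTop (𝓝 0) := by
    refine squeeze_zero (fun t => mul_nonneg (exp_pos t).le (h.integral_moment_le (exp_pos t)).1)
      (fun t => ?_) he
    refine (mul_le_mul_of_nonneg_left (h.integral_moment_le (exp_pos t)).2 (exp_pos t).le).trans
      (le_of_eq ?_)
    rw [Real.exp_neg]
    field_simp
  have e2 : Tendsto (fun t : ℝ => (deriv G ((exp (-t) : ℝ) : ℂ)).re) atTop (𝓝 (deriv G 0).re) := by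
    have hc : Continuous fun x : ℝ => (deriv G (x : ℂ)).re :=
      Complex.continuous_re.comp ((continuous_deriv_entire hG).comp Complex.continuous_ofReal)
    have := (hc.tendsto 0).comp he
    simp only [Complex.ofReal_zero] at this
    exact this
  have e3 := e1.sub (e2.mul he)
  simp only [mul_zero, sub_zero] at e3
  exact e3.congr fun t => (slopeC_exp_re ρ G t).symm

lemma tendsto_slopeC_vertical (ρ : ℝ → ℝ) (hG : Differentiable ℂ G) (σ : ℝ) :
    Tendsto (fun T : ℝ => slopeC ρ G (σ + T * Complex.I) / T) atTop (𝓝 0) := by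
  have hTinv : Tendsto (fun T : ℝ => (T : ℂ)⁻¹) atTop (𝓝 0) := by
    have := (Complex.continuous_ofReal.tendsto 0).comp tendsto_inv_atTop_zero
    simpa [Function.comp_def] using this
  have hbinv : Tendsto (fun T : ℝ => (σ + T * Complex.I : ℂ)⁻¹) atTop (𝓝 0) := by
    refine squeeze_zero_norm' ?_ tendsto_inv_atTop_zero
    filter_upwards [eventually_gt_atTop 0] with T hT
    rw [norm_inv]
    refine inv_anti₀ hT ?_
    have h1 := Complex.abs_im_le_norm (σ + T * Complex.I)
    have h2 : (σ + T * Complex.I : ℂ).im = T := by simp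
    rw [h2] at h1
    exact (le_abs_self T).trans h1
  have hb : Tendsto (fun T : ℝ => (σ * (T : ℂ)⁻¹ + Complex.I)) atTop (𝓝 (σ * 0 + Complex.I)) :=
    (hTinv.const_mul _).add_const _
  have e1 := hb.mul (tendsto_moment_vertical ρ σ)
  have e2 := ((((continuous_deriv_entire hG).tendsto 0).comp hbinv).mul hbinv).mul hTinv
  have e3 := e1.sub e2
  simp only [mul_zero, sub_zero] at e3
  refine e3.congr' ?_
  filter_upwards [eventually_gt_atTop 0] with T hT
  have hTc : (T : ℂ) ≠ 0 := by exact_mod_cast hT.ne'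
  simp only [slopeC, Function.comp]
  field_simp

end SlowDecay

lemma summable_pow_div_factorial_sq (R : ℝ) :
    Summable fun n : ℕ => R ^ n / (n.factorial : ℝ) ^ 2 := by
  refine (Real.summable_pow_div_factorial |R|).of_norm_bounded (fun n => ?_)
  have h1 : (1 : ℝ) ≤ n.factorial := by exact_mod_cast n.factorial_pos
  rw [norm_div, norm_pow, norm_pow, Real.norm_eq_abs, Real.norm_of_nonneg (by linarith)]
  exact div_le_div_of_nonneg_left (by positivity) (by linarith) (by nlinarith)

/-- The entire function `∑ zⁿ / (n!)²`. -/
noncomputable def besselC (z : ℂ) : ℂ := ∑' n : ℕ, z ^ n / (n.factorial : ℂ) ^ 2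

lemma besselC_ofReal (x : ℝ) :
    besselC x = ((∑' n : ℕ, x ^ n / (n.factorial : ℝ) ^ 2 : ℝ) : ℂ) := by
  rw [Complex.ofReal_tsum]
  unfold besselC
  push_cast
  rfl

lemma differentiable_besselC : Differentiable ℂ besselC := by
  intro z
  have h : DifferentiableOn ℂ besselC (Metric.ball 0 (‖z‖ + 1)) := by
    refine Complex.differentiableOn_tsum_of_summable_norm
      (summable_pow_div_factorial_sq (‖z‖ + 1)) (fun n => by fun_prop) Metric.isOpen_ball ?_
    intro n w hw
    rw [Metric.mem_ball, dist_zero_right] at hw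
    rw [norm_div, norm_pow, norm_pow, Complex.norm_natCast]
    gcongr
  exact h.differentiableAt (Metric.isOpen_ball.mem_nhds (by simp))

lemma EH_eq_besselC (B h2 x : ℝ) :
    ((EH B h2 x : ℝ) : ℂ) = besselC ((B ^ 2 * h2 ^ 2 / 2 * x ^ 2 : ℝ) : ℂ) := by
  rw [besselC_ofReal, EH, besselI0]
  have : (√2 * B * h2 * x) ^ 2 / 4 = B ^ 2 * h2 ^ 2 / 2 * x ^ 2 := by
    have h2 : √2 ^ 2 = 2 := Real.sq_sqrt (by norm_num)
    rw [mul_pow, mul_pow, mul_pow, h2]; ring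
  rw [this]

lemma continuous_EH (B h2 : ℝ) : Continuous (EH B h2) := by
  have h : EH B h2 = fun x => (besselC ((B ^ 2 * h2 ^ 2 / 2 * x ^ 2 : ℝ) : ℂ)).re := by
    ext x
    rw [← EH_eq_besselC, Complex.ofReal_re]
  rw [h]
  have := differentiable_besselC.continuous
  fun_prop

/-- The logarithm of the rate of the exponential law `pcond x`. -/
noncomputable def logRate (x : ℝ) : ℝ := -log (1 + x ^ 2)

lemma one_add_sq_pos (x : ℝ) : 0 < 1 + x ^ 2 := by positivity

lemma exp_logRate (x : ℝ) : exp (logRate x) = 1 / (1 + x ^ 2) := by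
  rw [logRate, Real.exp_neg, Real.exp_log (one_add_sq_pos x), one_div]

lemma exp_neg_logRate (x : ℝ) : exp (-logRate x) = 1 + x ^ 2 := by
  rw [logRate, neg_neg, Real.exp_log (one_add_sq_pos x)]

lemma continuous_logRate : Continuous logRate := by
  unfold logRate
  exact (Continuous.log (by fun_prop) fun x => (one_add_sq_pos x).ne').neg

lemma pcond_eq_exp (x y : ℝ) :
    pcond x y = exp (logRate x) * exp (-(exp (logRate x) * y)) := by
  rw [exp_logRate, pcond]
  congr 2
  ring

lemma logRate_nonpos (x : ℝ) : logRate x ≤ 0 := by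
  have := Real.log_nonneg (show 1 ≤ 1 + x ^ 2 by nlinarith [sq_nonneg x])
  unfold logRate
  linarith

lemma exp_logRate_le_one (x : ℝ) : exp (logRate x) ≤ 1 := Real.exp_le_one_iff.2 (logRate_nonpos x)

lemma logRate_antitone {x y : ℝ} (hx : 0 ≤ x) (hxy : x ≤ y) : logRate y ≤ logRate x := by
  have : log (1 + x ^ 2) ≤ log (1 + y ^ 2) := Real.log_le_log (one_add_sq_pos x) (by nlinarith)
  unfold logRate
  linarith

lemma logRate_injOn {x y : ℝ} (hx : 0 ≤ x) (hy : 0 ≤ y) (h : logRate x = logRate y) : x = y := by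
  have h1 := exp_neg_logRate x
  rw [h, exp_neg_logRate y] at h1
  have : x ^ 2 = y ^ 2 := by linarith
  exact (pow_left_inj₀ hx hy two_ne_zero).1 this

lemma logRate_neg {x : ℝ} (hx : 0 < x) : logRate x < 0 := by
  have := Real.log_pos (show 1 < 1 + x ^ 2 by nlinarith)
  unfold logRate
  linarith

lemma pcond_pos (x y : ℝ) : 0 < pcond x y := by rw [pcond_eq_exp]; positivity

lemma continuous_pcond : Continuous fun z : ℝ × ℝ => pcond z.1 z.2 := by
  simp only [pcond_eq_exp]
  have := continuous_logRate
  fun_prop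

lemma pcond_le_one (x : ℝ) {y : ℝ} (hy : 0 ≤ y) : pcond x y ≤ 1 := by
  rw [pcond_eq_exp]
  have h1 : exp (-(exp (logRate x) * y)) ≤ 1 := Real.exp_le_one_iff.2 (by
    have := mul_nonneg (exp_pos (logRate x)).le hy
    linarith)
  exact mul_le_one₀ (exp_logRate_le_one x) (exp_pos _).le h1

lemma pcond_le_exp_abs (x y : ℝ) : pcond x y ≤ exp |y| := by
  rw [pcond_eq_exp]
  have h1 : exp (-(exp (logRate x) * y)) ≤ exp |y| := by
    refine Real.exp_le_exp.2 ?_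
    have h2 : |exp (logRate x) * y| ≤ |y| := by
      rw [abs_mul, abs_of_pos (exp_pos _)]
      exact mul_le_of_le_one_left (abs_nonneg y) (exp_logRate_le_one x)
    exact (neg_le_abs _).trans h2
  exact (mul_le_of_le_one_left (exp_pos _).le (exp_logRate_le_one x)).trans h1

lemma pcond_ge {x A : ℝ} (hx : x ∈ Icc 0 A) {y : ℝ} (hy : 0 ≤ y) :
    exp (logRate A) * exp (-y) ≤ pcond x y := by
  rw [pcond_eq_exp]
  refine mul_le_mul (Real.exp_le_exp.2 (logRate_antitone hx.1 hx.2)) (Real.exp_le_exp.2 ?_)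
    (exp_pos _).le (exp_pos _).le
  have := mul_le_of_le_one_left hy (exp_logRate_le_one x)
  linarith

lemma pcond_le_exp {x A : ℝ} (hx : x ∈ Icc 0 A) {y : ℝ} (hy : 0 ≤ y) :
    pcond x y ≤ exp (-(exp (logRate A) * y)) := by
  rw [pcond_eq_exp]
  refine (mul_le_of_le_one_left (exp_pos _).le (exp_logRate_le_one x)).trans
    (Real.exp_le_exp.2 ?_)
  have := mul_le_mul_of_nonneg_right (Real.exp_le_exp.2 (logRate_antitone hx.1 hx.2)) hy
  linarith

lemma hasDerivAt_pcond (x y : ℝ) :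
    HasDerivAt (fun y => pcond x y) (-(exp (logRate x) * pcond x y)) y := by
  simp only [pcond_eq_exp]
  have h1 : HasDerivAt (fun u : ℝ => exp (-(exp (logRate x) * u)))
      (exp (-(exp (logRate x) * y)) * -(exp (logRate x) * 1)) y :=
    (((hasDerivAt_id y).const_mul _).neg).exp
  refine (h1.const_mul _).congr_deriv ?_
  ring

/-- The negative `y`-derivative of the extended channel density. -/
noncomputable def fcondDecay (p1 p2 : ℝ) (x : ℝ × ℝ) (y : ℝ) : ℝ :=
  p1 * (exp (logRate x.1) * pcond x.1 y) + p2 * (exp (logRate x.2) * pcond x.2 y)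

section
variable {p1 p2 A1 A2 : ℝ} {F : Measure (ℝ × ℝ)}

lemma continuous_fcond (p1 p2 : ℝ) :
    Continuous fun z : (ℝ × ℝ) × ℝ => fcond p1 p2 z.1 z.2 := by
  unfold fcond
  have h1 : Continuous fun z : (ℝ × ℝ) × ℝ => pcond z.1.1 z.2 :=
    continuous_pcond.comp (f := fun z : (ℝ × ℝ) × ℝ => (z.1.1, z.2)) (by fun_prop)
  have h2 : Continuous fun z : (ℝ × ℝ) × ℝ => pcond z.1.2 z.2 :=
    continuous_pcond.comp (f := fun z : (ℝ × ℝ) × ℝ => (z.1.2, z.2)) (by fun_prop)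
  fun_prop

lemma continuous_fcondDecay (p1 p2 : ℝ) :
    Continuous fun z : (ℝ × ℝ) × ℝ => fcondDecay p1 p2 z.1 z.2 := by
  unfold fcondDecay
  have := continuous_logRate
  have h1 : Continuous fun z : (ℝ × ℝ) × ℝ => pcond z.1.1 z.2 :=
    continuous_pcond.comp (f := fun z : (ℝ × ℝ) × ℝ => (z.1.1, z.2)) (by fun_prop)
  have h2 : Continuous fun z : (ℝ × ℝ) × ℝ => pcond z.1.2 z.2 :=
    continuous_pcond.comp (f := fun z : (ℝ × ℝ) × ℝ => (z.1.2, z.2)) (by fun_prop)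
  fun_prop

lemma fcond_pos (hp1 : 0 < p1) (hp2 : 0 < p2) (x : ℝ × ℝ) (y : ℝ) : 0 < fcond p1 p2 x y := by
  have := pcond_pos x.1 y
  have := pcond_pos x.2 y
  unfold fcond; positivity

lemma fcond_le_one (hp1 : 0 < p1) (hp2 : 0 < p2) (hp : p1 + p2 = 1) (x : ℝ × ℝ) {y : ℝ}
    (hy : 0 ≤ y) : fcond p1 p2 x y ≤ 1 := by
  have h1 := mul_le_mul_of_nonneg_left (pcond_le_one x.1 hy) hp1.le
  have h2 := mul_le_mul_of_nonneg_left (pcond_le_one x.2 hy) hp2.le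
  unfold fcond
  linarith

lemma fcond_le_exp_abs (hp1 : 0 < p1) (hp2 : 0 < p2) (hp : p1 + p2 = 1) (x : ℝ × ℝ) (y : ℝ) :
    fcond p1 p2 x y ≤ exp |y| := by
  have h1 := mul_le_mul_of_nonneg_left (pcond_le_exp_abs x.1 y) hp1.le
  have h2 := mul_le_mul_of_nonneg_left (pcond_le_exp_abs x.2 y) hp2.le
  have h3 : p1 * exp |y| + p2 * exp |y| = exp |y| := by rw [← add_mul, hp, one_mul]
  unfold fcond
  linarith

lemma fcondDecay_nonneg (hp1 : 0 < p1) (hp2 : 0 < p2) (x : ℝ × ℝ) (y : ℝ) :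
    0 ≤ fcondDecay p1 p2 x y := by
  have := pcond_pos x.1 y
  have := pcond_pos x.2 y
  unfold fcondDecay; positivity

lemma fcondDecay_le (hp1 : 0 < p1) (hp2 : 0 < p2) (x : ℝ × ℝ) (y : ℝ) :
    fcondDecay p1 p2 x y ≤ fcond p1 p2 x y := by
  unfold fcondDecay fcond
  have h1 := mul_le_of_le_one_left (pcond_pos x.1 y).le (exp_logRate_le_one x.1)
  have h2 := mul_le_of_le_one_left (pcond_pos x.2 y).le (exp_logRate_le_one x.2)
  have := mul_le_mul_of_nonneg_left h1 hp1.le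
  have := mul_le_mul_of_nonneg_left h2 hp2.le
  linarith

lemma fcond_ge (hp1 : 0 < p1) (hp2 : 0 < p2) {x : ℝ × ℝ} (hx : x ∈ Icc 0 A1 ×ˢ Icc 0 A2) {y : ℝ}
    (hy : 0 ≤ y) :
    (p1 * exp (logRate A1) + p2 * exp (logRate A2)) * exp (-y) ≤ fcond p1 p2 x y := by
  have h1 := mul_le_mul_of_nonneg_left (pcond_ge hx.1 hy) hp1.le
  have h2 := mul_le_mul_of_nonneg_left (pcond_ge hx.2 hy) hp2.le
  unfold fcond
  linarith

/-- An exponential envelope of the channel density. -/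
noncomputable def envelope (p1 p2 A1 A2 y : ℝ) : ℝ :=
  p1 * exp (-(exp (logRate A1) * y)) + p2 * exp (-(exp (logRate A2) * y))

lemma fcond_le_envelope (hp1 : 0 < p1) (hp2 : 0 < p2) {x : ℝ × ℝ}
    (hx : x ∈ Icc 0 A1 ×ˢ Icc 0 A2) {y : ℝ} (hy : 0 ≤ y) :
    fcond p1 p2 x y ≤ envelope p1 p2 A1 A2 y := by
  have h1 := mul_le_mul_of_nonneg_left (pcond_le_exp hx.1 hy) hp1.le
  have h2 := mul_le_mul_of_nonneg_left (pcond_le_exp hx.2 hy) hp2.le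
  unfold fcond envelope
  linarith

lemma integrableOn_envelope_mul (p1 p2 A1 A2 C : ℝ) :
    IntegrableOn (fun y => envelope p1 p2 A1 A2 y * (C + y)) (Ioi 0) := by
  have h1 := (integrableOn_affine_sq_mul_exp 0 C (exp_pos (logRate A1))).const_mul p1
  have h2 := (integrableOn_affine_sq_mul_exp 0 C (exp_pos (logRate A2))).const_mul p2
  refine (h1.add h2).congr (Eventually.of_forall fun u => ?_)
  simp only [Pi.add_apply, envelope]
  ring

lemma hasDerivAt_fcond (p1 p2 : ℝ) (x : ℝ × ℝ) (y : ℝ) :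
    HasDerivAt (fun y => fcond p1 p2 x y) (-fcondDecay p1 p2 x y) y := by
  unfold fcond
  refine (((hasDerivAt_pcond x.1 y).const_mul p1).add
    ((hasDerivAt_pcond x.2 y).const_mul p2)).congr_deriv ?_
  unfold fcondDecay
  ring

lemma measurable_fcond_left (p1 p2 y : ℝ) : Measurable fun x => fcond p1 p2 x y :=
  ((continuous_fcond p1 p2).comp (by fun_prop : Continuous fun x : ℝ × ℝ => (x, y))).measurable

lemma measurable_fcondDecay_left (p1 p2 y : ℝ) : Measurable fun x => fcondDecay p1 p2 x y :=
  ((continuous_fcondDecay p1 p2).comp (by fun_prop : Continuous fun x : ℝ × ℝ => (x, y))).measurable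

lemma integrable_fcond [IsProbabilityMeasure F] (hp1 : 0 < p1) (hp2 : 0 < p2) (hp : p1 + p2 = 1)
    (y : ℝ) : Integrable (fun x => fcond p1 p2 x y) F := by
  refine (integrable_const (exp |y|)).mono' (measurable_fcond_left p1 p2 y).aestronglyMeasurable
    (Eventually.of_forall fun x => ?_)
  rw [Real.norm_of_nonneg (fcond_pos hp1 hp2 x y).le]
  exact fcond_le_exp_abs hp1 hp2 hp x y

lemma integrable_fcondDecay [IsProbabilityMeasure F] (hp1 : 0 < p1) (hp2 : 0 < p2)
    (hp : p1 + p2 = 1) (y : ℝ) : Integrable (fun x => fcondDecay p1 p2 x y) F := by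
  refine (integrable_fcond hp1 hp2 hp y).mono'
      (measurable_fcondDecay_left p1 p2 y).aestronglyMeasurable
    (Eventually.of_forall fun x => ?_)
  rw [Real.norm_of_nonneg (fcondDecay_nonneg hp1 hp2 x y)]
  exact fcondDecay_le hp1 hp2 x y

lemma IsDistOn2.ae_mem (h : IsDistOn2 A1 A2 F) : ∀ᵐ x ∂F, x ∈ Icc (0 : ℝ) A1 ×ˢ Icc (0 : ℝ) A2 :=
  mem_ae_iff.2 h.2

lemma measurable_fout (p1 p2 : ℝ) (F : Measure (ℝ × ℝ)) [IsProbabilityMeasure F] :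
    Measurable (fout p1 p2 F) := by
  have h : StronglyMeasurable (fun z : ℝ × (ℝ × ℝ) => fcond p1 p2 z.2 z.1) :=
    ((continuous_fcond p1 p2).comp continuous_swap).stronglyMeasurable
  exact h.integral_prod_right.measurable

lemma measurable_integral_fcondDecay (p1 p2 : ℝ) (F : Measure (ℝ × ℝ)) [IsProbabilityMeasure F] :
    Measurable fun y => ∫ x, fcondDecay p1 p2 x y ∂F := by
  have h : StronglyMeasurable (fun z : ℝ × (ℝ × ℝ) => fcondDecay p1 p2 z.2 z.1) :=
    ((continuous_fcondDecay p1 p2).comp continuous_swap).stronglyMeasurable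
  exact h.integral_prod_right.measurable

lemma fout_ge (hp1 : 0 < p1) (hp2 : 0 < p2) (hp : p1 + p2 = 1) (h : IsDistOn2 A1 A2 F) {y : ℝ}
    (hy : 0 ≤ y) :
    (p1 * exp (logRate A1) + p2 * exp (logRate A2)) * exp (-y) ≤ fout p1 p2 F y := by
  have := h.1
  have h1 : ∫ _ : ℝ × ℝ, (p1 * exp (logRate A1) + p2 * exp (logRate A2)) * exp (-y) ∂F =
    (p1 * exp (logRate A1) + p2 * exp (logRate A2)) * exp (-y) := by simp
  rw [← h1]
  refine integral_mono_ae (integrable_const _) (integrable_fcond hp1 hp2 hp y) ?_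
  filter_upwards [h.ae_mem] with x hx using fcond_ge hp1 hp2 hx hy

lemma fout_le_one (hp1 : 0 < p1) (hp2 : 0 < p2) (hp : p1 + p2 = 1) [IsProbabilityMeasure F]
    {y : ℝ} (hy : 0 ≤ y) : fout p1 p2 F y ≤ 1 := by
  have h1 : ∫ _ : ℝ × ℝ, (1 : ℝ) ∂F = 1 := by simp
  rw [← h1]
  refine integral_mono (integrable_fcond hp1 hp2 hp y) (integrable_const _) fun x =>
    fcond_le_one hp1 hp2 hp x hy

lemma fout_pos (hp1 : 0 < p1) (hp2 : 0 < p2) (hp : p1 + p2 = 1) [IsProbabilityMeasure F] (y : ℝ) :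
    0 < fout p1 p2 F y := by
  refine (integral_pos_iff_support_of_nonneg (fun x => (fcond_pos hp1 hp2 x y).le)
    (integrable_fcond hp1 hp2 hp y)).2 ?_
  have : Function.support (fun x => fcond p1 p2 x y) = univ :=
    eq_univ_of_forall fun x => (fcond_pos hp1 hp2 x y).ne'
  rw [this, measure_univ]
  exact one_pos

lemma abs_log_fout_le (hp1 : 0 < p1) (hp2 : 0 < p2) (hp : p1 + p2 = 1) (h : IsDistOn2 A1 A2 F)
    {y : ℝ} (hy : 0 ≤ y) :
    |log (fout p1 p2 F y)| ≤ |log (p1 * exp (logRate A1) + p2 * exp (logRate A2))| + y := by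
  have := h.1
  have := abs_log_le_of_exp_bounds (by positivity) hy (fout_ge hp1 hp2 hp h hy)
    (fout_le_one hp1 hp2 hp hy)
  simpa using this

lemma hasDerivAt_fout (hp1 : 0 < p1) (hp2 : 0 < p2) (hp : p1 + p2 = 1) [IsProbabilityMeasure F]
    (y : ℝ) : HasDerivAt (fout p1 p2 F) (-∫ x, fcondDecay p1 p2 x y ∂F) y := by
  rw [← integral_neg]
  refine (hasDerivAt_integral_of_dominated_loc_of_deriv_le (s := Metric.ball y 1) (x₀ := y)
    (μ := F) (F := fun y x => fcond p1 p2 x y) (F' := fun y x => -fcondDecay p1 p2 x y)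
    (bound := fun _ => exp (|y| + 1)) (Metric.ball_mem_nhds y one_pos) ?_
    (integrable_fcond hp1 hp2 hp y) ?_ ?_ (integrable_const _) ?_).2
  · exact Eventually.of_forall fun z => (measurable_fcond_left p1 p2 z).aestronglyMeasurable
  · exact (measurable_fcondDecay_left p1 p2 y).neg.aestronglyMeasurable
  · refine Eventually.of_forall fun x z hz => ?_
    rw [norm_neg, Real.norm_of_nonneg (fcondDecay_nonneg hp1 hp2 x z)]
    refine ((fcondDecay_le hp1 hp2 x z).trans (fcond_le_exp_abs hp1 hp2 hp x z)).trans
      (Real.exp_le_exp.2 ?_)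
    rw [Metric.mem_ball, Real.dist_eq] at hz
    have := abs_sub_abs_le_abs_sub z y
    linarith
  · exact Eventually.of_forall fun x z _ => hasDerivAt_fcond p1 p2 x z

lemma slowDecay_log_fout (hp1 : 0 < p1) (hp2 : 0 < p2) (hp : p1 + p2 = 1)
    (h : IsDistOn2 A1 A2 F) : SlowDecay (fun y => log (fout p1 p2 F y))
      (fun y => (∫ x, fcondDecay p1 p2 x y ∂F) / fout p1 p2 F y) := by
  have := h.1
  have hder : ∀ y, HasDerivAt (fun y => log (fout p1 p2 F y))
      (-((∫ x, fcondDecay p1 p2 x y ∂F) / fout p1 p2 F y)) y := fun y => by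
    rw [← neg_div]
    exact (hasDerivAt_fout hp1 hp2 hp y).log (fout_pos hp1 hp2 hp y).ne'
  have hm := measurable_fout p1 p2 F
  exact
    { hder := fun y _ => hder y
      hcont := (hder 0).continuousAt.continuousWithinAt
      hmeas := hm.log
      hρ := (measurable_integral_fcondDecay p1 p2 F).div hm
      h0 := fun y _ => div_nonneg (integral_nonneg fun x => fcondDecay_nonneg hp1 hp2 x y)
        (fout_pos hp1 hp2 hp y).le
      h1 := fun y _ => (div_le_one (fout_pos hp1 hp2 hp y)).2
        (integral_mono (integrable_fcondDecay hp1 hp2 hp y) (integrable_fcond hp1 hp2 hp y)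
          fun x => fcondDecay_le hp1 hp2 x y)
      hbd := ⟨_, fun y hy => abs_log_fout_le hp1 hp2 hp h hy.le⟩ }

end

section
variable {p1 p2 A1 A2 : ℝ} {F G : Measure (ℝ × ℝ)}

lemma IsDistOn2.integrable_of_continuous (h : IsDistOn2 A1 A2 F) {f : ℝ × ℝ → ℝ}
    (hf : Continuous f) : Integrable f F := by
  have := h.1
  obtain ⟨C, hC⟩ := ((isCompact_Icc (a := (0 : ℝ)) (b := A1)).prod
    (isCompact_Icc (a := (0 : ℝ)) (b := A2))).exists_bound_of_continuousOn hf.continuousOn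
  refine (integrable_const C).mono' hf.aestronglyMeasurable ?_
  filter_upwards [h.ae_mem] with x hx using hC x hx

/-- The negative entropy `∫ f(y|x) log f(y|x) dy` of the channel output given the input. -/
noncomputable def condNegEnt (p1 p2 : ℝ) (x : ℝ × ℝ) : ℝ :=
  p1 * logRate x.1 + p2 * logRate x.2 - 1 - gap p1 p2 (logRate x.1 - logRate x.2)

lemma continuous_condNegEnt (hp1 : 0 < p1) (hp2 : 0 < p2) :
    Continuous (condNegEnt p1 p2) := by
  have hg : Continuous (gap p1 p2) :=
    continuous_iff_continuousAt.2 fun s => (hasDerivAt_gap hp1 hp2 s).continuousAt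
  have := continuous_logRate
  unfold condNegEnt
  fun_prop

lemma fcond_mul_log (hp1 : 0 < p1) (hp2 : 0 < p2) (hp : p1 + p2 = 1) (x : ℝ × ℝ) :
    IntegrableOn (fun y => fcond p1 p2 x y * log (fcond p1 p2 x y)) (Ioi 0) ∧
      ∫ y in Ioi (0 : ℝ), fcond p1 p2 x y * log (fcond p1 p2 x y) = condNegEnt p1 p2 x := by
  have := integral_mixture_mul_log hp1 hp2 hp (logRate x.1) (logRate x.2)
  simpa only [fcond, pcond_eq_exp, condNegEnt] using this

lemma fcond_mul_log_fout (hp1 : 0 < p1) (hp2 : 0 < p2) (hp : p1 + p2 = 1) (h : IsDistOn2 A1 A2 F)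
    (x : ℝ × ℝ) :
    IntegrableOn (fun y => fcond p1 p2 x y * log (fout p1 p2 F y)) (Ioi 0) ∧
      ∫ y in Ioi (0 : ℝ), fcond p1 p2 x y * log (fout p1 p2 F y) =
        p1 * (∫ y in Ioi (0 : ℝ), exp (logRate x.1) *
          (exp (-(exp (logRate x.1) * y)) * log (fout p1 p2 F y))) +
        p2 * ∫ y in Ioi (0 : ℝ), exp (logRate x.2) *
          (exp (-(exp (logRate x.2) * y)) * log (fout p1 p2 F y)) := by
  have hs := slowDecay_log_fout hp1 hp2 hp h
  have i1 := ((hs.integrableOn_exp_mul (exp_pos (logRate x.1))).const_mul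
    (exp (logRate x.1))).const_mul p1
  have i2 := ((hs.integrableOn_exp_mul (exp_pos (logRate x.2))).const_mul
    (exp (logRate x.2))).const_mul p2
  have e : (fun y => fcond p1 p2 x y * log (fout p1 p2 F y)) = fun y =>
      p1 * (exp (logRate x.1) * (exp (-(exp (logRate x.1) * y)) * log (fout p1 p2 F y))) +
      p2 * (exp (logRate x.2) * (exp (-(exp (logRate x.2) * y)) * log (fout p1 p2 F y))) := by
    ext y
    simp only [fcond, pcond_eq_exp]
    ring
  rw [e]
  refine ⟨i1.add i2, ?_⟩
  rw [integral_add i1 i2, integral_const_mul p1, integral_const_mul p2]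

lemma idens2_eq_sub (hp1 : 0 < p1) (hp2 : 0 < p2) (hp : p1 + p2 = 1) (h : IsDistOn2 A1 A2 F)
    (x : ℝ × ℝ) : idens2 p1 p2 F x = condNegEnt p1 p2 x -
      ∫ y in Ioi (0 : ℝ), fcond p1 p2 x y * log (fout p1 p2 F y) := by
  have := h.1
  obtain ⟨i1, e1⟩ := fcond_mul_log hp1 hp2 hp x
  obtain ⟨i2, -⟩ := fcond_mul_log_fout hp1 hp2 hp h x
  rw [← e1, ← integral_sub i1 i2, idens2]
  refine integral_congr_ae (Eventually.of_forall fun y => ?_)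
  simp only
  rw [Real.log_div (fcond_pos hp1 hp2 x y).ne' (fout_pos hp1 hp2 hp y).ne']
  ring

lemma continuous_idens2 (hp1 : 0 < p1) (hp2 : 0 < p2) (hp : p1 + p2 = 1)
    (h : IsDistOn2 A1 A2 F) : Continuous (idens2 p1 p2 F) := by
  have hs := slowDecay_log_fout hp1 hp2 hp h
  have hc : Continuous fun t : ℝ => ∫ y in Ioi (0 : ℝ), exp t *
      (exp (-(exp t * y)) * log (fout p1 p2 F y)) :=
    continuous_iff_continuousAt.2 fun t => (hs.hasDerivAt_integral_exp t).continuousAt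
  have e : idens2 p1 p2 F = fun x => _ := funext fun x => idens2_eq_sub hp1 hp2 hp h x
  rw [e]
  simp only [(fcond_mul_log_fout hp1 hp2 hp h _).2]
  have h1 := continuous_condNegEnt hp1 hp2
  have h2 := hc.comp (continuous_logRate.comp continuous_fst (X := ℝ × ℝ) )
  have h3 := hc.comp (continuous_logRate.comp continuous_snd (X := ℝ × ℝ))
  exact h1.sub ((h2.const_mul p1).add (h3.const_mul p2))

/-- Fubini for `f(y|x) k(y)` with `k` of at most linear growth. -/
lemma fubini_fcond (hp1 : 0 < p1) (hp2 : 0 < p2) (h : IsDistOn2 A1 A2 G)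
    {k : ℝ → ℝ} (hk : Measurable k) {C : ℝ} (hC : ∀ y, 0 ≤ y → |k y| ≤ C + y) :
    IntegrableOn (fun y => fout p1 p2 G y * k y) (Ioi 0) ∧
    Integrable (fun x => ∫ y in Ioi (0 : ℝ), fcond p1 p2 x y * k y) G ∧
    ∫ x, (∫ y in Ioi (0 : ℝ), fcond p1 p2 x y * k y) ∂G =
      ∫ y in Ioi (0 : ℝ), fout p1 p2 G y * k y := by
  have := h.1
  have hmain : Integrable (Function.uncurry fun (x : ℝ × ℝ) (y : ℝ) => fcond p1 p2 x y * k y)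
      (G.prod (volume.restrict (Ioi 0))) := by
    have hb := (integrableOn_envelope_mul p1 p2 A1 A2 C).comp_snd G
    refine hb.mono' ?_ ?_
    · exact ((continuous_fcond p1 p2).measurable.mul (hk.comp measurable_snd)).aestronglyMeasurable
    · filter_upwards [Measure.quasiMeasurePreserving_fst.ae h.ae_mem,
        Measure.quasiMeasurePreserving_snd.ae (self_mem_ae_restrict measurableSet_Ioi)] with z h1 h2
      have h2' : 0 ≤ z.2 := le_of_lt h2
      simp only [Function.uncurry]
      rw [norm_mul, Real.norm_of_nonneg (fcond_pos hp1 hp2 _ _).le, Real.norm_eq_abs]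
      exact mul_le_mul (fcond_le_envelope hp1 hp2 h1 h2') (hC _ h2') (abs_nonneg _)
        ((fcond_pos hp1 hp2 _ _).le.trans (fcond_le_envelope hp1 hp2 h1 h2'))
  have e : ∀ y, ∫ x, fcond p1 p2 x y * k y ∂G = fout p1 p2 G y * k y := fun y => by
    rw [integral_mul_const, fout]
  refine ⟨?_, hmain.integral_prod_left, ?_⟩
  · have := hmain.integral_prod_right
    simpa only [IntegrableOn, Function.uncurry, e] using this
  · rw [integral_integral_swap hmain]
    simp only [e]

lemma integral_fout (hp1 : 0 < p1) (hp2 : 0 < p2) (hp : p1 + p2 = 1) (h : IsDistOn2 A1 A2 G) :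
    IntegrableOn (fout p1 p2 G) (Ioi 0) ∧ ∫ y in Ioi (0 : ℝ), fout p1 p2 G y = 1 := by
  have := h.1
  obtain ⟨i, -, e⟩ := fubini_fcond hp1 hp2 h (k := fun _ => 1) measurable_const (C := 1)
    (fun y hy => by simpa using hy)
  simp only [mul_one] at i e
  refine ⟨i, ?_⟩
  rw [← e]
  have : ∀ x, ∫ y in Ioi (0 : ℝ), fcond p1 p2 x y = 1 := by
    intro x
    have i1 := ((integrableOn_exp_neg_mul (exp_pos (logRate x.1))).const_mul
      (exp (logRate x.1))).const_mul p1
    have i2 := ((integrableOn_exp_neg_mul (exp_pos (logRate x.2))).const_mul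
      (exp (logRate x.2))).const_mul p2
    have h1 : ∀ b : ℝ, ∫ y in Ioi (0 : ℝ), exp (-(exp b * y)) = (exp b)⁻¹ := by
      intro b
      have := integral_exp_mul_Ioi (a := -exp b) (by linarith [exp_pos b]) 0
      simpa [neg_mul, neg_div] using this
    simp only [fcond, pcond_eq_exp]
    rw [integral_add i1 i2]
    simp only [integral_const_mul, h1]
    rw [mul_inv_cancel₀ (exp_pos _).ne', mul_inv_cancel₀ (exp_pos _).ne']
    linarith
  simp [this]

lemma fout_mul_log_fout (hp1 : 0 < p1) (hp2 : 0 < p2) (hp : p1 + p2 = 1)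
    (hF : IsDistOn2 A1 A2 F) (hG : IsDistOn2 A1 A2 G) :
    IntegrableOn (fun y => fout p1 p2 G y * log (fout p1 p2 F y)) (Ioi 0) ∧
    ∫ x, idens2 p1 p2 F x ∂G = (∫ x, condNegEnt p1 p2 x ∂G) -
      ∫ y in Ioi (0 : ℝ), fout p1 p2 G y * log (fout p1 p2 F y) := by
  have := hF.1
  obtain ⟨i, i', e⟩ := fubini_fcond hp1 hp2 hG (measurable_fout p1 p2 F).log
    (fun y hy => abs_log_fout_le hp1 hp2 hp hF hy)
  refine ⟨i, ?_⟩
  simp only [idens2_eq_sub hp1 hp2 hp hF]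
  rw [integral_sub (hG.integrable_of_continuous (continuous_condNegEnt hp1 hp2)) i', e]

end

lemma mul_log_segment_bounds {a b t : ℝ} (ha : 0 < a) (hb : 0 < b) (ht : 0 < t) (ht1 : t ≤ 1) :
    (b - a) * (log a + 1) ≤
      (((1 - t) * a + t * b) * log ((1 - t) * a + t * b) - a * log a) / t ∧
    (((1 - t) * a + t * b) * log ((1 - t) * a + t * b) - a * log a) / t ≤
      b * log b - a * log a := by
  set c := (1 - t) * a + t * b with hc
  have hc0 : 0 < c := by
    have : 0 ≤ (1 - t) * a := mul_nonneg (by linarith) ha.le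
    have : 0 < t * b := mul_pos ht hb
    linarith
  constructor
  · rw [le_div_iff₀ ht]
    have h1 := Real.log_le_sub_one_of_pos (div_pos ha hc0)
    rw [Real.log_div ha.ne' hc0.ne'] at h1
    have h2 := mul_le_mul_of_nonneg_left h1 hc0.le
    have h3 : c * (a / c - 1) = a - c := by field_simp
    rw [h3] at h2
    have h4 : (b - a) * t = c - a := by rw [hc]; ring
    have h5 : (b - a) * (log a + 1) * t = (c - a) * (log a + 1) := by rw [← h4]; ring
    rw [h5]
    nlinarith
  · rw [div_le_iff₀ ht]
    have := Real.convexOn_mul_log.2 ha.le hb.le (show 0 ≤ 1 - t by linarith) ht.le (by ring)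
    simp only [smul_eq_mul] at this
    rw [← hc] at this
    linarith

lemma tendsto_mul_log_segment {a : ℝ} (ha : 0 < a) (b : ℝ) :
    Tendsto (fun t : ℝ => (((1 - t) * a + t * b) * log ((1 - t) * a + t * b) - a * log a) / t)
      (𝓝[≠] 0) (𝓝 ((b - a) * (log a + 1))) := by
  have h1 : HasDerivAt (fun t : ℝ => (1 - t) * a + t * b) (b - a) 0 := by
    refine ((((hasDerivAt_id (0 : ℝ)).const_sub 1).mul_const a).add
      ((hasDerivAt_id (0 : ℝ)).mul_const b)).congr_deriv ?_
    ring
  have h2 := Real.hasDerivAt_mul_log ha.ne'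
  have h3 : HasDerivAt (fun t : ℝ => ((1 - t) * a + t * b) * log ((1 - t) * a + t * b))
      ((log a + 1) * (b - a)) 0 := by
    refine HasDerivAt.comp (h₂ := fun x => x * log x) (0 : ℝ) ?_ h1
    simpa using h2
  rw [mul_comm (b - a)]
  refine (hasDerivAt_iff_tendsto_slope.1 h3).congr fun t => ?_
  simp [slope_def_field]

/-- The mixture `(1 - t) F + t G` of two measures. -/
noncomputable def mixture (t : ℝ) (F G : Measure (ℝ × ℝ)) : Measure (ℝ × ℝ) :=
  ENNReal.ofReal (1 - t) • F + ENNReal.ofReal t • G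

section
variable {p1 p2 A1 A2 t : ℝ} {F G : Measure (ℝ × ℝ)}

lemma IsDistOn2.mixture (hF : IsDistOn2 A1 A2 F) (hG : IsDistOn2 A1 A2 G) (ht : 0 ≤ t)
    (ht1 : t ≤ 1) : IsDistOn2 A1 A2 (mixture t F G) := by
  have := hF.1
  have := hG.1
  refine ⟨⟨?_⟩, ?_⟩
  · simp only [_root_.mixture, Measure.add_apply, Measure.smul_apply, measure_univ, smul_eq_mul,
      mul_one]
    rw [← ENNReal.ofReal_add (by linarith) ht]
    simp
  · simp only [_root_.mixture, Measure.add_apply, Measure.smul_apply, smul_eq_mul, hF.2, hG.2,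
      mul_zero, add_zero]

lemma integral_mixture {f : ℝ × ℝ → ℝ} (hF : Integrable f F) (hG : Integrable f G) (ht : 0 ≤ t)
    (ht1 : t ≤ 1) :
    ∫ x, f x ∂(mixture t F G) = (1 - t) * (∫ x, f x ∂F) + t * ∫ x, f x ∂G := by
  rw [mixture, integral_add_measure (hF.smul_measure ENNReal.ofReal_ne_top)
    (hG.smul_measure ENNReal.ofReal_ne_top), integral_smul_measure, integral_smul_measure,
    ENNReal.toReal_ofReal (by linarith), ENNReal.toReal_ofReal ht, smul_eq_mul, smul_eq_mul]

/-- First-order optimality: if mutual information does not increase along the segment from `F`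
to `G`, the information density of `F` has `G`-mean at most the mutual information of `F`. -/
lemma integral_idens2_le (hp1 : 0 < p1) (hp2 : 0 < p2) (hp : p1 + p2 = 1)
    (hF : IsDistOn2 A1 A2 F) (hG : IsDistOn2 A1 A2 G)
    (hmax : ∀ t : ℝ, 0 < t → t ≤ 1 → MI2 p1 p2 (mixture t F G) ≤ MI2 p1 p2 F) :
    ∫ x, idens2 p1 p2 F x ∂G ≤ MI2 p1 p2 F := by
  have := hF.1
  have := hG.1
  obtain ⟨iFF, eFF⟩ := fout_mul_log_fout hp1 hp2 hp hF hF
  obtain ⟨iGF, eGF⟩ := fout_mul_log_fout hp1 hp2 hp hF hG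
  obtain ⟨iGG, -⟩ := fout_mul_log_fout hp1 hp2 hp hG hG
  obtain ⟨iF, oF⟩ := integral_fout hp1 hp2 hp hF
  obtain ⟨iG, oG⟩ := integral_fout hp1 hp2 hp hG
  set f := fout p1 p2 F with hf
  set g := fout p1 p2 G with hg
  have f0 : ∀ y, 0 < f y := fun y => fout_pos hp1 hp2 hp y
  have g0 : ∀ y, 0 < g y := fun y => fout_pos hp1 hp2 hp y
  have mf : Measurable f := measurable_fout p1 p2 F
  have mg : Measurable g := measurable_fout p1 p2 G
  set D : ℝ → ℝ → ℝ := fun t y =>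
    (((1 - t) * f y + t * g y) * log ((1 - t) * f y + t * g y) - f y * log (f y)) / t with hD
  have hlow : IntegrableOn (fun y => (g y - f y) * (log (f y) + 1)) (Ioi 0) := by
    refine (((iGF.sub iFF).add iG).sub iF).congr (Eventually.of_forall fun y => ?_)
    simp only [Pi.add_apply, Pi.sub_apply]
    ring
  have hlow_eq : ∫ y in Ioi (0 : ℝ), (g y - f y) * (log (f y) + 1) =
      (∫ y in Ioi (0 : ℝ), g y * log (f y)) - ∫ y in Ioi (0 : ℝ), f y * log (f y) := by
    have : (fun y => (g y - f y) * (log (f y) + 1)) =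
        ((fun y => g y * log (f y)) - fun y => f y * log (f y)) + g - f := by
      ext y
      simp only [Pi.add_apply, Pi.sub_apply]
      ring
    rw [this, integral_sub' ((iGF.sub iFF).add iG) iF, integral_add' (iGF.sub iFF) iG,
      integral_sub' iGF iFF, oF, oG]
    ring
  have hbd : ∀ t : ℝ, 0 < t → t ≤ 1 → ∀ y,
      ‖D t y‖ ≤ |(g y - f y) * (log (f y) + 1)| + |g y * log (g y) - f y * log (f y)| := by
    intro t ht ht1 y
    obtain ⟨h1, h2⟩ := mul_log_segment_bounds (f0 y) (g0 y) ht ht1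
    rw [Real.norm_eq_abs, abs_le]
    constructor
    · have := neg_abs_le ((g y - f y) * (log (f y) + 1))
      have := abs_nonneg (g y * log (g y) - f y * log (f y))
      linarith
    · have := le_abs_self (g y * log (g y) - f y * log (f y))
      have := abs_nonneg ((g y - f y) * (log (f y) + 1))
      linarith
  have hbi : IntegrableOn (fun y => |(g y - f y) * (log (f y) + 1)| +
      |g y * log (g y) - f y * log (f y)|) (Ioi 0) := hlow.abs.add (iGG.sub iFF).abs
  have hmeas : ∀ t, Measurable (D t) := fun t => by
    have h1 : Measurable fun y => (1 - t) * f y + t * g y := by fun_prop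
    exact ((h1.mul h1.log).sub (mf.mul mf.log)).div_const t
  have iN : ∀ {H : Measure (ℝ × ℝ)}, IsDistOn2 A1 A2 H → Integrable (condNegEnt p1 p2) H :=
    fun h => h.integrable_of_continuous (continuous_condNegEnt hp1 hp2)
  have key : ∀ t : ℝ, 0 < t → t ≤ 1 →
      (∫ x, condNegEnt p1 p2 x ∂G) - ∫ x, condNegEnt p1 p2 x ∂F ≤ ∫ y in Ioi (0 : ℝ), D t y := by
    intro t ht ht1
    have hH := hF.mixture hG ht.le ht1
    obtain ⟨iHH, eHH⟩ := fout_mul_log_fout hp1 hp2 hp hH hH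
    have hfo : ∀ y, fout p1 p2 (mixture t F G) y = (1 - t) * f y + t * g y := fun y =>
      integral_mixture (integrable_fcond hp1 hp2 hp y) (integrable_fcond hp1 hp2 hp y) ht.le ht1
    have h1 := hmax t ht ht1
    rw [MI2, MI2, eHH, eFF, integral_mixture (iN hF) (iN hG) ht.le ht1] at h1
    simp only [hfo] at h1 iHH
    have h2 : ∫ y in Ioi (0 : ℝ), D t y = ((∫ y in Ioi (0 : ℝ), ((1 - t) * f y + t * g y) *
        log ((1 - t) * f y + t * g y)) - ∫ y in Ioi (0 : ℝ), f y * log (f y)) / t := by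
      rw [← integral_sub iHH iFF, ← integral_div]
    rw [h2, le_div_iff₀ ht]
    linarith
  have hlim : Tendsto (fun n : ℕ => ∫ y in Ioi (0 : ℝ), D (1 / ((n : ℝ) + 1)) y) atTop
      (𝓝 (∫ y in Ioi (0 : ℝ), (g y - f y) * (log (f y) + 1))) := by
    have hpos : ∀ n : ℕ, 0 < 1 / ((n : ℝ) + 1) := fun n => by positivity
    have hle : ∀ n : ℕ, 1 / ((n : ℝ) + 1) ≤ 1 := fun n => by
      rw [div_le_one (by positivity)]
      linarith [n.cast_nonneg (α := ℝ)]
    refine tendsto_integral_of_dominated_convergence _ (fun n => (hmeas _).aestronglyMeasurable)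
      hbi (fun n => Eventually.of_forall fun y => hbd _ (hpos n) (hle n) y)
      (Eventually.of_forall fun y => ?_)
    refine (tendsto_mul_log_segment (f0 y) (g y)).comp ?_
    refine tendsto_nhdsWithin_iff.2 ⟨tendsto_one_div_add_atTop_nhds_zero_nat, ?_⟩
    exact Eventually.of_forall fun n => (hpos n).ne'
  have hfin : (∫ x, condNegEnt p1 p2 x ∂G) - ∫ x, condNegEnt p1 p2 x ∂F ≤
      ∫ y in Ioi (0 : ℝ), (g y - f y) * (log (f y) + 1) := by
    refine ge_of_tendsto' hlim fun n => key _ (by positivity) ?_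
    rw [div_le_one (by positivity)]
    linarith [n.cast_nonneg (α := ℝ)]
  rw [hlow_eq] at hfin
  rw [MI2, eGF, eFF]
  linarith

end

/-- Lagrange multipliers for a maximization problem with two inequality constraints over a set
closed under averaging, satisfying Slater's condition. -/
lemma exists_multipliers {ι : Type*} {D : Set ι} {u v z : ι → ℝ}
    (hconv : ∀ F ∈ D, ∀ G ∈ D, ∀ t : ℝ, 0 ≤ t → t ≤ 1 → ∃ H ∈ D,
      u H = (1 - t) * u F + t * u G ∧ v H = (1 - t) * v F + t * v G ∧
      z H = (1 - t) * z F + t * z G)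
    (hopt : ∀ F ∈ D, v F ≤ 0 → 0 ≤ z F → u F ≤ 0)
    (hslater : ∃ F ∈ D, v F < 0 ∧ 0 < z F) :
    ∃ lam mu : ℝ, 0 ≤ lam ∧ 0 ≤ mu ∧ ∀ F ∈ D, u F - lam * v F + mu * z F ≤ 0 := by
  obtain ⟨S, hS, hvS, hzS⟩ := hslater
  set K : Set (ℝ × ℝ × ℝ) := ⋃ F ∈ D, Iio (u F) ×ˢ Ioi (v F) ×ˢ Iio (z F) with hK
  have hKo : IsOpen K := isOpen_biUnion fun F _ => isOpen_Iio.prod (isOpen_Ioi.prod isOpen_Iio)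
  have hKc : Convex ℝ K := by
    rintro ⟨a1, b1, c1⟩ h1 ⟨a2, b2, c2⟩ h2 s t hs ht hst
    simp only [hK, mem_iUnion₂, mem_prod, mem_Iio, mem_Ioi] at h1 h2 ⊢
    obtain ⟨F, hF, hF1, hF2, hF3⟩ := h1
    obtain ⟨G, hG, hG1, hG2, hG3⟩ := h2
    obtain ⟨H, hH, e1, e2, e3⟩ := hconv F hF G hG t ht (by linarith)
    have hs' : 1 - t = s := by linarith
    rw [hs'] at e1 e2 e3
    have hlt : ∀ {a b c d : ℝ}, a < b → c < d → s * a + t * c < s * b + t * d := by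
      intro a b c d hab hcd
      rcases hs.eq_or_lt with rfl | hs0
      · have : t = 1 := by linarith
        subst this; linarith
      · have := mul_lt_mul_of_pos_left hab hs0
        have := mul_le_mul_of_nonneg_left hcd.le ht
        linarith
    refine ⟨H, hH, ?_, ?_, ?_⟩
    · rw [e1]; exact hlt hF1 hG1
    · rw [e2]; exact hlt hF2 hG2
    · rw [e3]; exact hlt hF3 hG3
  have h0 : (0 : ℝ × ℝ × ℝ) ∉ K := by
    simp only [hK, mem_iUnion₂, mem_prod, mem_Iio, mem_Ioi, Prod.fst_zero, Prod.snd_zero]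
    rintro ⟨F, hF, h1, h2, h3⟩
    exact absurd (hopt F hF h2.le h3.le) (not_le.2 h1)
  obtain ⟨φ, hφ⟩ := geometric_hahn_banach_open_point hKc hKo h0
  set a := φ (1, 0, 0)
  set b := φ (0, 1, 0)
  set c := φ (0, 0, 1)
  have hφe : ∀ r s t : ℝ, φ (r, s, t) = r * a + s * b + t * c := by
    intro r s t
    have : (r, s, t) = r • ((1, 0, 0) : ℝ × ℝ × ℝ) + s • (0, 1, 0) + t • (0, 0, 1) := by simp
    rw [this, map_add, map_add, map_smul, map_smul, map_smul]
    rfl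
  have hneg : ∀ F ∈ D, ∀ r s t : ℝ, r < u F → v F < s → t < z F → r * a + s * b + t * c < 0 := by
    intro F hF r s t h1 h2 h3
    have := hφ (r, s, t) (by
      simp only [hK, mem_iUnion₂, mem_prod, mem_Iio, mem_Ioi]
      exact ⟨F, hF, h1, h2, h3⟩)
    rwa [hφe, map_zero] at this
  have hle : ∀ F ∈ D, u F * a + v F * b + z F * c ≤ 0 := by
    intro F hF
    have hlim : Tendsto (fun ε : ℝ => (u F - ε) * a + (v F + ε) * b + (z F - ε) * c) (𝓝[>] 0)
        (𝓝 ((u F - 0) * a + (v F + 0) * b + (z F - 0) * c)) := by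
      refine Tendsto.mono_left (Continuous.tendsto ?_ 0) nhdsWithin_le_nhds
      fun_prop
    simp only [sub_zero, add_zero] at hlim
    refine le_of_tendsto hlim ?_
    filter_upwards [self_mem_nhdsWithin] with ε hε
    have hε' : 0 < ε := hε
    exact (hneg F hF _ _ _ (by linarith) (by linarith) (by linarith)).le
  have hray : ∀ d e : ℝ, (∀ T : ℝ, 0 < T → e + T * d < 0) → d ≤ 0 := by
    intro d e h
    by_contra! hd
    have := h (|e| / d + 1) (by positivity)
    have h2 : (|e| / d + 1) * d = |e| + d := by field_simp
    rw [h2] at this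
    linarith [neg_abs_le e]
  have ha : 0 ≤ a := by
    have := hray (-a) ((u S) * a + (v S + 1) * b + (z S - 1) * c) fun T hT => by
      have := hneg S hS (u S - T) (v S + 1) (z S - 1) (by linarith) (by linarith) (by linarith)
      linarith
    linarith
  have hb : b ≤ 0 := hray b ((u S - 1) * a + (v S) * b + (z S - 1) * c) fun T hT => by
    have := hneg S hS (u S - 1) (v S + T) (z S - 1) (by linarith) (by linarith) (by linarith)
    linarith
  have hc : 0 ≤ c := by
    have := hray (-c) ((u S - 1) * a + (v S + 1) * b + (z S) * c) fun T hT => by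
      have := hneg S hS (u S - 1) (v S + 1) (z S - T) (by linarith) (by linarith) (by linarith)
      linarith
    linarith
  have ha' : 0 < a := by
    refine lt_of_le_of_ne ha fun ha0 => ?_
    have h1 := hneg S hS (u S - 1) (v S / 2) (z S / 2) (by linarith) (by linarith) (by linarith)
    have h2 : 0 ≤ v S / 2 * b := mul_nonneg_of_nonpos_of_nonpos (by linarith) hb
    have h3 : 0 ≤ z S / 2 * c := mul_nonneg (by linarith) hc
    rw [← ha0] at h1
    linarith
  refine ⟨-b / a, c / a, div_nonneg (by linarith) ha, div_nonneg hc ha, fun F hF => ?_⟩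
  have h1 : u F - -b / a * v F + c / a * z F = (u F * a + v F * b + z F * c) / a := by
    field_simp
    ring
  rw [h1]
  exact div_nonpos_of_nonpos_of_nonneg (hle F hF) ha

lemma isDistOn2_dirac {A1 A2 : ℝ} {x : ℝ × ℝ} (hx : x ∈ Icc (0 : ℝ) A1 ×ˢ Icc (0 : ℝ) A2) :
    IsDistOn2 A1 A2 (Measure.dirac x) := by
  refine ⟨inferInstance, ?_⟩
  rw [Measure.dirac_apply' x (measurableSet_Icc.prod measurableSet_Icc).compl]
  exact indicator_of_notMem (not_not.2 hx) _

lemma msupp_subset_of_isClosed {X : Type*} [TopologicalSpace X] [MeasurableSpace X] {μ : Measure X}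
    {s : Set X} (hs : IsClosed s) (h : μ sᶜ = 0) : msupp μ ⊆ s := by
  intro x hx
  by_contra hxs
  exact (hx sᶜ hs.isOpen_compl hxs).ne' h

lemma eq_zero_on_msupp {X : Type*} [TopologicalSpace X] [MeasurableSpace X] {μ : Measure X}
    {f : X → ℝ} (hf : Continuous f) (h : f =ᵐ[μ] 0) {x : X} (hx : x ∈ msupp μ) : f x = 0 := by
  have hs : IsClosed {y | f y = 0} := isClosed_eq hf continuous_const
  exact msupp_subset_of_isClosed hs (mem_ae_iff.1 h) hx

/-- The Lagrangian density whose sign expresses the optimality conditions. -/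
noncomputable def lagrangian (p1 p2 P B h2 Ereq lam mu : ℝ) (F : Measure (ℝ × ℝ)) (x : ℝ × ℝ) : ℝ :=
  (idens2 p1 p2 F x - MI2 p1 p2 F) - lam * ((p1 * x.1 ^ 2 + p2 * x.2 ^ 2) - P) +
    mu * ((p1 * EH B h2 x.1 + p2 * EH B h2 x.2) - Ereq)

section
variable {A1 A2 p1 p2 P B h2 Ereq : ℝ} {F : Measure (ℝ × ℝ)}

lemma continuous_lagrangian (hp1 : 0 < p1) (hp2 : 0 < p2) (hp : p1 + p2 = 1)
    (hF : IsDistOn2 A1 A2 F) (lam mu : ℝ) :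
    Continuous (lagrangian p1 p2 P B h2 Ereq lam mu F) := by
  have h1 := continuous_idens2 hp1 hp2 hp hF
  have h2 := continuous_EH B h2
  unfold lagrangian
  fun_prop

/-- Karush–Kuhn–Tucker conditions for a capacity-achieving input distribution. -/
lemma exists_kkt (hp1 : 0 < p1) (hp2 : 0 < p2) (hp : p1 + p2 = 1)
    (hslater : ∃ x ∈ Icc (0 : ℝ) A1 ×ˢ Icc (0 : ℝ) A2,
      p1 * x.1 ^ 2 + p2 * x.2 ^ 2 < P ∧ Ereq < p1 * EH B h2 x.1 + p2 * EH B h2 x.2)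
    (hF : Feas2 A1 A2 p1 p2 P B h2 Ereq F)
    (hmax : ∀ G : Measure (ℝ × ℝ), Feas2 A1 A2 p1 p2 P B h2 Ereq G → MI2 p1 p2 G ≤ MI2 p1 p2 F) :
    ∃ lam mu : ℝ,
      (∀ x ∈ Icc (0 : ℝ) A1 ×ˢ Icc (0 : ℝ) A2, lagrangian p1 p2 P B h2 Ereq lam mu F x ≤ 0) ∧
      ∀ x ∈ msupp F, lagrangian p1 p2 P B h2 Ereq lam mu F x = 0 := by
  obtain ⟨hD, hFP, hFE⟩ := hF
  set cost : ℝ × ℝ → ℝ := fun x => p1 * x.1 ^ 2 + p2 * x.2 ^ 2 with hcost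
  set gain : ℝ × ℝ → ℝ := fun x => p1 * EH B h2 x.1 + p2 * EH B h2 x.2 with hgain
  have cc : Continuous cost := by fun_prop
  have cg : Continuous gain := by
    have := continuous_EH B h2
    fun_prop
  have ci := continuous_idens2 hp1 hp2 hp hD
  obtain ⟨lam, mu, hlam, hmu, hdual⟩ := exists_multipliers (D := {G | IsDistOn2 A1 A2 G})
    (u := fun G => (∫ x, idens2 p1 p2 F x ∂G) - MI2 p1 p2 F) (v := fun G => (∫ x, cost x ∂G) - P)
    (z := fun G => (∫ x, gain x ∂G) - Ereq) (by
      intro G hG H hH t ht ht1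
      refine ⟨mixture t G H, hG.mixture hH ht ht1, ?_, ?_, ?_⟩
      · rw [integral_mixture (hG.integrable_of_continuous ci) (hH.integrable_of_continuous ci) ht
          ht1]
        ring
      · rw [integral_mixture (hG.integrable_of_continuous cc) (hH.integrable_of_continuous cc) ht
          ht1]
        ring
      · rw [integral_mixture (hG.integrable_of_continuous cg) (hH.integrable_of_continuous cg) ht
          ht1]
        ring)
    (by
      intro G hG hv hz
      have h1 := integral_idens2_le hp1 hp2 hp hD hG fun t ht ht1 => hmax _ ⟨
        hD.mixture hG ht.le ht1, by
          rw [integral_mixture (hD.integrable_of_continuous cc) (hG.integrable_of_continuous cc)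
            ht.le ht1]
          nlinarith, by
          rw [integral_mixture (hD.integrable_of_continuous cg) (hG.integrable_of_continuous cg)
            ht.le ht1]
          nlinarith⟩
      linarith)
    (by
      obtain ⟨x, hx, h1, h2⟩ := hslater
      refine ⟨Measure.dirac x, isDistOn2_dirac hx, ?_, ?_⟩
      · rw [integral_dirac]; exact sub_neg.2 h1
      · rw [integral_dirac]; exact sub_pos.2 h2)
  have hle : ∀ x ∈ Icc (0 : ℝ) A1 ×ˢ Icc (0 : ℝ) A2,
      lagrangian p1 p2 P B h2 Ereq lam mu F x ≤ 0 := by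
    intro x hx
    have := hdual (Measure.dirac x) (isDistOn2_dirac hx)
    simpa only [integral_dirac, lagrangian] using this
  refine ⟨lam, mu, hle, fun x hx => ?_⟩
  have := hD.1
  have cl := continuous_lagrangian (P := P) (B := B) (h2 := h2) (Ereq := Ereq) hp1 hp2 hp hD lam mu
  have hint : 0 ≤ ∫ x, lagrangian p1 p2 P B h2 Ereq lam mu F x ∂F := by
    have e : ∫ x, lagrangian p1 p2 P B h2 Ereq lam mu F x ∂F =
        ((∫ x, idens2 p1 p2 F x ∂F) - MI2 p1 p2 F) - lam * ((∫ x, cost x ∂F) - P) +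
          mu * ((∫ x, gain x ∂F) - Ereq) := by
      have i1 := hD.integrable_of_continuous (f := fun x => idens2 p1 p2 F x - MI2 p1 p2 F)
        (by fun_prop)
      have i2 := hD.integrable_of_continuous (f := fun x => lam * (cost x - P)) (by fun_prop)
      have i3 := hD.integrable_of_continuous (f := fun x => mu * (gain x - Ereq)) (by fun_prop)
      have e1 := integral_add (i1.sub i2) i3
      simp only [Pi.sub_apply] at e1
      rw [integral_sub i1 i2, integral_const_mul, integral_const_mul,
        integral_sub (hD.integrable_of_continuous ci) (integrable_const _),
        integral_sub (hD.integrable_of_continuous cc) (integrable_const _),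
        integral_sub (hD.integrable_of_continuous cg) (integrable_const _)] at e1
      simpa [lagrangian] using e1
    rw [e, MI2, sub_self]
    have h1 := mul_nonneg hlam (sub_nonneg.2 hFP)
    have h2 := mul_nonneg hmu (sub_nonneg.2 hFE)
    linarith
  refine eq_zero_on_msupp cl ?_ hx
  have hneg : 0 ≤ᵐ[F] fun x => -lagrangian p1 p2 P B h2 Ereq lam mu F x := by
    filter_upwards [hD.ae_mem] with y hy
    have := hle y hy
    simp only [Pi.zero_apply]
    linarith
  have hz := (integral_eq_zero_iff_of_nonneg_ae hneg (hD.integrable_of_continuous cl.neg)).1 (by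
    refine le_antisymm ?_ (integral_nonneg_of_ae hneg)
    rw [integral_neg]
    linarith)
  filter_upwards [hz] with y hy
  simpa using hy

end

lemma pairFun_swap {p q : ℝ} (hp : 0 < p) (hq : 0 < q) (hpq : p + q = 1) (Φ : ℝ → ℝ) (α β : ℝ) :
    pairFun q p Φ β α = pairFun p q Φ α β := by
  unfold pairFun
  rw [← gap_swap hp hq hpq, neg_sub]
  ring

lemma finite_zeros_of_slope {Φ w : ℝ → ℝ} (hder : ∀ t, HasDerivAt Φ (w t - 1) t)
    (han : ∀ t, AnalyticAt ℝ Φ t) (hlim : Tendsto w atTop (𝓝 0)) (a b : ℝ) :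
    {t | t ∈ Icc a b ∧ Φ t = 0}.Finite := by
  by_contra hinf
  obtain ⟨t, -, ht⟩ := Set.Infinite.exists_accPt_of_subset_isCompact hinf
    (isCompact_Icc (a := a) (b := b)) fun t ht => ht.1
  have hfreq : ∃ᶠ s in 𝓝[≠] t, Φ s = 0 :=
    (accPt_iff_frequently_nhdsNE.1 ht).mono fun s hs => hs.2
  have hz := AnalyticOnNhd.eqOn_zero_of_preconnected_of_frequently_eq_zero
    (fun s (_ : s ∈ univ) => han s) isPreconnected_univ (mem_univ t) hfreq
  have hΦ : Φ = fun _ => 0 := funext fun s => hz (mem_univ s)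
  have hw : ∀ s, w s = 1 := fun s => by
    have h1 := hder s
    rw [hΦ] at h1
    have := h1.unique (hasDerivAt_const s (0 : ℝ))
    linarith
  have hw' : w = fun _ => 1 := funext hw
  rw [hw'] at hlim
  exact one_ne_zero (tendsto_nhds_unique tendsto_const_nhds hlim)

/-- A nonnegative pair function on a rectangle has finitely many zeros there. -/
lemma finite_zeros_pairFun {p q a b : ℝ} {Φ w : ℝ → ℝ} {W : ℂ → ℂ} (hp : 0 < p) (hq : 0 < q)
    (hpq : p + q = 1) (ha : a < 0) (hb : b < 0) (hder : ∀ t, HasDerivAt Φ (w t - 1) t)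
    (han : ∀ t, AnalyticAt ℝ Φ t) (hlim : Tendsto w atTop (𝓝 0))
    (hW : DifferentiableOn ℂ W {z | 0 < z.re}) (hWw : ∀ t : ℝ, W ((exp t : ℝ) : ℂ) = (w t : ℝ))
    (hWlim : ∀ σ : ℝ, 0 < σ → Tendsto (fun T : ℝ => W (σ + T * Complex.I) / T) atTop (𝓝 0))
    (hnonneg : ∀ α ∈ Icc a 0, ∀ β ∈ Icc b 0, 0 ≤ pairFun p q Φ α β) :
    {z : ℝ × ℝ | z ∈ Icc a 0 ×ˢ Icc b 0 ∧ pairFun p q Φ z.1 z.2 = 0}.Finite := by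
  set m := max a b with hm
  have hm0 : m < 0 := max_lt ha hb
  have hdiag : ∀ t, pairFun p q Φ t t = Φ t := fun t => by
    rw [pairFun, sub_self, gap_zero hpq, add_zero, ← add_mul, hpq, one_mul]
  have hΦ : ∀ t ∈ Icc m 0, 0 ≤ Φ t := fun t ht => by
    rw [← hdiag]
    exact hnonneg t ⟨(le_max_left _ _).trans ht.1, ht.2⟩ t ⟨(le_max_right _ _).trans ht.1, ht.2⟩
  have h1 : PairOptimal p q m b Φ w W := ⟨hp, hq, hpq, hm0, hder, han, hlim, hW,
    hWw, hWlim, hΦ, fun α hα β hβ hlt =>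
      hnonneg α ⟨(le_max_left _ _).trans hα.1, hα.2⟩ β ⟨hβ, hlt.le.trans hα.2⟩⟩
  have h2 : PairOptimal q p m a Φ w W := ⟨hq, hp, by linarith, hm0, hder, han,
    hlim, hW, hWw, hWlim, hΦ, fun α hα β hβ hlt => by
      rw [pairFun_swap hp hq hpq]
      exact hnonneg β ⟨hβ, hlt.le.trans hα.2⟩ α ⟨(le_max_right _ _).trans hα.1, hα.2⟩⟩
  refine ((h1.finite_contactSet.union (h2.finite_contactSet.image Prod.swap)).union
    ((finite_zeros_of_slope hder han hlim m 0).image fun t => (t, t))).subset ?_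
  rintro ⟨α, β⟩ ⟨⟨hα, hβ⟩, hz⟩
  simp only at hα hβ hz
  rcases lt_trichotomy β α with hlt | rfl | hlt
  · exact Or.inl (Or.inl ⟨⟨max_le hα.1 (hβ.1.trans hlt.le), hα.2⟩, hβ.1, hlt, hz⟩)
  · exact Or.inr ⟨β, ⟨⟨max_le hα.1 hβ.1, hα.2⟩, by rw [← hdiag, hz]⟩, rfl⟩
  · refine Or.inl (Or.inr ⟨(β, α), ⟨⟨max_le (hα.1.trans hlt.le) hβ.1, hβ.2⟩, hα.1, hlt, ?_⟩, rfl⟩)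
    simp only
    rw [pairFun_swap hp hq hpq, hz]

/-- The multiplier term of the optimality conditions, as an entire function of `1 + x²`. -/
noncomputable def multC (B h2 lam mu : ℝ) (z : ℂ) : ℂ :=
  lam * (z - 1) - mu * besselC ((B ^ 2 * h2 ^ 2 / 2 : ℝ) * (z - 1))

lemma differentiable_multC (B h2 lam mu : ℝ) : Differentiable ℂ (multC B h2 lam mu) := by
  have := differentiable_besselC
  unfold multC
  fun_prop

lemma multC_ofReal (B h2 lam mu x : ℝ) :
    multC B h2 lam mu x = ((multC B h2 lam mu x).re : ℝ) := by
  have h : besselC ((B ^ 2 * h2 ^ 2 / 2 : ℝ) * ((x : ℂ) - 1)) =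
      ((∑' n : ℕ, (B ^ 2 * h2 ^ 2 / 2 * (x - 1)) ^ n / (n.factorial : ℝ) ^ 2 : ℝ) : ℂ) := by
    rw [← besselC_ofReal]
    push_cast
    rfl
  unfold multC
  rw [h]
  norm_cast

lemma multC_one_add_sq (B h2 lam mu x : ℝ) :
    (multC B h2 lam mu ((1 + x ^ 2 : ℝ) : ℂ)).re = lam * x ^ 2 - mu * EH B h2 x := by
  have h : ((B ^ 2 * h2 ^ 2 / 2 : ℝ) : ℂ) * (((1 + x ^ 2 : ℝ) : ℂ) - 1) =
      ((B ^ 2 * h2 ^ 2 / 2 * x ^ 2 : ℝ) : ℂ) := by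
    push_cast
    ring
  unfold multC
  rw [h, ← EH_eq_besselC]
  have : (lam : ℂ) * (((1 + x ^ 2 : ℝ) : ℂ) - 1) - mu * ((EH B h2 x : ℝ) : ℂ) =
      ((lam * x ^ 2 - mu * EH B h2 x : ℝ) : ℂ) := by
    push_cast
    ring
  rw [this, Complex.ofReal_re]

section
variable {A1 A2 p1 p2 P B h2 Ereq : ℝ} {F : Measure (ℝ × ℝ)}

lemma pairFun_logRate (hp1 : 0 < p1) (hp2 : 0 < p2) (hp : p1 + p2 = 1) (hF : IsDistOn2 A1 A2 F)
    (lam mu : ℝ) (x : ℝ × ℝ) :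
    pairFun p1 p2 (SlowDecay.profile (fun y => log (fout p1 p2 F y))
      (fun t => (multC B h2 lam mu t).re) (1 + MI2 p1 p2 F - lam * P + mu * Ereq))
      (logRate x.1) (logRate x.2) = -lagrangian p1 p2 P B h2 Ereq lam mu F x := by
  unfold pairFun SlowDecay.profile lagrangian
  simp only
  rw [exp_neg_logRate, exp_neg_logRate, multC_one_add_sq, multC_one_add_sq,
    idens2_eq_sub hp1 hp2 hp hF, (fcond_mul_log_fout hp1 hp2 hp hF x).2, condNegEnt]
  linear_combination (1 + MI2 p1 p2 F - lam * P + mu * Ereq) * hp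

lemma exists_logRate_eq {A α : ℝ} (hA : 0 ≤ A) (h : α ∈ Icc (logRate A) 0) :
    ∃ x ∈ Icc 0 A, logRate x = α := by
  have h1 : 1 ≤ exp (-α) := Real.one_le_exp (by linarith [h.2])
  have h2 : exp (-α) ≤ 1 + A ^ 2 := by
    rw [← exp_neg_logRate]
    exact Real.exp_le_exp.2 (by linarith [h.1])
  refine ⟨√(exp (-α) - 1), ⟨Real.sqrt_nonneg _, ?_⟩, ?_⟩
  · rw [Real.sqrt_le_left hA]
    linarith
  · rw [logRate, Real.sq_sqrt (by linarith), add_sub_cancel, Real.log_exp, neg_neg]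

end

/-- (Time-varying peak-power.) If `Ω₂` is nonempty and there is a
Slater point `(x₁, x₂) ∈ [0,A₁]×[0,A₂]` with `p₁x₁² + p₂x₂² < P` and
`p₁ℰ(x₁) + p₂ℰ(x₂) > E_req`, then any maximizer `F*` of `I` over `Ω₂` has finite
topological support contained in `[0,A₁]×[0,A₂]`. -/
theorem stmt8 (A1 A2 p1 p2 P B h2 Ereq : ℝ) (hA1 : 0 < A1) (hA2 : 0 < A2)
    (hp1 : 0 < p1) (hp2 : 0 < p2) (hp : p1 + p2 = 1)
    (hP : 0 < P) (hB : 0 < B) (hh2 : 0 < h2)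
    (hne : ∃ F : Measure (ℝ × ℝ), Feas2 A1 A2 p1 p2 P B h2 Ereq F)
    (hslater : ∃ x ∈ Set.Icc (0 : ℝ) A1 ×ˢ Set.Icc (0 : ℝ) A2,
      p1 * x.1 ^ 2 + p2 * x.2 ^ 2 < P ∧ Ereq < p1 * EH B h2 x.1 + p2 * EH B h2 x.2)
    (Fstar : Measure (ℝ × ℝ)) (hFstar : Feas2 A1 A2 p1 p2 P B h2 Ereq Fstar)
    (hmax : ∀ F : Measure (ℝ × ℝ),
      Feas2 A1 A2 p1 p2 P B h2 Ereq F → MI2 p1 p2 F ≤ MI2 p1 p2 Fstar) :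
    (msupp Fstar).Finite ∧ msupp Fstar ⊆ Set.Icc (0 : ℝ) A1 ×ˢ Set.Icc (0 : ℝ) A2 := by
  obtain ⟨lam, mu, hle, hzero⟩ := exists_kkt hp1 hp2 hp hslater hFstar hmax
  have hD := hFstar.1
  have hs := slowDecay_log_fout hp1 hp2 hp hD
  have hG := differentiable_multC B h2 lam mu
  have hGg := multC_ofReal B h2 lam mu
  have hsub : msupp Fstar ⊆ Icc (0 : ℝ) A1 ×ˢ Icc (0 : ℝ) A2 :=
    msupp_subset_of_isClosed (isClosed_Icc.prod isClosed_Icc) hD.2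
  refine ⟨?_, hsub⟩
  have hfin := finite_zeros_pairFun hp1 hp2 hp (logRate_neg hA1) (logRate_neg hA2)
    (fun t => hs.hasDerivAt_profile hG hGg (1 + MI2 p1 p2 Fstar - lam * P + mu * Ereq) t)
    (fun t => hs.analyticAt_profile hG hGg _ t) (hs.tendsto_slope_atTop hG)
    (hs.differentiableOn_slopeC hG) (SlowDecay.slopeC_exp hG hGg)
    (fun σ _ => SlowDecay.tendsto_slopeC_vertical _ hG σ) (by
      intro α hα β hβ
      obtain ⟨x, hx, rfl⟩ := exists_logRate_eq hA1.le hα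
      obtain ⟨y, hy, rfl⟩ := exists_logRate_eq hA2.le hβ
      rw [pairFun_logRate hp1 hp2 hp hD lam mu (x, y)]
      exact neg_nonneg.2 (hle (x, y) ⟨hx, hy⟩))
  refine Set.Finite.of_finite_image (f := fun x : ℝ × ℝ => (logRate x.1, logRate x.2))
    (hfin.subset ?_) ?_
  · rintro _ ⟨x, hx, rfl⟩
    obtain ⟨h1, h2'⟩ := hsub hx
    refine ⟨⟨⟨logRate_antitone h1.1 h1.2, logRate_nonpos _⟩,
      ⟨logRate_antitone h2'.1 h2'.2, logRate_nonpos _⟩⟩, ?_⟩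
    simp only
    rw [pairFun_logRate hp1 hp2 hp hD lam mu x, hzero x hx, neg_zero]
  · intro x hx y hy hxy
    obtain ⟨hx1, hx2⟩ := hsub hx
    obtain ⟨hy1, hy2⟩ := hsub hy
    simp only [Prod.mk.injEq] at hxy
    exact Prod.ext (logRate_injOn hx1.1 hy1.1 hxy.1) (logRate_injOn hx2.1 hy2.1 hxy.2)
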